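/- Let p be an odd prime, q = p^m, and let SU(4, q) be the subgroup of SL(4, F_{q²}) consisting of all matrices g such that σ(g)ᵀ · g = 1, where σ is the q-th power Frobenius map applied entrywise. Let L = PSU(4, q) be the quotient of SU(4, q) by its center. Then L is recognizable by spectrum among covers: for every finite group H having a normal subgroup K with H/K isomorphic to L, if ω(H) = ω(L) then H is isomorphic to L. -/

import Mathlib

open Matrix

/-- The spectrum of a group: the set of orders of its elements. -/
def elementOrders (G : Type*) [Monoid G] : Set ℕ := Set.range (orderOf : G → ℕ)

/-- The special unitary group `SU(4, q)` inside `SL(4, F_{q²})`: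
matrices `g` with `σ(g)ᵀ * g = 1`, where `σ` is the `q`-th power Frobenius. -/
def SU4 (p m : ℕ) [Fact p.Prime] (F : Type*) [Field F] [Fintype F] [CharP F p]
    (hF : Fintype.card F = (p ^ m) ^ 2) :
    Subgroup (SpecialLinearGroup (Fin 4) F) where
  carrier := { g | ((g : Matrix (Fin 4) (Fin 4) F).map (iterateFrobenius F p m))ᵀ * g = 1 }
  one_mem' := by
    simp [Matrix.map_one]
  mul_mem' := by
    intro a b ha hb
    simp only [Set.mem_setOf_eq] at *
    have : ((a * b : SpecialLinearGroup (Fin 4) F) : Matrix (Fin 4) (Fin 4) F)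
        = (a : Matrix (Fin 4) (Fin 4) F) * b := rfl
    rw [this, Matrix.map_mul, transpose_mul, mul_assoc,
      ← mul_assoc ((a : Matrix (Fin 4) (Fin 4) F).map _)ᵀ, ha, one_mul, hb]
  inv_mem' := by
    intro a ha
    simp only [Set.mem_setOf_eq] at *
    set σ := iterateFrobenius F p m with hσ
    set A := (a : Matrix (Fin 4) (Fin 4) F) with hA
    have hdet : det ((A.map σ)ᵀ) = 1 := by
      rw [det_transpose, ← RingHom.mapMatrix_apply, ← RingHom.map_det, hA, a.det_coe,
        _root_.map_one]
    let M : SpecialLinearGroup (Fin 4) F := ⟨(A.map σ)ᵀ, hdet⟩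
    have h1 : M * a = 1 := Subtype.ext ha
    have h2 : ((a⁻¹ : SpecialLinearGroup (Fin 4) F) : Matrix (Fin 4) (Fin 4) F)
        = (A.map σ)ᵀ := by
      rw [← eq_inv_of_mul_eq_one_left h1]
    rw [h2]
    have hσσ : ∀ x : F, σ (σ x) = x := by
      intro x
      rw [hσ, iterateFrobenius_def, iterateFrobenius_def, ← pow_mul, ← pow_two,
        ← hF, FiniteField.pow_card]
    have h3 : ((A.map σ)ᵀ.map σ)ᵀ = A := by
      rw [← Matrix.transpose_map, transpose_transpose, Matrix.map_map]
      have : (⇑σ ∘ ⇑σ) = id := funext fun x => hσσ x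
      rw [this, Matrix.map_id]
    rw [h3]
    exact mul_eq_one_comm.mp ha

section FormGroup

variable {F : Type*} [Field F]

/-- The inclusion of `SL₄` into the monoid of matrices. -/
def slMat : SpecialLinearGroup (Fin 4) F →* Matrix (Fin 4) (Fin 4) F where
  toFun g := g
  map_one' := Matrix.SpecialLinearGroup.coe_one
  map_mul' := Matrix.SpecialLinearGroup.coe_mul

theorem slMat_injective : Function.Injective (slMat (F := F)) := Subtype.coe_injective

theorem det_slMat (g : SpecialLinearGroup (Fin 4) F) : (slMat g).det = 1 := g.2

/-- The special isometry group of the `σ`-sesquilinear form with Gram matrix `Φ`. -/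
def formGroup (σ : F →+* F) (Φ : Matrix (Fin 4) (Fin 4) F) :
    Subgroup (SpecialLinearGroup (Fin 4) F) where
  carrier := { g | ((slMat g).map σ)ᵀ * Φ * slMat g = Φ }
  one_mem' := by simp [Matrix.map_one]
  mul_mem' := by
    intro a b ha hb
    change ((slMat a).map σ)ᵀ * Φ * (slMat a) = Φ at ha
    change ((slMat b).map σ)ᵀ * Φ * (slMat b) = Φ at hb
    change ((slMat (a * b)).map σ)ᵀ * Φ * (slMat (a * b)) = Φ
    simp only [map_mul, Matrix.map_mul, transpose_mul]
    calc _ = ((slMat b).map σ)ᵀ * (((slMat a).map σ)ᵀ * Φ * (slMat a)) * (slMat b) := by simp only [mul_assoc]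
      _ = _ := by rw [ha, hb]
  inv_mem' := by
    intro a (ha : ((slMat a).map σ)ᵀ * Φ * (slMat a) = Φ)
    change ((slMat a⁻¹).map σ)ᵀ * Φ * (slMat a⁻¹) = Φ
    have h1 : (slMat a) * (slMat a⁻¹) = 1 := by
      rw [← map_mul, mul_inv_cancel, map_one]
    have h2 : ((slMat a⁻¹).map σ)ᵀ * ((slMat a).map σ)ᵀ = 1 := by
      rw [← transpose_mul, ← Matrix.map_mul, h1]; simp [Matrix.map_one]
    calc _ = ((slMat a⁻¹).map σ)ᵀ * (((slMat a).map σ)ᵀ * Φ * (slMat a)) * (slMat a⁻¹) := by rw [ha]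
      _ = (((slMat a⁻¹).map σ)ᵀ * ((slMat a).map σ)ᵀ) * Φ * ((slMat a) * (slMat a⁻¹)) := by
          simp only [mul_assoc]
      _ = _ := by rw [h1, h2]; simp

theorem mem_formGroup {σ : F →+* F} {Φ : Matrix (Fin 4) (Fin 4) F}
    {g : SpecialLinearGroup (Fin 4) F} :
    g ∈ formGroup σ Φ ↔ ((slMat g).map σ)ᵀ * Φ * (slMat g) = Φ := Iff.rfl

/-- The antidiagonal Gram matrix. -/
def antiDiag (F : Type*) [Field F] : Matrix (Fin 4) (Fin 4) F :=
  !![0, 0, 0, 1; 0, 0, 1, 0; 0, 1, 0, 0; 1, 0, 0, 0]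

theorem SU4_eq_formGroup (p m : ℕ) [Fact p.Prime] [Fintype F] [CharP F p]
    (hF : Fintype.card F = (p ^ m) ^ 2) :
    SU4 p m F hF = formGroup (iterateFrobenius F p m) 1 := by
  ext g
  rw [mem_formGroup, mul_one]
  rfl

/-- A matrix of determinant one taking the standard form to the antidiagonal one
conjugates the corresponding groups. -/
noncomputable def formGroupEquiv (σ : F →+* F) (Φ Ψ : Matrix (Fin 4) (Fin 4) F)
    (C : SpecialLinearGroup (Fin 4) F) (hC : ((slMat C).map σ)ᵀ * Φ * (slMat C) = Ψ) :
    formGroup σ Ψ ≃* formGroup σ Φ :=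
  ((MulAut.conj C).subgroupMap (formGroup σ Ψ)).trans (MulEquiv.subgroupCongr (by
    have key : ∀ g : SpecialLinearGroup (Fin 4) F, C * g * C⁻¹ ∈ formGroup σ Φ ↔
        g ∈ formGroup σ Ψ := by
      intro g
      have hinv : (slMat C⁻¹) * (slMat C) = 1 := by
        rw [← map_mul, inv_mul_cancel, map_one]
      have hinv' : (slMat C) * (slMat C⁻¹) = 1 := by
        rw [← map_mul, mul_inv_cancel, map_one]
      have hs : ((slMat C).map σ)ᵀ * ((slMat C⁻¹).map σ)ᵀ = 1 := by
        rw [← transpose_mul, ← Matrix.map_mul, hinv]; simp [Matrix.map_one]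
      have hs' : ((slMat C⁻¹).map σ)ᵀ * ((slMat C).map σ)ᵀ = 1 := by
        rw [← transpose_mul, ← Matrix.map_mul, hinv']; simp [Matrix.map_one]
      have hΦ : Φ = ((slMat C⁻¹).map σ)ᵀ * Ψ * (slMat C⁻¹) := by
        rw [← hC]
        calc Φ = 1 * Φ * 1 := by simp
          _ = (((slMat C⁻¹).map σ)ᵀ * ((slMat C).map σ)ᵀ) * Φ * ((slMat C) * (slMat C⁻¹)) := by
            rw [hs', hinv']
          _ = _ := by simp only [mul_assoc]
      have hexp : ((slMat (C * g * C⁻¹)).map σ)ᵀ * Φ * (slMat (C * g * C⁻¹)) =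
          ((slMat C⁻¹).map σ)ᵀ * (((slMat g).map σ)ᵀ * Ψ * (slMat g)) * (slMat C⁻¹) := by
        simp only [map_mul, Matrix.map_mul, transpose_mul, ← hC, mul_assoc]
      rw [mem_formGroup, mem_formGroup, hexp]
      constructor
      · intro h
        calc _ = 1 * (((slMat g).map σ)ᵀ * Ψ * (slMat g)) * 1 := by simp
          _ = (((slMat C).map σ)ᵀ * ((slMat C⁻¹).map σ)ᵀ) * (((slMat g).map σ)ᵀ * Ψ * (slMat g)) *
              ((slMat C⁻¹) * (slMat C)) := by rw [hs, hinv]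
          _ = ((slMat C).map σ)ᵀ * (((slMat C⁻¹).map σ)ᵀ * (((slMat g).map σ)ᵀ * Ψ * (slMat g)) *
              (slMat C⁻¹)) * (slMat C) := by simp only [mul_assoc]
          _ = Ψ := by rw [h, hC]
      · intro h
        rw [h, ← hΦ]
    ext x
    constructor
    · rintro ⟨g, hg, rfl⟩
      exact (key g).2 hg
    · intro hx
      refine ⟨C⁻¹ * x * C, (key _).1 (by simpa [mul_assoc] using hx), ?_⟩
      simp [MulAut.conj_apply, mul_assoc]))

theorem exists_pow_add_one_eq_neg_one [Fintype F] {q : ℕ} (hq : Odd q)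
    (hF : Fintype.card F = q ^ 2) : ∃ κ : F, κ ^ (q + 1) = -1 := by
  obtain ⟨g, hg⟩ := IsCyclic.exists_generator (α := Fˣ)
  obtain ⟨k, hk⟩ := hq
  have hcard : orderOf g = q ^ 2 - 1 := by
    rw [orderOf_eq_card_of_forall_mem_zpowers hg, Nat.card_units, Nat.card_eq_fintype_card, hF]
  have hkpos : 0 < k := by
    rcases Nat.eq_zero_or_pos k with rfl | h
    · have := Fintype.one_lt_card (α := F)
      simp [hF, hk] at this
    · exact h
  refine ⟨(g : F) ^ k, ?_⟩
  have hord : q ^ 2 - 1 = 2 * (k * (q + 1)) := by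
    rw [hk, Nat.sub_eq_iff_eq_add (by nlinarith)]; ring
  have h1 : ((g : F) ^ (k * (q + 1))) ^ 2 = 1 := by
    rw [← pow_mul, mul_comm _ 2, ← hord, ← hcard]
    rw [← Units.val_pow_eq_pow_val, pow_orderOf_eq_one, Units.val_one]
  rw [← pow_mul]
  rcases sq_eq_one_iff.1 h1 with h | h
  · exfalso
    have h2 : g ^ (k * (q + 1)) = 1 := Units.ext (by simpa using h)
    have h3 := orderOf_dvd_of_pow_eq_one h2
    rw [hcard, hord] at h3
    have := Nat.le_of_dvd (by positivity) h3
    have : 0 < k * (q + 1) := by positivity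
    omega
  · exact h

theorem exists_antiDiag_congruence [Fintype F] {q : ℕ} (hq : Odd q)
    (hF : Fintype.card F = q ^ 2) (h2 : (2 : F) ≠ 0) (σ : F →+* F)
    (hσ : ∀ x, σ x = x ^ q) :
    ∃ C : SpecialLinearGroup (Fin 4) F, ((slMat C).map σ)ᵀ * 1 * (slMat C) = antiDiag F := by
  obtain ⟨κ, hκ⟩ := exists_pow_add_one_eq_neg_one hq hF
  have hκ0 : κ ≠ 0 := by
    rintro rfl
    simp at hκ
  have hσκ : σ κ = - κ⁻¹ := by
    rw [hσ, eq_neg_iff_add_eq_zero]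
    field_simp
    rw [← pow_succ, hκ]; ring
  refine ⟨⟨!![κ⁻¹, 0, 0, -κ⁻¹ / 2; 1, 0, 0, 1 / 2; 0, 1 / 2, 1, 0; 0, -κ / 2, κ, 0], ?_⟩, ?_⟩
  · simp [det_succ_row_zero, Fin.sum_univ_succ, Fin.succAbove]
    field_simp
    ring
  · rw [mul_one, ← Matrix.ext_iff]
    simp [slMat, Fin.forall_fin_succ, antiDiag, Matrix.mul_apply, Fin.sum_univ_succ, hσκ,
      map_ofNat]
    split_ands <;> field_simp <;> ring

end FormGroup

section Reduction

open scoped IsMulCommutative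

theorem elementOrders_dvd {G : Type*} [Group G] {m n : ℕ} (hn : n ∈ elementOrders G)
    (hn0 : n ≠ 0) (h : m ∣ n) : m ∈ elementOrders G := by
  obtain ⟨x, rfl⟩ := hn
  obtain ⟨k, hk⟩ := h
  refine ⟨x ^ k, ?_⟩
  have hk0 : k ≠ 0 := by rintro rfl; rw [mul_zero] at hk; exact hn0 hk
  rw [orderOf_pow_of_dvd hk0 ⟨m, by rw [hk, mul_comm]⟩, hk]
  exact Nat.mul_div_cancel _ (Nat.pos_of_ne_zero hk0)

/-- An `L`-module arising from an elementary abelian `r`-extension of `L` all of whose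
element orders already occur in `L`. -/
structure IsSpectralModule (L : Type*) [Group L] (r : ℕ) (V : Type*) [AddCommGroup V]
    [DistribMulAction L V] : Prop where
  nsmul_eq_zero : ∀ v : V, r • v = 0
  sum_smul : ∀ x : L, r * orderOf x ∉ elementOrders L →
    ∀ v : V, ∑ i ∈ Finset.range (orderOf x), x ^ i • v = 0

theorem mul_pow_eq_prod_conjNormal {H : Type*} [Group H] (K : Subgroup H) [K.Normal]
    [IsMulCommutative K] (h : H) (k : K) (n : ℕ) :
    ((k : H) * h) ^ n = ((∏ i ∈ Finset.range n, MulAut.conjNormal (h ^ i) k : K) : H) * h ^ n := by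
  induction n with
  | zero => simp
  | succ n ih =>
    rw [pow_succ, ih, Finset.prod_range_succ, Subgroup.coe_mul, MulAut.conjNormal_apply]
    group

theorem exists_spectralModule_of_abelian {H L : Type} [Group H] [Finite H] [Group L]
    (φ : H →* L) (hφ : Function.Surjective φ) (hω : elementOrders H ⊆ elementOrders L)
    {r : ℕ} (hr : r.Prime) [IsMulCommutative φ.ker] (hne : φ.ker ≠ ⊥)
    (hexp : ∀ k ∈ φ.ker, k ^ r = 1) :
    ∃ (V : Type) (_ : AddCommGroup V) (_ : DistribMulAction L V),
      Finite V ∧ Nontrivial V ∧ IsSpectralModule L r V := by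
  have hker : φ.ker ≤ (MulAut.conjNormal (H := φ.ker)).ker := by
    intro x hx
    rw [MonoidHom.mem_ker]
    ext y
    rw [MulAut.conjNormal_apply]
    have := congrArg Subtype.val (mul_comm (⟨x, hx⟩ : φ.ker) y)
    simp only [Subgroup.coe_mul] at this
    simp [this]
  let ψ : L →* MulAut φ.ker := φ.liftOfSurjective hφ ⟨MulAut.conjNormal, hker⟩
  have hψ : ∀ h, ψ (φ h) = MulAut.conjNormal h := fun h =>
    MonoidHom.liftOfRightInverse_comp_apply φ _ (Function.rightInverse_surjInv hφ)
      ⟨MulAut.conjNormal, hker⟩ h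
  let act : DistribMulAction L (Additive φ.ker) :=
    { smul := fun l v => Additive.ofMul (ψ l v.toMul)
      one_smul := fun v => by
        change Additive.ofMul (ψ 1 v.toMul) = v
        simp
      mul_smul := fun a b v => by
        change Additive.ofMul (ψ (a * b) v.toMul) = Additive.ofMul (ψ a (ψ b v.toMul))
        simp
      smul_zero := fun a => by
        change Additive.ofMul (ψ a 1) = 0
        simp
      smul_add := fun a v w => by
        change Additive.ofMul (ψ a (v.toMul * w.toMul)) = _
        rw [map_mul]; rfl }
  have hsmul : ∀ (l : L) (v : Additive φ.ker), l • v = Additive.ofMul (ψ l v.toMul) :=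
    fun _ _ => rfl
  refine ⟨Additive φ.ker, inferInstance, act, inferInstance, ?_, ?_, ?_⟩
  · rw [Subgroup.ne_bot_iff_exists_ne_one] at hne
    obtain ⟨a, ha⟩ := hne
    exact ⟨Additive.ofMul a, 0, fun h => ha h⟩
  · intro v
    have : v.toMul ^ r = 1 := Subtype.ext (hexp _ v.toMul.2)
    exact congrArg Additive.ofMul this
  · intro x hx v
    set n := orderOf x with hn
    have key : ∀ h : H, φ h = x → h ^ n = 1 := by
      intro h hh
      have h1 : n ∣ orderOf h := by
        rw [hn, ← hh]; exact orderOf_map_dvd φ h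
      have h2 : orderOf h ∣ n * r := by
        apply orderOf_dvd_of_pow_eq_one
        rw [pow_mul]
        apply hexp
        rw [MonoidHom.mem_ker, map_pow, hh, hn, pow_orderOf_eq_one]
      obtain ⟨c, hc⟩ := h1
      have hn0 : 0 < n := by
        have := orderOf_pos h
        rcases Nat.eq_zero_or_pos n with h0 | h0
        · rw [h0] at hc; omega
        · exact h0
      rw [hc] at h2
      rcases (Nat.dvd_prime hr).1 (Nat.dvd_of_mul_dvd_mul_left hn0 h2) with rfl | rfl
      · rw [mul_one] at hc
        rw [← hc, pow_orderOf_eq_one]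
      · exfalso
        apply hx
        rw [mul_comm, ← hc]
        exact hω ⟨h, rfl⟩
    obtain ⟨h, hh⟩ := hφ x
    have h1 := key h hh
    have h2 := key (v.toMul * h) (by rw [map_mul, hh, v.toMul.2, one_mul])
    rw [mul_pow_eq_prod_conjNormal, h1, mul_one] at h2
    have h3 : ∏ i ∈ Finset.range n, MulAut.conjNormal (h ^ i) v.toMul = 1 := Subtype.ext h2
    have h4 := congrArg Additive.ofMul h3
    rw [ofMul_prod] at h4
    rw [← ofMul_one, ← h4]
    refine Finset.sum_congr rfl fun i _ => ?_
    rw [hsmul, ← hh, ← map_pow, hψ]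

theorem exists_spectralModule {L : Type} [Group L] [Finite L] (n : ℕ) :
    ∀ (H : Type) [Group H] [Finite H] (φ : H →* L), Nat.card H = n →
      Function.Surjective φ → elementOrders H ⊆ elementOrders L → φ.ker ≠ ⊥ →
      ∃ r, r.Prime ∧ ∃ (V : Type) (_ : AddCommGroup V) (_ : DistribMulAction L V),
        Finite V ∧ Nontrivial V ∧ IsSpectralModule L r V := by
  induction n using Nat.strong_induction_on with
  | _ n ih =>
  intro H _ _ φ hn hφ hω hne
  subst hn
  by_cases hmin : ∀ M : Subgroup H, M.Normal → M ≤ φ.ker → M ≠ ⊥ → M = φ.ker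
  swap
  · push Not at hmin
    obtain ⟨M, hM, hMK, hM0, hM1⟩ := hmin
    refine ih (Nat.card (H ⧸ M)) ?_ (H ⧸ M) (QuotientGroup.lift M φ hMK) rfl ?_ ?_ ?_
    · rw [Subgroup.card_eq_card_quotient_mul_card_subgroup M]
      exact lt_mul_of_one_lt_right Nat.card_pos (Subgroup.one_lt_card_iff_ne_bot M |>.2 hM0)
    · intro x
      obtain ⟨h, rfl⟩ := hφ x
      exact ⟨h, rfl⟩
    · rintro _ ⟨x, rfl⟩
      obtain ⟨h, rfl⟩ := QuotientGroup.mk_surjective x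
      exact elementOrders_dvd (hω ⟨h, rfl⟩) (orderOf_pos h).ne'
        (orderOf_map_dvd (QuotientGroup.mk' M) h)
    · intro hb
      apply hM1
      refine le_antisymm hMK fun x hx => ?_
      have : (x : H ⧸ M) ∈ (QuotientGroup.lift M φ hMK).ker := hx
      rw [hb, Subgroup.mem_bot, QuotientGroup.eq_one_iff] at this
      exact this
  have hcard : Nat.card φ.ker ≠ 1 := by rwa [Ne, Subgroup.card_eq_one]
  obtain ⟨r, hr, hrK⟩ := Nat.exists_prime_and_dvd hcard
  have : Fact r.Prime := ⟨hr⟩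
  let P : Sylow r φ.ker := default
  have hP : (P : Subgroup φ.ker) ≠ ⊥ := P.ne_bot_of_dvd_card hrK
  set Q : Subgroup H := (P : Subgroup φ.ker).map φ.ker.subtype with hQ
  have hQ0 : Q ≠ ⊥ := by
    rwa [hQ, Ne, Subgroup.map_eq_bot_iff_of_injective _ φ.ker.subtype_injective]
  have hQK : Q ≤ φ.ker := Subgroup.map_subtype_le _
  have hfr := Sylow.normalizer_sup_eq_top P
  by_cases htop : Subgroup.normalizer (Q : Set H) = ⊤
  swap
  · set N := Subgroup.normalizer (Q : Set H) with hN
    refine ih (Nat.card N) ?_ N (φ.comp N.subtype) rfl ?_ ?_ ?_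
    · refine lt_of_le_of_ne (Subgroup.card_le_card_group N) fun h => htop ?_
      exact (Subgroup.card_eq_iff_eq_top N).1 h
    · intro x
      obtain ⟨h, rfl⟩ := hφ x
      have : h ∈ N ⊔ φ.ker := by rw [hfr]; trivial
      obtain ⟨a, ha, b, hb, rfl⟩ := Subgroup.mem_sup_of_normal_right.1 this
      exact ⟨⟨a, ha⟩, by rw [map_mul, hb, mul_one]; rfl⟩
    · rintro _ ⟨x, rfl⟩
      rw [← Subgroup.orderOf_coe]
      exact hω ⟨_, rfl⟩
    · obtain ⟨x, hx⟩ := Subgroup.ne_bot_iff_exists_ne_one.1 hQ0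
      refine Subgroup.ne_bot_iff_exists_ne_one.2
        ⟨⟨⟨x, Subgroup.le_normalizer x.2⟩, hQK x.2⟩, fun h => hx ?_⟩
      exact Subtype.ext (congrArg (fun y => ((y : N) : H)) (congrArg Subtype.val h))
  have hQn : Q.Normal := Subgroup.normalizer_eq_top_iff.1 htop
  have hQe := hmin Q hQn hQK hQ0
  have hpK : IsPGroup r φ.ker := by
    rw [← hQe]
    exact P.isPGroup'.map _
  refine ⟨r, hr, ?_⟩
  let M : Subgroup H :=
    { carrier := {x | x ∈ φ.ker ∧ (∀ y ∈ φ.ker, Commute x y) ∧ x ^ r = 1}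
      one_mem' := ⟨one_mem _, fun y _ => Commute.one_left y, one_pow _⟩
      mul_mem' := by
        rintro a b ⟨ha, ha', ha''⟩ ⟨hb, hb', hb''⟩
        exact ⟨mul_mem ha hb, fun y hy => (ha' y hy).mul_left (hb' y hy), by
          rw [(ha' b hb).mul_pow, ha'', hb'', one_mul]⟩
      inv_mem' := by
        rintro a ⟨ha, ha', ha''⟩
        exact ⟨inv_mem ha, fun y hy => (ha' y hy).inv_left, by rw [inv_pow, ha'', inv_one]⟩ }
  have hMn : M.Normal := by
    constructor
    rintro a ⟨ha, ha', ha''⟩ g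
    refine ⟨(inferInstance : φ.ker.Normal).conj_mem a ha g, fun y hy => ?_, by
      rw [conj_pow, ha'']; simp⟩
    have := ha' (g⁻¹ * y * g) (by
      simpa using (inferInstance : φ.ker.Normal).conj_mem y hy g⁻¹)
    rw [commute_iff_eq] at this ⊢
    calc _ = g * (a * (g⁻¹ * y * g)) * g⁻¹ := by group
      _ = _ := by rw [this]; group
  have hM0 : M ≠ ⊥ := by
    have : Nontrivial φ.ker := (Subgroup.nontrivial_iff_ne_bot _).2 hne
    have hc := hpK.center_nontrivial
    have hdvd : r ∣ Nat.card (Subgroup.center φ.ker) := by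
      obtain ⟨k, hk⟩ := (IsPGroup.iff_card.1 (hpK.to_subgroup (Subgroup.center φ.ker)))
      rw [hk]
      refine dvd_pow_self r fun h0 => ?_
      rw [h0, pow_zero] at hk
      exact (Finite.one_lt_card (α := Subgroup.center φ.ker)).ne' hk
    obtain ⟨z, hz⟩ := exists_prime_orderOf_dvd_card' r hdvd
    refine Subgroup.ne_bot_iff_exists_ne_one.2
      ⟨⟨((z : φ.ker) : H), z.1.2, fun y hy => ?_, ?_⟩, fun h => ?_⟩
    · exact congrArg Subtype.val ((Subgroup.mem_center_iff.1 z.2 ⟨y, hy⟩).symm)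
    · have := pow_orderOf_eq_one z
      rw [hz] at this
      exact congrArg (fun y : Subgroup.center φ.ker => ((y : φ.ker) : H)) this
    · have h0 : ((z : φ.ker) : H) = 1 := congrArg Subtype.val h
      have h1 : z = 1 := Subtype.ext (Subtype.ext h0)
      rw [h1, orderOf_one] at hz
      exact hr.one_lt.ne hz
  have hMe := hmin M hMn (fun x hx => hx.1) hM0
  have : IsMulCommutative φ.ker := ⟨⟨fun a b => by
    have : (a : H) ∈ M := by rw [hMe]; exact a.2
    exact Subtype.ext (this.2.1 b b.2)⟩⟩
  refine exists_spectralModule_of_abelian φ hφ hω hr hne fun k hk => ?_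
  have : k ∈ M := by rw [hMe]; exact hk
  exact this.2.2

end Reduction

section AntiDiag

variable {F : Type*} [Field F] {σ : F →+* F}

/-- The special unitary group of the antidiagonal Hermitian form. -/
abbrev unitaryJ (σ : F →+* F) : Subgroup (SpecialLinearGroup (Fin 4) F) :=
  formGroup σ (antiDiag F)

/-- The inclusion of a form group into the monoid of matrices. -/
def mat {Φ : Matrix (Fin 4) (Fin 4) F} : formGroup σ Φ →* Matrix (Fin 4) (Fin 4) F :=
  slMat.comp (formGroup σ Φ).subtype

theorem mat_injective {Φ : Matrix (Fin 4) (Fin 4) F} :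
    Function.Injective (mat : formGroup σ Φ →* _) :=
  slMat_injective.comp Subtype.coe_injective

theorem det_mat {Φ : Matrix (Fin 4) (Fin 4) F} (g : formGroup σ Φ) : (mat g).det = 1 :=
  det_slMat _

theorem mat_form {Φ : Matrix (Fin 4) (Fin 4) F} (g : formGroup σ Φ) :
    ((mat g).map σ)ᵀ * Φ * mat g = Φ := g.2

/-- The element of a form group with a given matrix. -/
def mkForm {Φ : Matrix (Fin 4) (Fin 4) F} (M : Matrix (Fin 4) (Fin 4) F) (hd : M.det = 1)
    (h : (M.map σ)ᵀ * Φ * M = Φ) : formGroup σ Φ := ⟨⟨M, hd⟩, h⟩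

@[simp] theorem mat_mkForm {Φ : Matrix (Fin 4) (Fin 4) F} (M : Matrix (Fin 4) (Fin 4) F)
    (hd : M.det = 1) (h : (M.map σ)ᵀ * Φ * M = Φ) : mat (mkForm M hd h) = M := rfl

/-- Elements of the unipotent radical of the stabiliser of a maximal isotropic subspace. -/
def siegel (x y z : F) (hx : σ (σ x) = x) (hy : σ y = -y) (hz : σ z = -z) : unitaryJ σ :=
  mkForm !![1, 0, x, y; 0, 1, z, -σ x; 0, 0, 1, 0; 0, 0, 0, 1]
    (by simp [det_succ_row_zero, Fin.sum_univ_succ, Fin.succAbove])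
    (by
      rw [← Matrix.ext_iff]
      simp [Fin.forall_fin_succ, antiDiag, Matrix.mul_apply, Fin.sum_univ_succ, hx, hy, hz])

/-- Elements of the opposite unipotent radical. -/
def lowerSiegel (x y z : F) (hx : σ (σ x) = x) (hy : σ y = -y) (hz : σ z = -z) : unitaryJ σ :=
  mkForm !![1, 0, 0, 0; 0, 1, 0, 0; x, z, 1, 0; y, -σ x, 0, 1]
    (by simp [det_succ_row_zero, Fin.sum_univ_succ, Fin.succAbove])
    (by
      rw [← Matrix.ext_iff]
      simp [Fin.forall_fin_succ, antiDiag, Matrix.mul_apply, Fin.sum_univ_succ, hx, hy, hz])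

/-- Elements of the Levi subgroup stabilising two complementary maximal isotropic subspaces. -/
def levi (hσ : ∀ x, σ (σ x) = x) (a b c d D : F) (hD : a * d - b * c = D) (h0 : D ≠ 0)
    (hσD : σ D = D) : unitaryJ σ :=
  mkForm !![a, b, 0, 0; c, d, 0, 0; 0, 0, σ a / D, -σ b / D; 0, 0, -σ c / D, σ d / D]
    (by
      have hD' := congrArg σ hD
      simp only [map_sub, map_mul, hσD] at hD'
      simp [det_succ_row_zero, Fin.sum_univ_succ, Fin.succAbove]
      field_simp
      linear_combination (σ a * σ d - σ b * σ c) * hD + D * hD')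
    (by
      have hD' := congrArg σ hD
      simp only [map_sub, map_mul, hσD] at hD'
      rw [← Matrix.ext_iff]
      simp [Fin.forall_fin_succ, antiDiag, Matrix.mul_apply, Fin.sum_univ_succ, hσ, hσD]
      split_ands <;> field_simp <;>
        first | ring1 | linear_combination hD' | linear_combination hD)

end AntiDiag

section AntiDiag

variable {F : Type*} [Field F] {σ : F →+* F}

@[simp] theorem mat_siegel (x y z : F) (hx : σ (σ x) = x) (hy : σ y = -y) (hz : σ z = -z) :
    mat (siegel x y z hx hy hz) =
      !![1, 0, x, y; 0, 1, z, -σ x; 0, 0, 1, 0; 0, 0, 0, 1] := rfl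

@[simp] theorem mat_lowerSiegel (x y z : F) (hx : σ (σ x) = x) (hy : σ y = -y)
    (hz : σ z = -z) : mat (lowerSiegel x y z hx hy hz) =
      !![1, 0, 0, 0; 0, 1, 0, 0; x, z, 1, 0; y, -σ x, 0, 1] := rfl

@[simp] theorem mat_levi (hσ : ∀ x, σ (σ x) = x) (a b c d D : F) (hD : a * d - b * c = D)
    (h0 : D ≠ 0) (hσD : σ D = D) : mat (levi hσ a b c d D hD h0 hσD) =
      !![a, b, 0, 0; c, d, 0, 0; 0, 0, σ a / D, -σ b / D; 0, 0, -σ c / D, σ d / D] := rfl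

theorem mem_center_of_scalar {Φ : Matrix (Fin 4) (Fin 4) F} {g : formGroup σ Φ} {ζ : F}
    (h : mat g = ζ • (1 : Matrix (Fin 4) (Fin 4) F)) :
    g ∈ Subgroup.center (formGroup σ Φ) := by
  rw [Subgroup.mem_center_iff]
  intro x
  apply mat_injective
  rw [map_mul, map_mul, h]
  simp

theorem exists_scalar_of_mem_center (hσ : ∀ x, σ (σ x) = x) {ε : F} (hε : σ ε = -ε)
    (hε0 : ε ≠ 0) {g : unitaryJ σ} (hg : g ∈ Subgroup.center (unitaryJ σ)) :
    ∃ ζ : F, mat g = ζ • (1 : Matrix (Fin 4) (Fin 4) F) := by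
  rw [Subgroup.mem_center_iff] at hg
  have key : ∀ x : unitaryJ σ, ∀ i j, (mat x * mat g) i j = (mat g * mat x) i j := by
    intro x i j
    rw [← map_mul, hg, map_mul]
  set M := mat g
  have h0 : σ (σ 0) = (0 : F) := hσ 0
  have h0' : σ (0 : F) = -0 := by simp
  have e1 := key (siegel 0 ε 0 h0 hε h0')
  have e2 := key (siegel 0 0 ε h0 h0' hε)
  have e3 := key (lowerSiegel 0 ε 0 h0 hε h0')
  have e4 := key (lowerSiegel 0 0 ε h0 h0' hε)
  have e5 := key (levi hσ 1 1 0 1 1 (by ring) one_ne_zero (map_one σ)) 0 1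
  simp [Fin.forall_fin_succ, Matrix.mul_apply, Fin.sum_univ_succ, hε0] at e1 e2 e3 e4 e5
  refine ⟨M 0 0, ?_⟩
  rw [← Matrix.ext_iff]
  simp_all [Fin.forall_fin_succ, mul_comm]

end AntiDiag

section UnitaryField

/-- A finite field of order `q²`, where `q = p ^ m` is odd, and its automorphism `x ↦ x ^ q`. -/
structure IsUnitaryField (F : Type*) [Field F] (p m q : ℕ) (σ : F →+* F) : Prop where
  prime : p.Prime
  odd : Odd p
  charP : CharP F p
  m_pos : 0 < m
  q_eq : q = p ^ m
  finite : Finite F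
  card : Nat.card F = q ^ 2
  conj : ∀ x, σ x = x ^ q

namespace IsUnitaryField

variable {F : Type*} [Field F] {p m q : ℕ} {σ : F →+* F}

theorem pow_card (h : IsUnitaryField F p m q σ) (x : F) : x ^ q ^ 2 = x := by
  have := h.finite
  rw [← h.card]
  have := Fintype.ofFinite F
  rw [Nat.card_eq_fintype_card, FiniteField.pow_card]

theorem invol (h : IsUnitaryField F p m q σ) (x : F) : σ (σ x) = x := by
  rw [h.conj, h.conj, ← pow_mul, ← sq, h.pow_card]

theorem q_odd (h : IsUnitaryField F p m q σ) : Odd q := by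
  rw [h.q_eq]; exact h.odd.pow

theorem p_ge (h : IsUnitaryField F p m q σ) : 3 ≤ p := by
  have := h.prime.two_le
  have := h.odd
  rcases this with ⟨k, hk⟩
  omega

theorem p_le_q (h : IsUnitaryField F p m q σ) : p ≤ q := by
  rw [h.q_eq]; exact Nat.le_self_pow h.m_pos.ne' p

theorem q_ge (h : IsUnitaryField F p m q σ) : 3 ≤ q := h.p_ge.trans h.p_le_q

theorem p_dvd_q (h : IsUnitaryField F p m q σ) : p ∣ q := by
  rw [h.q_eq]; exact dvd_pow_self p h.m_pos.ne'

theorem two_ne_zero (h : IsUnitaryField F p m q σ) : (2 : F) ≠ 0 := by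
  have := h.charP
  intro h2
  have h3 : ((2 : ℕ) : F) = 0 := by exact_mod_cast h2
  rw [CharP.cast_eq_zero_iff F p] at h3
  have := Nat.le_of_dvd (by norm_num) h3
  have := h.p_ge
  omega

/-- Powers of a primitive element give elements of every order dividing `q² - 1`. -/
theorem exists_orderOf (h : IsUnitaryField F p m q σ) {k : ℕ} (hk : k ∣ q ^ 2 - 1) :
    ∃ x : F, orderOf x = k := by
  have := h.finite
  have := Fintype.ofFinite F
  obtain ⟨g, hg⟩ := IsCyclic.exists_generator (α := Fˣ)
  have hcard : orderOf g = q ^ 2 - 1 := by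
    rw [orderOf_eq_card_of_forall_mem_zpowers hg, Nat.card_units, h.card]
  have hpos : 0 < q ^ 2 - 1 := by
    have := h.q_ge
    have : 3 ^ 2 ≤ q ^ 2 := Nat.pow_le_pow_left this 2
    omega
  obtain ⟨c, hc⟩ := hk
  have hc0 : c ≠ 0 := by rintro rfl; omega
  refine ⟨((g ^ c : Fˣ) : F), ?_⟩
  rw [orderOf_units, orderOf_pow_of_dvd hc0 ⟨k, by rw [hcard, hc, mul_comm]⟩, hcard, hc]
  exact Nat.mul_div_cancel _ (Nat.pos_of_ne_zero hc0)

theorem exists_conj_eq_neg (h : IsUnitaryField F p m q σ) : ∃ ε : F, ε ≠ 0 ∧ σ ε = -ε := by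
  obtain ⟨k, hk⟩ := h.q_odd
  have hq := h.q_ge
  have hord : 2 * (q - 1) ∣ q ^ 2 - 1 := by
    refine ⟨k + 1, ?_⟩
    have : q - 1 = 2 * k := by omega
    rw [this, hk, Nat.sub_eq_iff_eq_add (by nlinarith)]
    ring
  obtain ⟨ε, hε⟩ := h.exists_orderOf hord
  have hε0 : ε ≠ 0 := by
    rintro rfl
    rw [orderOf_zero] at hε
    omega
  refine ⟨ε, hε0, ?_⟩
  have h1 : (ε ^ (q - 1)) ^ 2 = 1 := by
    rw [← pow_mul, mul_comm, ← hε, pow_orderOf_eq_one]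
  rw [h.conj]
  rcases sq_eq_one_iff.1 h1 with h2 | h2
  · exfalso
    have := Nat.le_of_dvd (by omega) (orderOf_dvd_of_pow_eq_one h2)
    omega
  · calc ε ^ q = ε ^ (q - 1) * ε := by rw [← pow_succ]; congr 1; omega
      _ = -ε := by rw [h2]; ring

end IsUnitaryField

variable {F : Type*} [Field F] {p m q : ℕ} {σ : F →+* F}

/-- The projective special unitary group of the antidiagonal Hermitian form. -/
abbrev projUnitary (σ : F →+* F) : Type _ := unitaryJ σ ⧸ Subgroup.center (unitaryJ σ)

theorem scalar_pow_eq_one {g : unitaryJ σ} {ζ : F}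
    (hg : mat g = ζ • (1 : Matrix (Fin 4) (Fin 4) F)) : ζ ^ 4 = 1 := by
  have := det_mat g
  rw [hg, det_smul] at this
  simpa using this

theorem scalar_mul_conj {g : unitaryJ σ} {ζ : F}
    (hg : mat g = ζ • (1 : Matrix (Fin 4) (Fin 4) F)) : σ ζ * ζ = 1 := by
  have := congrFun (congrFun (mat_form g) 0) 3
  rw [hg] at this
  simpa [antiDiag, Matrix.mul_apply, Fin.sum_univ_four] using this

theorem IsUnitaryField.mk_eq_one_iff (h : IsUnitaryField F p m q σ) (g : unitaryJ σ) :
    (g : projUnitary σ) = 1 ↔ ∃ ζ : F, mat g = ζ • (1 : Matrix (Fin 4) (Fin 4) F) := by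
  obtain ⟨ε, h0, hε⟩ := h.exists_conj_eq_neg
  rw [QuotientGroup.eq_one_iff]
  exact ⟨exists_scalar_of_mem_center h.invol hε h0, fun ⟨ζ, hζ⟩ => mem_center_of_scalar hζ⟩

theorem IsUnitaryField.orderOf_dvd_iff (h : IsUnitaryField F p m q σ) (g : unitaryJ σ) (k : ℕ) :
    orderOf (g : projUnitary σ) ∣ k ↔
      ∃ ζ : F, mat g ^ k = ζ • (1 : Matrix (Fin 4) (Fin 4) F) := by
  rw [orderOf_dvd_iff_pow_eq_one, ← QuotientGroup.mk_pow, h.mk_eq_one_iff, map_pow]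

theorem IsUnitaryField.pow_eq_one_of_dvd (h : IsUnitaryField F p m q σ) (g : unitaryJ σ) {k : ℕ}
    (hk : orderOf (g : projUnitary σ) ∣ k) : mat g ^ (k * 4) = 1 := by
  obtain ⟨ζ, hζ⟩ := (h.orderOf_dvd_iff g k).1 hk
  rw [← map_pow] at hζ
  rw [pow_mul, ← map_pow, hζ, smul_pow, scalar_pow_eq_one hζ, one_pow, one_smul]

end UnitaryField

section Diagonalization

variable {K : Type*} [Field K] {n : ℕ}

theorem exists_diagonal_of_pow_eq_one [IsAlgClosed K] (X : Matrix (Fin n) (Fin n) K) {k : ℕ}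
    (hX : X ^ k = 1) (hk : (k : K) ≠ 0) :
    ∃ (S : Matrix (Fin n) (Fin n) K) (ν : Fin n → K), S.det ≠ 0 ∧
      X * S = S * diagonal ν := by
  classical
  set f : Module.End K (Fin n → K) := toLin' X with hf
  have hfk : f ^ k = 1 := by
    rw [hf, ← toLin'_pow, hX, toLin'_one]
    rfl
  have hss : f.IsSemisimple := by
    refine Module.End.isSemisimple_of_squarefree_aeval_eq_zero
      (p := (Polynomial.X ^ k - 1 : Polynomial K)) ?_ ?_
    · exact (Polynomial.X_pow_sub_one_separable_iff.2 hk).squarefree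
    · simp [hfk]
  let eigenDecomp := DirectSum.isInternal_submodule_of_iSupIndep_of_iSup_eq_top
    f.eigenspaces_iSupIndep hss.iSup_eigenspace_eq_top
  let v := eigenDecomp.collectedBasis fun μ ↦ Module.finBasis K (f.eigenspace μ)
  have hcard := Module.finrank_eq_nat_card_basis v
  rw [Module.finrank_fin_fun] at hcard
  have := Module.Finite.finite_basis v
  let e := (Finite.equivFinOfCardEq hcard.symm)
  refine ⟨of fun i j => v (e.symm j) i, fun j => (e.symm j).1, ?_, ?_⟩
  · have hu : IsUnit (of fun i j => v (e.symm j) i : Matrix (Fin n) (Fin n) K) := by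
      rw [← linearIndependent_cols_iff_isUnit]
      exact v.linearIndependent.comp _ e.symm.injective
    exact ((isUnit_iff_isUnit_det _).1 hu).ne_zero
  · ext i j
    rw [mul_diagonal]
    have h1 : f (v (e.symm j)) = (e.symm j).1 • v (e.symm j) :=
      Module.End.mem_eigenspace_iff.mp (eigenDecomp.collectedBasis_mem _ (e.symm j))
    have h2 := congrFun h1 i
    exact h2.trans (mul_comm _ _)

theorem exists_perm_of_det_ne_zero (Y : Matrix (Fin n) (Fin n) K) (h : Y.det ≠ 0) :
    ∃ π : Equiv.Perm (Fin n), ∀ j, Y (π j) j ≠ 0 := by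
  rw [det_apply] at h
  obtain ⟨π, -, hπ⟩ := Finset.exists_ne_zero_of_sum_ne_zero h
  refine ⟨π, fun j hj => hπ ?_⟩
  have : ∏ i, Y (π i) i = 0 := Finset.prod_eq_zero (Finset.mem_univ j) hj
  rw [this, smul_zero]

/-- The eigenvalues of isometries of a sesquilinear form that are diagonal in a common basis
are permuted by `x ↦ φ(x)⁻¹`, uniformly in the isometry. -/
theorem exists_perm_eigenvalues (φ : K →+* K) (Φ S : Matrix (Fin n) (Fin n) K)
    (hΦ : Φ.det ≠ 0) (hS : S.det ≠ 0) :
    ∃ π : Equiv.Perm (Fin n), ∀ (A : Matrix (Fin n) (Fin n) K) (μ : Fin n → K),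
      (A.map φ)ᵀ * Φ * A = Φ → A * S = S * diagonal μ → ∀ j, φ (μ j) * μ (π j) = 1 := by
  have hdet : ((S.map φ)ᵀ * Φ * S).det ≠ 0 := by
    rw [det_mul, det_mul, det_transpose, ← RingHom.mapMatrix_apply, ← RingHom.map_det]
    exact mul_ne_zero (mul_ne_zero (by simpa using hS) hΦ) hS
  obtain ⟨π, hπ⟩ := exists_perm_of_det_ne_zero _ hdet
  refine ⟨π.symm, fun A μ hA hAS j => ?_⟩
  have hy := hπ (π.symm j)
  rw [Equiv.apply_symm_apply] at hy
  have h1 : (diagonal (φ ∘ μ)) * ((S.map φ)ᵀ * Φ * S) * diagonal μ = (S.map φ)ᵀ * Φ * S := by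
    have h2 : (diagonal (φ ∘ μ)) * (S.map φ)ᵀ = (S.map φ)ᵀ * (A.map φ)ᵀ := by
      rw [← transpose_mul, ← Matrix.map_mul, hAS, Matrix.map_mul, transpose_mul,
        diagonal_map (map_zero φ), diagonal_transpose]
      rfl
    calc _ = (diagonal (φ ∘ μ) * (S.map φ)ᵀ) * Φ * (S * diagonal μ) := by
          simp only [Matrix.mul_assoc]
      _ = (S.map φ)ᵀ * ((A.map φ)ᵀ * Φ * A) * S := by
          rw [h2, ← hAS]; simp only [Matrix.mul_assoc]
      _ = _ := by rw [hA]
  have h3 := congrFun (congrFun h1 j) (π.symm j)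
  rw [mul_diagonal, diagonal_mul, Function.comp_apply] at h3
  refine mul_left_cancel₀ hy ?_
  linear_combination h3

theorem exists_diagonal_of_commute {A B S : Matrix (Fin n) (Fin n) K} {ν : Fin n → K}
    (hS : S.det ≠ 0) (hA : A * S = S * diagonal ν) (hν : Function.Injective ν)
    (hAB : A * B = B * A) : ∃ μ : Fin n → K, B * S = S * diagonal μ := by
  have hu : IsUnit S.det := hS.isUnit
  set B' := S⁻¹ * B * S with hB'
  have hSB : S * B' = B * S := by
    rw [hB', Matrix.mul_assoc, mul_nonsing_inv_cancel_left _ _ hu]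
  have hc : diagonal ν * B' = B' * diagonal ν := by
    have h1 : S * (diagonal ν * B') = S * (B' * diagonal ν) := by
      rw [← Matrix.mul_assoc, ← hA, Matrix.mul_assoc, hSB, ← Matrix.mul_assoc, hAB,
        Matrix.mul_assoc, hA, ← Matrix.mul_assoc, ← hSB, Matrix.mul_assoc]
    have h2 := congrArg (S⁻¹ * ·) h1
    simpa only [nonsing_inv_mul_cancel_left _ _ hu] using h2
  refine ⟨fun i => B' i i, ?_⟩
  rw [← hSB]
  congr 1
  ext i j
  rcases eq_or_ne i j with rfl | hij
  · simp
  · rw [diagonal_apply_ne _ hij]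
    have h1 := congrFun (congrFun hc i) j
    rw [mul_diagonal, diagonal_mul] at h1
    have h2 : (ν i - ν j) * B' i j = 0 := by linear_combination h1
    rcases mul_eq_zero.1 h2 with h3 | h3
    · exact absurd (hν (sub_eq_zero.1 h3)) hij
    · exact h3

theorem pow_mul_eq_mul_diagonal {A S : Matrix (Fin n) (Fin n) K} {ν : Fin n → K}
    (hA : A * S = S * diagonal ν) (k : ℕ) : A ^ k * S = S * diagonal (ν ^ k) := by
  induction k with
  | zero => simp
  | succ k ih =>
    rw [pow_succ, Matrix.mul_assoc, hA, ← Matrix.mul_assoc, ih, Matrix.mul_assoc,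
      diagonal_mul_diagonal, pow_succ]
    rfl

theorem eq_scalar_of_mul_eq_mul_diagonal {F : Type*} [Field F] [Algebra F K] [NeZero n]
    {M : Matrix (Fin n) (Fin n) F} {S : Matrix (Fin n) (Fin n) K} (hS : S.det ≠ 0) {c : K}
    (hM : M.map (algebraMap F K) * S = S * diagonal fun _ => c) :
    ∃ ζ : F, M = ζ • (1 : Matrix (Fin n) (Fin n) F) := by
  have h1 : M.map (algebraMap F K) = diagonal fun _ => c := by
    have h2 : S * diagonal (fun _ => c) = diagonal (fun _ => c) * S := by
      ext i j; simp [mul_comm]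
    rw [h2] at hM
    have := congrArg (· * S⁻¹) hM
    simpa only [mul_nonsing_inv_cancel_right _ _ hS.isUnit] using this
  refine ⟨M 0 0, ?_⟩
  ext i j
  apply (algebraMap F K).injective
  have h3 : ∀ i j, algebraMap F K (M i j) = diagonal (fun _ => c) i j :=
    fun i j => congrFun (congrFun h1 i) j
  rcases eq_or_ne i j with rfl | hij
  · rw [h3, diagonal_apply_eq, Matrix.smul_apply, one_apply_eq, smul_eq_mul, mul_one, h3,
      diagonal_apply_eq]
  · rw [h3, diagonal_apply_ne _ hij, Matrix.smul_apply, one_apply_ne hij, smul_zero, map_zero]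

end Diagonalization

section UnitaryEigenvalues

variable {F : Type*} [Field F] {p m q : ℕ} {σ : F →+* F}

theorem det_antiDiag : (antiDiag F).det = 1 := by
  simp [antiDiag, det_succ_row_zero, Fin.sum_univ_succ, Fin.succAbove]
  norm_num

theorem IsUnitaryField.exists_perm (h : IsUnitaryField F p m q σ)
    {S : Matrix (Fin 4) (Fin 4) (AlgebraicClosure F)} (hS : S.det ≠ 0) :
    ∃ π : Equiv.Perm (Fin 4), ∀ (g : unitaryJ σ) (μ : Fin 4 → AlgebraicClosure F),
      (mat g).map (algebraMap F (AlgebraicClosure F)) * S = S * diagonal μ →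
      (∀ j, μ j ^ q * μ (π j) = 1) ∧ ∏ j, μ j = 1 := by
  have := h.charP
  have := Fact.mk h.prime
  have : CharP (AlgebraicClosure F) p := charP_of_injective_algebraMap
    (algebraMap F (AlgebraicClosure F)).injective p
  set ι := algebraMap F (AlgebraicClosure F)
  have hΦ : ((antiDiag F).map ι).det ≠ 0 := by
    rw [← RingHom.mapMatrix_apply, ← RingHom.map_det, det_antiDiag, map_one]
    exact one_ne_zero
  obtain ⟨π, hπ⟩ := exists_perm_eigenvalues (iterateFrobenius (AlgebraicClosure F) p m)
    ((antiDiag F).map ι) S hΦ hS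
  refine ⟨π, fun g μ hg => ⟨fun j => ?_, ?_⟩⟩
  · have h1 : (((mat g).map ι).map (iterateFrobenius (AlgebraicClosure F) p m))ᵀ *
        (antiDiag F).map ι * (mat g).map ι = (antiDiag F).map ι := by
      have h2 : ((mat g).map ι).map (iterateFrobenius (AlgebraicClosure F) p m) =
          ((mat g).map σ).map ι := by
        ext i j
        simp [iterateFrobenius_def, h.conj, h.q_eq]
      rw [h2, ← transpose_map, ← Matrix.map_mul, ← Matrix.map_mul, mat_form]
    have h3 := hπ _ μ h1 hg j
    rwa [iterateFrobenius_def, ← h.q_eq] at h3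
  · have h1 := congrArg det hg
    rw [det_mul, det_mul, det_diagonal, ← RingHom.mapMatrix_apply, ← RingHom.map_det, det_mat,
      map_one, one_mul] at h1
    exact mul_left_cancel₀ hS (by rw [← h1, mul_one])

theorem IsUnitaryField.exists_diagonal (h : IsUnitaryField F p m q σ) (x : unitaryJ σ) {k : ℕ}
    (hx : mat x ^ k = 1) (hk : ¬ p ∣ k) :
    ∃ (S : Matrix (Fin 4) (Fin 4) (AlgebraicClosure F)) (ν : Fin 4 → AlgebraicClosure F),
      S.det ≠ 0 ∧ (mat x).map (algebraMap F (AlgebraicClosure F)) * S = S * diagonal ν := by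
  have := h.charP
  apply exists_diagonal_of_pow_eq_one (k := k)
  · rw [← Matrix.map_pow, hx]
    simp [Matrix.map_one]
  · have : CharP (AlgebraicClosure F) p := charP_of_injective_algebraMap
      (algebraMap F (AlgebraicClosure F)).injective p
    rwa [Ne, CharP.cast_eq_zero_iff (AlgebraicClosure F) p]

end UnitaryEigenvalues

section Nilpotent

theorem pow_finrank_eq_zero_of_isNilpotent {K : Type*} [Field K] {n : ℕ}
    {N : Matrix (Fin n) (Fin n) K} (hN : IsNilpotent N) : N ^ n = 0 := by
  have h1 : IsNilpotent (toLin' N) := by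
    obtain ⟨k, hk⟩ := hN
    exact ⟨k, by rw [← toLin'_pow, hk, map_zero]⟩
  have h2 := LinearMap.aeval_self_charpoly (toLin' N)
  rw [h1.charpoly_eq_X_pow_finrank, Module.finrank_fin_fun, map_pow, Polynomial.aeval_X,
    ← toLin'_pow] at h2
  exact toLin'.injective (by rw [h2, map_zero])

/-- Endomorphisms commuting with a regular nilpotent endomorphism have only one eigenvalue. -/
theorem exists_sub_smul_pow_eq_zero {K V : Type*} [Field K] [AddCommGroup V] [Module K V]
    (hV : Module.finrank K V = 4) {f g : Module.End K V} (h4 : f ^ 4 = 0) (h3 : f ^ 3 ≠ 0)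
    (hfg : Commute f g) : ∃ a : K, (g - a • 1) ^ 4 = 0 := by
  obtain ⟨v, hv⟩ : ∃ v, (f ^ 3) v ≠ 0 := by
    by_contra! h
    exact h3 (LinearMap.ext h)
  have hzero : ∀ k, 4 ≤ k → ∀ x : V, (f ^ k) x = 0 := fun k hk x => by
    rw [pow_eq_zero_of_le hk h4, LinearMap.zero_apply]
  have happ : ∀ i j, (f ^ i) ((f ^ j) v) = (f ^ (i + j)) v := fun i j => by
    rw [pow_add, Module.End.mul_apply]
  have hli : LinearIndependent K fun i : Fin 4 => (f ^ (i : ℕ)) v := by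
    rw [Fintype.linearIndependent_iff]
    intro c hc
    rw [Fin.sum_univ_four] at hc
    simp only [Fin.val_zero, Fin.val_one, Fin.val_two, Fin.isValue,
      show ((3 : Fin 4) : ℕ) = 3 from rfl] at hc
    have e := fun k : ℕ => congrArg (f ^ k : Module.End K V) hc
    simp only [map_add, map_smul, happ, map_zero] at e
    have c0 : c 0 = 0 := by
      have := e 3
      simp only [hzero _ (by norm_num : 4 ≤ 3 + 1), hzero _ (by norm_num : 4 ≤ 3 + 2),
        hzero _ (by norm_num : 4 ≤ 3 + 3), smul_zero, add_zero] at this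
      exact (smul_eq_zero.1 this).resolve_right hv
    have c1 : c 1 = 0 := by
      have := e 2
      simp only [c0, zero_smul, zero_add, hzero _ (by norm_num : 4 ≤ 2 + 2),
        hzero _ (by norm_num : 4 ≤ 2 + 3), smul_zero, add_zero] at this
      exact (smul_eq_zero.1 this).resolve_right hv
    have c2 : c 2 = 0 := by
      have := e 1
      simp only [c0, c1, zero_smul, zero_add,
        hzero _ (by norm_num : 4 ≤ 1 + 3), smul_zero, add_zero] at this
      exact (smul_eq_zero.1 this).resolve_right hv
    have c3 : c 3 = 0 := by
      have := e 0
      simp only [c0, c1, c2, zero_smul, zero_add] at this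
      exact (smul_eq_zero.1 this).resolve_right hv
    exact fun i => by fin_cases i <;> assumption
  let b := basisOfLinearIndependentOfCardEqFinrank hli (by simp [hV])
  have hb : ∀ i, b i = (f ^ (i : ℕ)) v := fun i => by
    simp [b]
  let c := b.repr (g v)
  have hgv : g v = (∑ i : Fin 4, c i • f ^ (i : ℕ)) v := by
    rw [LinearMap.sum_apply]
    conv_lhs => rw [← b.sum_repr (g v)]
    exact Finset.sum_congr rfl fun i _ => by rw [hb]; rfl
  have hg : g = ∑ i : Fin 4, c i • f ^ (i : ℕ) := by
    refine b.ext fun i => ?_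
    have h1 : Commute (f ^ (i : ℕ)) (∑ i : Fin 4, c i • f ^ (i : ℕ)) :=
      Commute.sum_right _ _ _ fun j _ => ((Commute.refl f).pow_pow _ _).smul_right _
    rw [hb, ← Module.End.mul_apply, ← Module.End.mul_apply, ← (hfg.pow_left i).eq, ← h1.eq,
      Module.End.mul_apply, Module.End.mul_apply, hgv]
  refine ⟨c 0, ?_⟩
  have h5 : g - c 0 • 1 = f * (c 1 • 1 + c 2 • f + c 3 • f ^ 2) := by
    rw [hg, Fin.sum_univ_four]
    simp only [Fin.val_zero, Fin.val_one, Fin.val_two, Fin.isValue,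
      show ((3 : Fin 4) : ℕ) = 3 from rfl, mul_add, mul_smul_comm, mul_one, pow_zero, pow_one,
      ← pow_succ', ← sq]
    abel
  have h6 : Commute f (c 1 • 1 + c 2 • f + c 3 • f ^ 2) :=
    (((Commute.one_right f).smul_right _).add_right ((Commute.refl f).smul_right _)).add_right
      (((Commute.refl f).pow_right 2).smul_right _)
  rw [h5, h6.mul_pow, h4, zero_mul]

end Nilpotent

namespace IsUnitaryField

variable {F : Type*} [Field F] {p m q : ℕ} {σ : F →+* F}

theorem isNilpotent_sub_one (h : IsUnitaryField F p m q σ) {u : Matrix (Fin 4) (Fin 4) F} {k : ℕ}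
    (hu : u ^ p ^ k = 1) : IsNilpotent (u - 1) := by
  have := h.charP
  have := Fact.mk h.prime
  exact ⟨p ^ k, by rw [sub_pow_char_pow_of_commute p _ (Commute.one_right u), hu, one_pow, sub_self]⟩

theorem sq_notMem_elementOrders (h : IsUnitaryField F p m q σ) (hp : 5 ≤ p) :
    p * p ∉ elementOrders (projUnitary σ) := by
  rintro ⟨x, hx⟩
  obtain ⟨y, rfl⟩ := QuotientGroup.mk_surjective x
  have := h.charP
  have := Fact.mk h.prime
  have h1 := h.pow_eq_one_of_dvd y hx.dvd
  have h2 : (mat y ^ 4) ^ p ^ 2 = 1 := by rw [← pow_mul, mul_comm, sq, h1]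
  have h3 := pow_finrank_eq_zero_of_isNilpotent (h.isNilpotent_sub_one h2)
  have h4 : (mat y ^ 4 - 1) ^ p = 0 := pow_eq_zero_of_le (by omega) h3
  rw [sub_pow_char_of_commute p (Commute.one_right _), one_pow, ← pow_mul, sub_eq_zero] at h4
  have h5 : p * p ∣ p * 4 := by
    rw [← hx, mul_comm p, h.orderOf_dvd_iff]
    exact ⟨1, by rw [h4, one_smul]⟩
  have := Nat.le_of_dvd (by norm_num) (Nat.dvd_of_mul_dvd_mul_left h.prime.pos h5)
  omega

theorem eighteen_notMem_elementOrders (h : IsUnitaryField F 3 m q σ) :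
    18 ∉ elementOrders (projUnitary σ) := by
  rintro ⟨x, hx⟩
  obtain ⟨y, rfl⟩ := QuotientGroup.mk_surjective x
  have := h.charP
  have := Fact.mk h.prime
  have h1 := h.pow_eq_one_of_dvd y hx.dvd
  have h2 : (mat y ^ 8) ^ 3 ^ 2 = 1 := by rw [← pow_mul, ← h1]; norm_num
  have h4 := pow_finrank_eq_zero_of_isNilpotent (h.isNilpotent_sub_one h2)
  have h3 : (mat y ^ 8 - 1) ^ 3 ≠ 0 := by
    intro h3
    rw [sub_pow_char_of_commute 3 (Commute.one_right _), one_pow, ← pow_mul, sub_eq_zero] at h3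
    have : 18 ∣ 24 := by
      rw [← hx, h.orderOf_dvd_iff]
      exact ⟨1, by rw [h3, one_smul]⟩
    omega
  let T := toLinAlgEquiv' (R := F) (n := Fin 4)
  have hc : Commute (mat y ^ 8 - 1) (mat y ^ 9) :=
    (((Commute.refl _).pow_left 8).sub_left (Commute.one_left _)).pow_right 9
  obtain ⟨a, ha⟩ := exists_sub_smul_pow_eq_zero (f := T (mat y ^ 8 - 1)) (g := T (mat y ^ 9))
    (by simp) (by rw [← map_pow, h4, map_zero])
    (by rw [← map_pow]; exact fun h => h3 (T.injective (h.trans (map_zero _).symm)))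
    (hc.map T)
  have ha' : (mat y ^ 9 - a • 1) ^ 4 = 0 := by
    apply T.injective
    rw [map_zero, map_pow, map_sub, map_smul, ← ha, map_one T]
  have ha9 : (mat y ^ 9 - a • 1) ^ 3 ^ 2 = 0 := pow_eq_zero_of_le (by norm_num) ha'
  rw [sub_pow_char_pow_of_commute 3 _ ((Commute.one_right _).smul_right a), sub_eq_zero, smul_pow,
    one_pow, ← pow_mul, show 9 * 3 ^ 2 = 18 * 4 + 9 by norm_num, pow_add, h1, one_mul] at ha9
  have : 18 ∣ 9 := by
    rw [← hx, h.orderOf_dvd_iff]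
    exact ⟨_, ha9⟩
  omega

end IsUnitaryField

theorem pow_eq_one_of_mul_eq_mul_diagonal {K : Type*} [Field K] {n : ℕ}
    {A S : Matrix (Fin n) (Fin n) K} {ν : Fin n → K} (hS : S.det ≠ 0)
    (hA : A * S = S * diagonal ν) {k : ℕ} (hk : A ^ k = 1) (j : Fin n) : ν j ^ k = 1 := by
  have h2 := pow_mul_eq_mul_diagonal hA k
  rw [hk, Matrix.one_mul] at h2
  have h3 : diagonal (ν ^ k) = 1 := by
    have := congrArg (S⁻¹ * ·) h2
    simpa only [nonsing_inv_mul_cancel_left _ _ hS.isUnit, nonsing_inv_mul _ hS.isUnit]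
      using this.symm
  simpa using congrFun (congrFun h3 j) j

namespace IsUnitaryField

variable {F : Type*} [Field F] {p m q : ℕ} {σ : F →+* F}

theorem orderOf_dvd_of_diagonal (h : IsUnitaryField F p m q σ) {y : unitaryJ σ}
    {S : Matrix (Fin 4) (Fin 4) (AlgebraicClosure F)} (hS : S.det ≠ 0)
    {μ : Fin 4 → AlgebraicClosure F}
    (hμ : (mat y).map (algebraMap F (AlgebraicClosure F)) * S = S * diagonal μ) {N : ℕ}
    {c : AlgebraicClosure F} (hN : ∀ j, μ j ^ N = c) : orderOf (y : projUnitary σ) ∣ N := by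
  rw [h.orderOf_dvd_iff]
  have h1 := pow_mul_eq_mul_diagonal hμ N
  rw [← Matrix.map_pow, show μ ^ N = fun _ => c from funext hN] at h1
  exact eq_scalar_of_mul_eq_mul_diagonal hS h1

theorem exists_eigenvalues_of_prime_dvd (h : IsUnitaryField F p m q σ) {s : ℕ} (hs : s.Prime)
    (hs2 : s ≠ 2) (hsp : s ≠ p) (y : unitaryJ σ) (hy : s ∣ orderOf (y : projUnitary σ)) :
    ∃ (S : Matrix (Fin 4) (Fin 4) (AlgebraicClosure F)) (ν : Fin 4 → AlgebraicClosure F)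
      (π : Equiv.Perm (Fin 4)) (j : Fin 4), S.det ≠ 0 ∧ (∀ j, ν j ^ s = 1) ∧ ν j ≠ 1 ∧
      (∀ j, ν j ^ q * ν (π j) = 1) ∧ ∏ j, ν j = 1 ∧
      (Function.Injective ν → ∃ μ : Fin 4 → AlgebraicClosure F,
        (mat y).map (algebraMap F (AlgebraicClosure F)) * S = S * diagonal μ ∧
        (∀ j, μ j ^ q * μ (π j) = 1) ∧ ∏ j, μ j = 1) := by
  obtain ⟨k, hk⟩ := hy
  have h1 := h.pow_eq_one_of_dvd y (dvd_refl _)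
  have hxs : mat (y ^ (k * 4)) ^ s = 1 := by
    rw [map_pow, ← pow_mul, ← h1, hk]
    congr 1
    ring
  have hps : ¬ p ∣ s := fun hd => hsp ((Nat.prime_dvd_prime_iff_eq h.prime hs).1 hd).symm
  obtain ⟨S, ν, hS, hν⟩ := h.exists_diagonal _ hxs hps
  obtain ⟨π, hπ⟩ := h.exists_perm hS
  obtain ⟨hψ, hprod⟩ := hπ _ _ hν
  have hνs : ∀ j, ν j ^ s = 1 := by
    refine pow_eq_one_of_mul_eq_mul_diagonal hS hν ?_
    rw [← Matrix.map_pow, hxs, Matrix.map_one _ (map_zero _) (map_one _)]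
  obtain ⟨j, hj⟩ : ∃ j, ν j ≠ 1 := by
    by_contra! hall
    have h2 := (h.orderOf_dvd_iff (y ^ (k * 4)) 1).2 (by
      rw [pow_one]
      exact eq_scalar_of_mul_eq_mul_diagonal hS (by rw [hν, funext hall]))
    rw [Nat.dvd_one, orderOf_eq_one_iff, QuotientGroup.mk_pow, ← orderOf_dvd_iff_pow_eq_one,
      hk] at h2
    have hk0 : k ≠ 0 := by
      rintro rfl
      have := h.finite
      have : Finite (SpecialLinearGroup (Fin 4) F) := Subtype.finite
      rw [mul_zero] at hk
      exact (orderOf_pos _).ne' hk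
    rw [mul_comm k] at h2
    have h3 := Nat.dvd_of_mul_dvd_mul_right (Nat.pos_of_ne_zero hk0) h2
    rw [show 4 = 2 ^ 2 by norm_num] at h3
    exact hs2 ((Nat.prime_dvd_prime_iff_eq hs Nat.prime_two).1 (hs.dvd_of_dvd_pow h3))
  refine ⟨S, ν, π, j, hS, hνs, hj, hψ, hprod, fun hinj => ?_⟩
  obtain ⟨μ, hμ⟩ := exists_diagonal_of_commute hS hν hinj
    (B := (mat y).map (algebraMap F (AlgebraicClosure F))) (by
      rw [← Matrix.map_mul, ← Matrix.map_mul, map_pow, ← pow_succ, ← pow_succ'])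
  exact ⟨μ, hμ, hπ y μ hμ⟩

theorem orderOf_dvd_of_prime_dvd_sq_add_one (h : IsUnitaryField F p m q σ) {s : ℕ}
    (hs : s.Prime) (hs2 : s ≠ 2) (hsq : s ∣ q ^ 2 + 1) {y : unitaryJ σ}
    (hy : s ∣ orderOf (y : projUnitary σ)) {N d : ℕ} (hN : N * d = (q ^ 2 + 1) * (q - 1))
    (hd : d ∣ q + 1) : orderOf (y : projUnitary σ) ∣ N := by
  have hsp : s ≠ p := by
    rintro rfl
    have := (Nat.dvd_add_right (dvd_pow h.p_dvd_q (by norm_num : 2 ≠ 0))).1 hsq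
    exact hs.one_lt.ne' (Nat.dvd_one.1 this)
  obtain ⟨S, ν, π, j, hS, hνs, hj, hψ, -, hμ⟩ := h.exists_eigenvalues_of_prime_dvd hs hs2 hsp y hy
  have key : ∀ k, ν j ^ k = 1 → s ∣ k := fun k hk => by
    have := Fact.mk hs
    rw [← orderOf_eq_prime (hνs j) hj]
    exact orderOf_dvd_of_pow_eq_one hk
  have two : ¬ s ∣ 2 := fun hd => hs2 ((Nat.prime_dvd_prime_iff_eq hs Nat.prime_two).1 hd)
  have hq1 : ¬ s ∣ q + 1 := fun hd => two (by
    zify at hd hsq ⊢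
    have := dvd_sub hsq (hd.mul_right ((q : ℤ) - 1))
    ring_nf at this; exact this)
  have hq2 : ¬ s ∣ q - 1 := fun hd => two (by
    have := h.q_ge
    zify [show 1 ≤ q by omega] at hd hsq ⊢
    have := dvd_sub hsq (hd.mul_right ((q : ℤ) + 1))
    ring_nf at this; exact this)
  have hν0 : ν j ≠ 0 := fun h0 => by simpa [h0, hs.ne_zero] using hνs j
  set a := ν j with ha
  set b := a ^ q with hb
  have hb0 : b ≠ 0 := pow_ne_zero _ hν0
  have hbq : b ^ q * a = 1 := by
    obtain ⟨k, hk⟩ := hsq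
    rw [hb, ← pow_mul, ← pow_succ, ← sq, hk, pow_mul, hνs, one_pow]
  have h1 : ν (π j) = b⁻¹ := by
    exact eq_inv_of_mul_eq_one_right (hψ j)
  have h2 : ν (π (π j)) = a⁻¹ := by
    have := hψ (π j)
    rw [h1, inv_pow] at this
    rw [inv_mul_eq_one₀ (pow_ne_zero _ hb0)] at this
    rw [← this]
    exact eq_inv_of_mul_eq_one_left hbq
  have h3 : ν (π (π (π j))) = b := by
    have := hψ (π (π j))
    rw [h2, inv_pow, inv_mul_eq_one₀ (pow_ne_zero _ hν0)] at this
    exact this.symm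
  have hab : a * b ≠ 1 := fun hab => hq1 (key _ (by rw [pow_succ']; exact hab))
  have hanb : a ≠ b := fun hab => hq2 (key _ (by
    have := h.q_ge
    apply mul_left_cancel₀ hν0
    rw [← pow_succ', Nat.sub_add_cancel (by omega), mul_one, ← hb, hab]))
  have haa : a * a ≠ 1 := fun haa => two (key _ (by rw [sq]; exact haa))
  have hbb : b * b ≠ 1 := fun hbb => by
    apply haa
    have : (b ^ q * a) * (b ^ q * a) = (b * b) ^ q * (a * a) := by ring
    rw [hbq, hbb] at this
    simpa using this.symm
  set o : Fin 4 → Fin 4 := ![j, π j, π (π j), π (π (π j))] with ho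
  have hinj : Function.Injective (ν ∘ o) := by
    have e : ν ∘ o = ![a, b⁻¹, a⁻¹, b] := by
      ext i; fin_cases i <;> simp [ho, h1, h2, h3, ha]
    rw [e]
    have e1 : a ≠ b⁻¹ := fun e => hab (by rw [e, inv_mul_cancel₀ hb0])
    have e2 : a ≠ a⁻¹ := fun e => haa (by nth_rw 1 [e]; rw [inv_mul_cancel₀ hν0])
    have e3 : b⁻¹ ≠ a⁻¹ := fun e => hanb (inv_injective e).symm
    have e4 : b⁻¹ ≠ b := fun e => hbb (by nth_rw 1 [← e]; rw [inv_mul_cancel₀ hb0])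
    have e5 : a⁻¹ ≠ b := fun e => hab (by rw [← e, mul_inv_cancel₀ hν0])
    intro i k
    fin_cases i <;> fin_cases k <;>
      simp [e1, e2, e3, e4, e5, hanb, e1.symm, e2.symm, e3.symm, e4.symm, e5.symm, hanb.symm]
  have hbij : Function.Bijective o := Finite.injective_iff_bijective.1 hinj.of_comp
  have hνinj : Function.Injective ν := by
    intro x y hxy
    obtain ⟨x, rfl⟩ := hbij.2 x
    obtain ⟨y, rfl⟩ := hbij.2 y
    rw [hinj hxy]
  obtain ⟨μ, hμS, hμψ, hμp⟩ := hμ hνinj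
  have hμ0 : ∀ i, μ i ≠ 0 := fun i h0 => by
    have := hμψ i
    rw [h0, zero_pow (by have := h.q_ge; omega), zero_mul] at this
    exact zero_ne_one this
  have hstep : ∀ i, μ (π i) = (μ i ^ q)⁻¹ := fun i => eq_inv_of_mul_eq_one_right (hμψ i)
  set c := μ j with hc
  have hc0 : c ≠ 0 := hμ0 j
  have hcN : c ^ ((q ^ 2 + 1) * (q - 1)) = 1 := by
    rw [← (Equiv.ofBijective o hbij).prod_comp, Fin.prod_univ_four] at hμp
    simp only [Equiv.ofBijective_apply, ho, cons_val, hstep, ← hc] at hμp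
    rw [pow_mul]
    have h5 : (c ^ (q ^ 2 + 1)) ^ q = c ^ (q ^ 2 + 1) := by
      simp only [inv_pow, inv_inv, ← pow_mul] at hμp
      rw [mul_inv_eq_one₀ (pow_ne_zero _ hc0)] at hμp
      calc (c ^ (q ^ 2 + 1)) ^ q = c ^ (q * q * q) * c ^ q := by ring
        _ = c ^ (q ^ 2 + 1) := by
          rw [← hμp]
          field_simp
          ring
    apply mul_left_cancel₀ (pow_ne_zero (q ^ 2 + 1) hc0)
    have := h.q_ge
    rw [← pow_succ', Nat.sub_add_cancel (by omega), mul_one, h5]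
  have htq : (c ^ N) ^ q * c ^ N = 1 := by
    obtain ⟨k, hk⟩ := hd
    rw [← pow_succ, hk, ← pow_mul, ← mul_assoc, hN, pow_mul, hcN, one_pow]
  have hpres : ∀ i, μ i ^ N = c ^ N → μ (π i) ^ N = c ^ N := fun i hi => by
    rw [hstep, inv_pow, ← pow_mul, mul_comm, pow_mul, hi]
    exact (eq_inv_of_mul_eq_one_right htq).symm
  refine h.orderOf_dvd_of_diagonal hS hμS (c := c ^ N) fun i => ?_
  obtain ⟨i, rfl⟩ := hbij.2 i
  have g1 := hpres j rfl
  have g2 := hpres _ g1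
  have g3 := hpres _ g2
  fin_cases i
  exacts [rfl, g1, g2, g3]

end IsUnitaryField

namespace IsUnitaryField

variable {F : Type*} [Field F] {p m q : ℕ} {σ : F →+* F}

theorem orderOf_dvd_of_prime_dvd_sq_sub_add_one (h : IsUnitaryField F p m q σ) {R w : ℕ}
    (hR : R + q = q ^ 2 + 1) (hw : w.Prime) (hw3 : w ≠ 3) (hwR : w ∣ R) {y : unitaryJ σ}
    (hy : w ∣ orderOf (y : projUnitary σ)) {M d : ℕ} (hM : M * d = q ^ 3 + 1)
    (hd : d ∣ q + 1) (hd4 : d ∣ 4) : orderOf (y : projUnitary σ) ∣ M := by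
  have hwp : w ≠ p := by
    rintro rfl
    have h1 := hwR.add h.p_dvd_q
    rw [hR] at h1
    have := (Nat.dvd_add_right (dvd_pow h.p_dvd_q (by norm_num : 2 ≠ 0))).1 h1
    exact hw.one_lt.ne' (Nat.dvd_one.1 this)
  have hw2 : w ≠ 2 := by
    rintro rfl
    obtain ⟨k, hk⟩ := h.q_odd
    obtain ⟨l, rfl⟩ := hwR
    have : q ^ 2 = 2 * (2 * k * k + 2 * k) + 1 := by rw [hk]; ring
    omega
  have hq3 : q ^ 3 + 1 = (q + 1) * R := by
    zify at hR ⊢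
    linear_combination -(q + 1 : ℤ) * hR
  obtain ⟨S, ν, π, j, hS, hνs, hj, hψ, hprod, hμ⟩ :=
    h.exists_eigenvalues_of_prime_dvd hw hw2 hwp y hy
  have hq0 : q ≠ 0 := by have := h.q_ge; omega
  have step : ∀ {μ : Fin 4 → AlgebraicClosure F}, (∀ j, μ j ^ q * μ (π j) = 1) →
      ∀ i, μ (π i) = (μ i ^ q)⁻¹ := fun hμ i => eq_inv_of_mul_eq_one_right (hμ i)
  have hν0 : ν j ≠ 0 := fun h0 => by simpa [h0, hw.ne_zero] using hνs j
  have h01 : ν j ≠ ν (π j) := fun e => by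
    have h1 := hψ j
    rw [← e, ← pow_succ] at h1
    have := Fact.mk hw
    have h2 := orderOf_dvd_of_pow_eq_one h1
    rw [orderOf_eq_prime (hνs j) hj] at h2
    refine hw3 ((Nat.prime_dvd_prime_iff_eq hw Nat.prime_three).1 ?_)
    zify at h2 hwR hR ⊢
    have := dvd_sub hwR (h2.mul_right ((q : ℤ) - 2))
    rwa [show (R : ℤ) - (q + 1) * (q - 2) = 3 by linear_combination hR] at this
  have hcyc : ν (π (π (π j))) = ν j := by
    rw [step hψ, step hψ, step hψ]
    simp only [inv_pow, inv_inv, ← pow_mul]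
    refine (eq_inv_of_mul_eq_one_right ?_).symm
    obtain ⟨k, rfl⟩ := hwR
    rw [← pow_succ, show q * q * q + 1 = w * ((q + 1) * k) by linarith, pow_mul, hνs, one_pow]
  have h20 : ν (π (π j)) ≠ ν j := fun e => h01 (by rw [← hcyc, step hψ, e, ← step hψ])
  have h12 : ν (π j) ≠ ν (π (π j)) := fun e => h20 (by
    rw [step hψ, e, ← step hψ, hcyc])
  have h2 : ν (π (π j)) ≠ 1 := fun e => hj (by rw [← hcyc, step hψ, e, one_pow, inv_one])
  have h1 : ν (π j) ≠ 1 := fun e => h2 (by rw [step hψ, e, one_pow, inv_one])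
  obtain ⟨k, hk⟩ : ∃ k, k ≠ j ∧ k ≠ π j ∧ k ≠ π (π j) := by
    have : ∀ x y z : Fin 4, ∃ k, k ≠ x ∧ k ≠ y ∧ k ≠ z := by decide
    exact this _ _ _
  have hk0 := hk.1.symm
  have hk1 := hk.2.1.symm
  have hk2 := hk.2.2.symm
  have n01 : j ≠ π j := fun e => h01 (congrArg ν e)
  have n12 : π j ≠ π (π j) := fun e => h12 (congrArg ν e)
  have n20 : π (π j) ≠ j := fun e => h20 (congrArg ν e)
  set o : Fin 4 → Fin 4 := ![j, π j, π (π j), k] with ho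
  have hbij : Function.Bijective o := by
    refine Finite.injective_iff_bijective.1 fun x y => ?_
    fin_cases x <;> fin_cases y <;>
      simp [ho, hk0, hk1, hk2, hk, n01, n12, n20, n01.symm, n12.symm, n20.symm]
  have hprod_o : ∀ {μ : Fin 4 → AlgebraicClosure F}, (∀ j, μ j ^ q * μ (π j) = 1) →
      ∏ j, μ j = 1 → μ j ≠ 0 → μ j ^ R * μ k = 1 := by
    intro μ h1 h2 h3
    rw [← (Equiv.ofBijective o hbij).prod_comp, Fin.prod_univ_four] at h2
    simp only [Equiv.ofBijective_apply, ho, cons_val, step h1] at h2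
    simp only [inv_pow, inv_inv, ← pow_mul] at h2
    have h4 : μ j ^ R * μ j ^ q = μ j ^ (q * q) * μ j := by
      rw [← pow_add, hR, ← pow_succ, sq]
    rw [← h2, (eq_mul_inv_iff_mul_eq₀ (pow_ne_zero q h3)).2 h4]
    ring
  have hνk : ν k = 1 := by
    have := hprod_o hψ hprod hν0
    obtain ⟨l, hl⟩ := hwR
    rwa [hl, pow_mul, hνs, one_pow, one_mul] at this
  have hνinj : Function.Injective ν := by
    refine Function.Injective.of_comp_right (g := o) (fun x y => ?_) hbij.2
    fin_cases x <;> fin_cases y <;>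
      simp [ho, hνk, hj, h1, h2, h01, h20, h12, hj.symm, h1.symm, h2.symm, h01.symm, h20.symm,
        h12.symm]
  have hπk : π k = k := hνinj (by rw [step hψ, hνk, one_pow, inv_one])
  obtain ⟨μ, hμS, hμψ, hμp⟩ := hμ hνinj
  have hμ0 : ∀ i, μ i ≠ 0 := fun i h0 => by
    have := hμψ i
    rw [h0, zero_pow hq0, zero_mul] at this
    exact zero_ne_one this
  have hc := hprod_o hμψ hμp (hμ0 j)
  have hη := hμψ k
  rw [hπk, ← pow_succ] at hη
  obtain ⟨l, hl⟩ := hd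
  have hd0 : 0 < d := Nat.pos_of_ne_zero (by rintro rfl; omega)
  have hMl : M = R * l := by
    apply Nat.eq_of_mul_eq_mul_right hd0
    rw [hM, hq3, hl]; ring
  have hζd : (μ k ^ l) ^ d = 1 := by rw [← pow_mul, mul_comm, ← hl, hη]
  have hdd : ∀ {x : AlgebraicClosure F} {n}, x ^ d = 1 → d ∣ n → x ^ n = 1 := by
    rintro x n hx ⟨r, rfl⟩
    rw [pow_mul, hx, one_pow]
  set t := (μ k ^ l)⁻¹ with ht
  have htd : t ^ d = 1 := by rw [ht, inv_pow, hζd, inv_one]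
  have htq : t ^ q * t = 1 := by rw [← pow_succ]; exact hdd htd ⟨l, hl⟩
  have g0 : μ j ^ M = t := by
    rw [hMl, pow_mul, ht]
    refine eq_inv_of_mul_eq_one_left ?_
    rw [← mul_pow, hc, one_pow]
  have hpres : ∀ i, μ i ^ M = t → μ (π i) ^ M = t := fun i hi => by
    rw [step hμψ, inv_pow, ← pow_mul, mul_comm, pow_mul, hi]
    exact (eq_inv_of_mul_eq_one_right htq).symm
  have g1 := hpres j g0
  have g2 := hpres _ g1
  have g3 : μ k ^ M = t := by
    rw [hMl, mul_comm, pow_mul, ht]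
    refine eq_inv_of_mul_eq_one_left ?_
    rw [← pow_succ]
    refine hdd hζd ?_
    have h5 : d ∣ q + 1 := ⟨l, hl⟩
    zify at h5 hd4 hR ⊢
    have := (h5.mul_right ((q : ℤ) - 2)).add hd4
    rwa [show ((q : ℤ) + 1) * (q - 2) + 4 = R + 1 by linear_combination -hR] at this
  refine h.orderOf_dvd_of_diagonal hS hμS (c := t) fun i => ?_
  obtain ⟨i, rfl⟩ := hbij.2 i
  fin_cases i
  exacts [g0, g1, g2, g3]

end IsUnitaryField

theorem pow_two_pow_eq_one_of_pow_eq_one {G : Type*} [Monoid G] {x : G} {n e k c : ℕ}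
    (hx : x ^ 2 ^ n = 1) (hk : x ^ k = 1) (hc : Odd c) (hd : 2 * k ∣ 2 ^ (e + 1) * c) :
    x ^ 2 ^ e = 1 := by
  obtain ⟨j, -, hj⟩ := (Nat.dvd_prime_pow Nat.prime_two).1 (orderOf_dvd_of_pow_eq_one hx)
  rw [← orderOf_dvd_iff_pow_eq_one, hj]
  rw [← orderOf_dvd_iff_pow_eq_one, hj] at hk
  have h1 : 2 * 2 ^ j ∣ 2 ^ (e + 1) * c := (Nat.mul_dvd_mul_left 2 hk).trans hd
  rw [← pow_succ'] at h1
  have h2 := (Nat.Coprime.pow_left (j + 1) (Nat.coprime_two_left.2 hc)).dvd_of_dvd_mul_right h1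
  exact pow_dvd_pow 2 (Nat.succ_le_succ_iff.1 ((Nat.pow_dvd_pow_iff_le_right (by norm_num)).1 h2))

theorem exists_pow_eq_of_repeated {K : Type*} [Field K] {q n e c : ℕ}
    (hq : q ^ 2 - 1 = 2 ^ (e + 1) * c) (hc : Odd c) (hqo : Odd q)
    (hinj : ∀ x y : K, x ^ q = y ^ q → x = y) {a : Fin 4 → K} {π : Equiv.Perm (Fin 4)}
    (hψ : ∀ j, a j ^ q * a (π j) = 1) (hprod : ∏ j, a j = 1) (ha : ∀ j, a j ^ 2 ^ n = 1)
    (h01 : a 0 = a 1) : ∃ c, ∀ j, a j ^ 2 ^ e = c := by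
  obtain ⟨r, hr⟩ := hqo
  have hq2 : q ^ 2 - 1 = 2 * ((q + 1) * r) := by
    rw [hr, Nat.sub_eq_iff_eq_add (by nlinarith)]; ring
  have key1 : ∀ {x : K}, x ^ 2 ^ n = 1 → x ^ q * x = 1 → x ^ 2 ^ e = 1 := fun {x} hx h => by
    rw [← pow_succ] at h
    refine pow_two_pow_eq_one_of_pow_eq_one hx h hc ?_
    rw [← hq, hq2]
    exact Nat.mul_dvd_mul_left 2 (dvd_mul_right _ _)
  have ha0 : ∀ j, a j ≠ 0 := fun j h0 => by simpa [h0] using ha j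
  rw [Fin.prod_univ_four, ← h01] at hprod
  have hcases : ∀ π : Equiv.Perm (Fin 4),
      ((π 0 = 0 ∨ π 0 = 1 ∨ π 1 = 0 ∨ π 1 = 1) ∧
        (π 2 = 2 ∧ π 3 = 3 ∨ π 2 = 3 ∧ π 3 = 2 ∨ π 2 = 0 ∨ π 2 = 1 ∨ π 3 = 0 ∨ π 3 = 1)) ∨
      ((π 0 = 2 ∧ π 1 = 3 ∨ π 0 = 3 ∧ π 1 = 2) ∧ (π 2 = 0 ∨ π 2 = 1)) := by decide
  have hp : ∀ {i j}, π i = j → a i ^ q * a j = 1 := fun {i j} hij => hij ▸ hψ i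
  rcases hcases π with ⟨hA, hB⟩ | ⟨hA, hB⟩
  · have hβ : a 0 ^ q * a 0 = 1 := by
      rcases hA with h | h | h | h <;> simpa only [← h01] using hp h
    have hβe := key1 (ha 0) hβ
    have key2 : ∀ {x y : K}, x ^ 2 ^ n = 1 → x ^ q * y = 1 → a 0 * a 0 * x * y = 1 →
        x ^ 2 ^ e = 1 := fun {x y} hx h1 h2 => by
      have hx0 : x ≠ 0 := by rintro rfl; simp at h2
      have hy0 : y ≠ 0 := by rintro rfl; simp at h2
      have h3 : x ^ (2 * r) = a 0 ^ 2 := by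
        apply mul_right_cancel₀ (mul_ne_zero hx0 hy0)
        calc x ^ (2 * r) * (x * y) = x ^ (2 * r + 1) * y := by ring
          _ = a 0 ^ 2 * (x * y) := by rw [← hr, h1, ← h2]; ring
      refine pow_two_pow_eq_one_of_pow_eq_one hx (k := (q + 1) * r) ?_ hc (by rw [← hq, hq2])
      rw [← hβ, ← pow_succ, show (q + 1) * r = 2 * r * (r + 1) by rw [hr]; ring, pow_mul, h3,
        ← pow_mul, hr]
      congr 1
    have key3 : ∀ {x : K}, a 0 * a 0 * a 0 * x = 1 → x ^ 2 ^ e = 1 := fun {x} h => by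
      have := congrArg (· ^ 2 ^ e) h
      simpa only [mul_pow, hβe, one_mul, one_pow] using this
    have key4 : ∀ {x y : K}, x ^ q * a 0 = 1 → a 0 * a 0 * x * y = 1 →
        x ^ 2 ^ e = 1 ∧ y ^ 2 ^ e = 1 := fun {x y} h1 h2 => by
      obtain rfl := hinj x (a 0) (mul_right_cancel₀ (ha0 0) (h1.trans hβ.symm))
      exact ⟨hβe, key3 h2⟩
    have hprod' : a 0 * a 0 * a 3 * a 2 = 1 := by rw [← hprod]; ring
    have h23 : a 2 ^ 2 ^ e = 1 ∧ a 3 ^ 2 ^ e = 1 := by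
      rcases hB with h | h | h | h | h | h
      · exact ⟨key1 (ha 2) (hp h.1), key1 (ha 3) (hp h.2)⟩
      · exact ⟨key2 (ha 2) (hp h.1) hprod, key2 (ha 3) (hp h.2) hprod'⟩
      · exact key4 (hp h) hprod
      · exact key4 (h01 ▸ hp h) hprod
      · exact (key4 (hp h) hprod').symm
      · exact (key4 (h01 ▸ hp h) hprod').symm
    refine ⟨1, fun j => ?_⟩
    fin_cases j
    exacts [hβe, h01 ▸ hβe, h23.1, h23.2]
  · have h2 : a 0 ^ q * a 2 = 1 := by
      rcases hA with h | h
      · exact hp h.1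
      · rw [h01]; exact hp h.2
    have h3 : a 0 ^ q * a 3 = 1 := by
      rcases hA with h | h
      · rw [h01]; exact hp h.2
      · exact hp h.1
    have h32 : a 3 = a 2 := mul_left_cancel₀ (pow_ne_zero q (ha0 0)) (h3.trans h2.symm)
    have h4 : a 2 ^ q * a 0 = 1 := by
      rcases hB with h | h
      · exact hp h
      · rw [h01]; exact hp h
    have h5 : a 0 ^ (q ^ 2 - 1) = 1 := by
      apply mul_right_cancel₀ (ha0 0)
      rw [← pow_succ, Nat.sub_add_cancel (Nat.one_le_pow _ _ (by omega)), one_mul]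
      apply mul_left_cancel₀ (pow_ne_zero q (ha0 2))
      rw [h4, sq, pow_mul, ← mul_pow, mul_comm, h2, one_pow]
    have h6 := pow_two_pow_eq_one_of_pow_eq_one (e := e + 1) (ha 0) h5 hc (by
      rw [hq, pow_succ' 2 (e + 1), mul_assoc])
    have h7 : a 2 ^ 2 ^ e = a 0 ^ 2 ^ e := by
      apply mul_left_cancel₀ (pow_ne_zero (2 ^ e) (pow_ne_zero q (ha0 0)))
      rw [← mul_pow, h2, one_pow, ← mul_pow, ← pow_succ, ← pow_mul,
        show (q + 1) * 2 ^ e = 2 ^ (e + 1) * (r + 1) by rw [hr]; ring, pow_mul, h6, one_pow]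
    refine ⟨a 0 ^ 2 ^ e, fun j => ?_⟩
    fin_cases j
    exacts [rfl, congrArg (· ^ 2 ^ e) h01.symm, h7, h32 ▸ h7]

namespace IsUnitaryField

variable {F : Type*} [Field F] {p m q : ℕ} {σ : F →+* F}

theorem mul_two_pow_notMem_elementOrders (h : IsUnitaryField F p m q σ) {e c : ℕ}
    (hq : q ^ 2 - 1 = 2 ^ (e + 1) * c) (hc : Odd c) :
    p * 2 ^ (e + 1) ∉ elementOrders (projUnitary σ) := by
  rintro ⟨x, hx⟩
  obtain ⟨y, rfl⟩ := QuotientGroup.mk_surjective x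
  have := h.charP
  have := Fact.mk h.prime
  have : CharP (AlgebraicClosure F) p := charP_of_injective_algebraMap
    (algebraMap F (AlgebraicClosure F)).injective p
  have h1 := h.pow_eq_one_of_dvd y hx.dvd
  have hp2 : ¬ p ∣ 2 ^ (e + 3) := fun hd => by
    have := Nat.le_of_dvd two_pos (h.prime.dvd_of_dvd_pow hd)
    have := h.p_ge
    omega
  have hxk : mat (y ^ p) ^ 2 ^ (e + 3) = 1 := by
    rw [map_pow, ← pow_mul, ← h1]
    congr 1
    ring
  have huk : mat (y ^ 2 ^ (e + 3)) ^ p = 1 := by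
    rw [map_pow, ← pow_mul, ← h1]
    congr 1
    ring
  obtain ⟨S, ν, hS, hν⟩ := h.exists_diagonal _ hxk hp2
  obtain ⟨π, hπ⟩ := h.exists_perm hS
  have hνk : ∀ j, ν j ^ 2 ^ (e + 3) = 1 := pow_eq_one_of_mul_eq_mul_diagonal hS hν (by
    rw [← Matrix.map_pow, hxk, Matrix.map_one _ (map_zero _) (map_one _)])
  have hfrob : ∀ x y : AlgebraicClosure F, x ^ q = y ^ q → x = y := fun x y hxy => by
    apply (iterateFrobenius (AlgebraicClosure F) p m).injective
    rwa [iterateFrobenius_def, iterateFrobenius_def, ← h.q_eq]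
  obtain ⟨j, k, hjk, hne⟩ : ∃ j k, ν j = ν k ∧ j ≠ k := by
    by_contra! hinj
    obtain ⟨μ, hμ⟩ := exists_diagonal_of_commute hS hν (fun x y => hinj x y)
      (B := (mat (y ^ 2 ^ (e + 3))).map (algebraMap F (AlgebraicClosure F))) (by
        rw [← Matrix.map_mul, ← Matrix.map_mul, ← map_mul, ← map_mul, ← pow_add, ← pow_add,
          add_comm])
    have hμp := pow_eq_one_of_mul_eq_mul_diagonal hS hμ (k := p) (by
      rw [← Matrix.map_pow, huk, Matrix.map_one _ (map_zero _) (map_one _)])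
    have h2 := h.orderOf_dvd_of_diagonal hS hμ (N := 1) (c := 1) fun j => by
      rw [pow_one]
      exact frobenius_inj (AlgebraicClosure F) p (by simpa [frobenius_def] using hμp j)
    rw [Nat.dvd_one, orderOf_eq_one_iff, QuotientGroup.mk_pow, ← orderOf_dvd_iff_pow_eq_one,
      hx] at h2
    exact hp2 ((dvd_mul_right _ _).trans h2)
  obtain ⟨τ, hτ0, hτ1⟩ : ∃ τ : Equiv.Perm (Fin 4), τ 0 = j ∧ τ 1 = k := by
    have : ∀ j k : Fin 4, j ≠ k → ∃ τ : Equiv.Perm (Fin 4), τ 0 = j ∧ τ 1 = k := by decide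
    exact this j k hne
  obtain ⟨hψ, hprod⟩ := hπ _ _ hν
  obtain ⟨b, hb⟩ := exists_pow_eq_of_repeated hq hc h.q_odd hfrob (a := ν ∘ τ)
    (π := (τ.trans π).trans τ.symm) (fun j => by simpa using hψ (τ j))
    (by rw [← hprod]; exact Equiv.prod_comp τ ν) (fun j => hνk _) (by simp [hτ0, hτ1, hjk])
  have h2 := h.orderOf_dvd_of_diagonal hS hν (N := 2 ^ e) (c := b) fun j => by
    simpa using hb (τ.symm j)
  rw [orderOf_dvd_iff_pow_eq_one, QuotientGroup.mk_pow, ← pow_mul, ← orderOf_dvd_iff_pow_eq_one,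
    hx] at h2
  have h3 := (Nat.pow_dvd_pow_iff_le_right (by norm_num)).1
    (Nat.dvd_of_mul_dvd_mul_left h.prime.pos h2)
  omega

end IsUnitaryField

section Frobenius

variable {G V : Type*} [Group G] [AddCommGroup V] [DistribMulAction G V]

theorem card_nsmul_eq_sum_smul (E : Subgroup G) [Fintype E] {t : G} {n : ℕ} (hn : 0 < n)
    (hnorm : ∀ e ∈ E, t * e * t⁻¹ ∈ E)
    (hfpf : ∀ i, 0 < i → i < n → ∀ e ∈ E, t ^ i * e = e * t ^ i → e = 1)
    (hS : ∀ v : V, ∑ i ∈ Finset.range n, t ^ i • v = 0) (v : V) :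
    Nat.card E • v = ∑ e : E, (e : G) • v := by
  have hpow : ∀ i : ℕ, ∀ e ∈ E, t ^ i * e * (t ^ i)⁻¹ ∈ E := by
    intro i
    induction i with
    | zero => simp
    | succ i ih =>
      intro e he
      have := hnorm _ (ih e he)
      rw [pow_succ']
      convert this using 1
      group
  have hmove : ∀ i, 0 < i → i < n → ∀ w : V,
      ∑ e : E, ((e : G) * t ^ i * (e : G)⁻¹) • w = ∑ e : E, (e : G) • t ^ i • w := by
    intro i h0 hi w
    let f : E → E := fun e => e * ⟨t ^ i * (e : G)⁻¹ * (t ^ i)⁻¹, hpow i _ (inv_mem e.2)⟩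
    have hf : Function.Injective f := by
      intro a b hab
      have h1 := congrArg Subtype.val hab
      simp only [f, Subgroup.coe_mul] at h1
      have h2 := hfpf i h0 hi ((b : G)⁻¹ * a) (mul_mem (inv_mem b.2) a.2) (by
        have h3 : (a : G) * (t ^ i * (a : G)⁻¹) = b * (t ^ i * (b : G)⁻¹) := by
          simpa only [← mul_assoc, mul_left_inj] using h1
        calc t ^ i * ((b : G)⁻¹ * a) = (b : G)⁻¹ * (b * (t ^ i * (b : G)⁻¹)) * a := by group
          _ = (b : G)⁻¹ * a * t ^ i := by rw [← h3]; group)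
      exact Subtype.ext (inv_mul_eq_one.1 h2).symm
    rw [← (Equiv.ofBijective f (Finite.injective_iff_bijective.1 hf)).sum_comp
      fun e : E => (e : G) • t ^ i • w]
    refine Finset.sum_congr rfl fun e _ => ?_
    rw [smul_smul]
    congr 1
    simp only [Equiv.ofBijective_apply, f, Subgroup.coe_mul]
    group
  obtain ⟨k, rfl⟩ : ∃ k, n = k + 1 := ⟨n - 1, by omega⟩
  have h1 : ∑ i ∈ Finset.range (k + 1), ∑ e : E, ((e : G) * t ^ i * (e : G)⁻¹) • v = 0 := by
    rw [Finset.sum_comm]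
    refine Finset.sum_eq_zero fun e _ => ?_
    simp only [mul_smul, ← Finset.smul_sum]
    rw [hS, smul_zero]
  have h2 : ∑ e : E, (e : G) • ∑ i ∈ Finset.range (k + 1), t ^ i • v = 0 := by
    simp [hS]
  simp only [Finset.smul_sum] at h2
  rw [Finset.sum_comm] at h2
  rw [Finset.sum_range_succ', Finset.sum_congr rfl fun i hi => hmove (i + 1) i.succ_pos
    (by have := Finset.mem_range.1 hi; omega) v] at h1
  rw [Finset.sum_range_succ'] at h2
  have h3 := h1.trans h2.symm
  rw [add_right_inj] at h3
  simpa using h3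

theorem smul_eq_self_of_fpf (E : Subgroup G) [Finite E] {t : G} {n r : ℕ} (hn : 0 < n)
    (hnorm : ∀ e ∈ E, t * e * t⁻¹ ∈ E)
    (hfpf : ∀ i, 0 < i → i < n → ∀ e ∈ E, t ^ i * e = e * t ^ i → e = 1)
    (hS : ∀ v : V, ∑ i ∈ Finset.range n, t ^ i • v = 0) (hr : ∀ v : V, r • v = 0)
    (hcop : r.Coprime (Nat.card E)) {g : G} (hg : g ∈ E) (v : V) : g • v = v := by
  have := Fintype.ofFinite E
  have key := card_nsmul_eq_sum_smul E hn hnorm hfpf hS v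
  have h1 : Nat.card E • (g • v - v) = 0 := by
    rw [smul_sub, sub_eq_zero, smul_comm, key, Finset.smul_sum]
    simp only [smul_smul]
    exact Equiv.sum_comp (Equiv.mulLeft (⟨g, hg⟩ : E)) fun e : E => (e : G) • v
  have h2 := hr (g • v - v)
  have h3 : addOrderOf (g • v - v) ∣ 1 := by
    rw [← hcop]
    exact Nat.dvd_gcd (addOrderOf_dvd_of_nsmul_eq_zero h2) (addOrderOf_dvd_of_nsmul_eq_zero h1)
  rw [Nat.dvd_one, AddMonoid.addOrderOf_eq_one_iff] at h3
  exact sub_eq_zero.1 h3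

end Frobenius

section UnitaryModule

variable {F : Type*} [Field F] {p m q : ℕ} {σ : F →+* F}

/-- A module for the unitary group on which scalars act trivially, and which is a spectral module
for the projective unitary group. -/
structure IsUnitaryModule (σ : F →+* F) (r : ℕ) (V : Type*) [AddCommGroup V]
    [DistribMulAction (unitaryJ σ) V] : Prop where
  nsmul_eq_zero : ∀ v : V, r • v = 0
  smul_of_scalar : ∀ (g : unitaryJ σ) (ζ : F), mat g = ζ • (1 : Matrix (Fin 4) (Fin 4) F) →
    ∀ v : V, g • v = v
  sum_smul : ∀ x : unitaryJ σ,
    r * orderOf (x : projUnitary σ) ∉ elementOrders (projUnitary σ) →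
    ∀ v : V, ∑ i ∈ Finset.range (orderOf (x : projUnitary σ)), x ^ i • v = 0

theorem IsSpectralModule.exists_unitaryModule {r : ℕ} {V : Type*} [AddCommGroup V]
    [DistribMulAction (projUnitary σ) V] (h : IsSpectralModule (projUnitary σ) r V) :
    ∃ _ : DistribMulAction (unitaryJ σ) V, IsUnitaryModule σ r V := by
  let _ : DistribMulAction (unitaryJ σ) V :=
    DistribMulAction.compHom V (QuotientGroup.mk' (Subgroup.center (unitaryJ σ)))
  have hs : ∀ (g : unitaryJ σ) (v : V), g • v = (g : projUnitary σ) • v := fun _ _ => rfl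
  refine ⟨inferInstance, h.nsmul_eq_zero, fun g ζ hg v => ?_, fun x hx v => ?_⟩
  · rw [hs, (QuotientGroup.eq_one_iff g).2 (mem_center_of_scalar hg), one_smul]
  · simpa only [hs, QuotientGroup.mk_pow] using h.sum_smul x hx v

end UnitaryModule

section Arithmetic

theorem dvd_of_mul_dvd_add_one_mul {q N d i : ℕ} (hN : N * d = (q ^ 2 + 1) * (q - 1))
    (hd : d = Nat.gcd 4 (q + 1)) (hq : 3 ≤ q) (h : (q ^ 2 + 1) * (q - 1) ∣ (q + 1) * i) :
    N ∣ i := by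
  obtain ⟨l, hl⟩ : d ∣ q + 1 := hd ▸ Nat.gcd_dvd_right 4 (q + 1)
  have hd0 : 0 < d := Nat.pos_of_ne_zero (by rintro rfl; omega)
  have hcop : N.Coprime l := by
    have h1 : d * Nat.gcd N l ∣ d := by
      conv_rhs => rw [hd]
      refine Nat.dvd_gcd ?_ ?_
      · have h2 : d * Nat.gcd N l ∣ (q ^ 2 + 1) * (q - 1) := by
          rw [← hN, mul_comm N]
          exact Nat.mul_dvd_mul_left d (Nat.gcd_dvd_left N l)
        have h3 : d * Nat.gcd N l ∣ q + 1 := by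
          rw [hl]
          exact Nat.mul_dvd_mul_left d (Nat.gcd_dvd_right N l)
        obtain ⟨u, rfl⟩ : ∃ u, q = u + 1 := ⟨q - 1, by omega⟩
        zify at h2 h3 ⊢
        have := (h3.mul_left ((u : ℤ) ^ 2 + 2)).sub h2
        rw [Nat.add_sub_cancel] at this
        rwa [show ((u : ℤ) ^ 2 + 2) * (u + 1 + 1) - ((u + 1) ^ 2 + 1) * u = 4 by ring] at this
      · rw [hl]
        exact Nat.mul_dvd_mul_left d (Nat.gcd_dvd_right N l)
    have h4 := Nat.le_of_dvd hd0 h1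
    have h5 : Nat.gcd N l ≤ 1 := by
      by_contra! h6
      nlinarith
    have h6 : Nat.gcd N l ≠ 0 := by
      intro h0
      rw [h0, mul_zero, zero_dvd_iff] at h1
      omega
    exact Nat.le_antisymm h5 (Nat.pos_of_ne_zero h6)
  rw [← hN, hl, mul_assoc, mul_comm N] at h
  exact hcop.dvd_of_dvd_mul_left (Nat.dvd_of_mul_dvd_mul_left hd0 h)

theorem exists_odd_prime_dvd_sq_add_one {q : ℕ} (hq : Odd q) (h3 : 3 ≤ q) :
    ∃ s, s.Prime ∧ s ≠ 2 ∧ s ∣ q ^ 2 + 1 := by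
  obtain ⟨k, hk⟩ := hq
  have h1 : q ^ 2 + 1 = 2 * (2 * (k * k + k) + 1) := by rw [hk]; ring
  have hk1 : 1 ≤ k := by omega
  refine ⟨_, Nat.minFac_prime (n := 2 * (k * k + k) + 1) ?_, fun h => ?_, ?_⟩
  · have := Nat.mul_pos hk1 hk1
    omega
  · have := Nat.minFac_dvd (2 * (k * k + k) + 1)
    rw [h] at this
    omega
  · rw [h1]
    exact (Nat.minFac_dvd _).mul_left 2

theorem exists_prime_dvd_sq_sub_add_one {q R : ℕ} (h3 : 3 ≤ q) (hR : R + q = q ^ 2 + 1) :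
    ∃ w, w.Prime ∧ w ≠ 3 ∧ w ∣ R := by
  have hR7 : 7 ≤ R := by nlinarith
  by_contra! hall
  have h9 : ¬ 9 ∣ R := by
    intro ⟨c, hc⟩
    have h1 : (q ^ 2 + 1) % 9 = q % 9 := by rw [← hR, hc]; omega
    have h2 : q % 9 < 9 := Nat.mod_lt _ (by norm_num)
    rw [Nat.add_mod, Nat.pow_mod] at h1
    generalize q % 9 = x at h1 h2
    interval_cases x <;> simp at h1
  have key : ∀ w, w.Prime → w ∣ R → w = 3 := fun w hw hd => by
    by_contra hne
    exact hall w hw hne hd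
  have h31 : 3 ∣ R := by
    have := key _ (Nat.minFac_prime (by omega : R ≠ 1)) (Nat.minFac_dvd R)
    rw [← this]
    exact Nat.minFac_dvd R
  obtain ⟨c, hc⟩ := h31
  have hc1 : c ≠ 1 := by omega
  have h4 := key _ (Nat.minFac_prime hc1) ((Nat.minFac_dvd c).trans ⟨3, by rw [hc, mul_comm]⟩)
  obtain ⟨e, he⟩ := Nat.minFac_dvd c
  rw [h4] at he
  exact h9 ⟨e, by rw [hc, he]; ring⟩

theorem not_prime_dvd_of_coprime_torus_orders {q N M d R r : ℕ} (hq : Odd q) (hq3 : 3 ≤ q)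
    (hR : R + q = q ^ 2 + 1) (hN : N * d = (q ^ 2 + 1) * (q - 1)) (hM : M * d = q ^ 3 + 1)
    (hd : d = Nat.gcd 4 (q + 1)) (hr : r.Prime) (hrN : r ∣ N) : ¬ r ∣ M := by
  intro hrM
  obtain ⟨l, hl⟩ : d ∣ q + 1 := hd ▸ Nat.gcd_dvd_right 4 (q + 1)
  have hd0 : 0 < d := Nat.pos_of_ne_zero (by rintro rfl; omega)
  have hMl : M = R * l := by
    apply Nat.eq_of_mul_eq_mul_right hd0
    rw [hM, mul_assoc, mul_comm l, ← hl]
    zify at hR ⊢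
    linear_combination (-(q : ℤ) - 1) * hR
  have h1 : r ∣ q ^ 2 + 1 ∨ r ∣ q - 1 := by
    rw [← hr.dvd_mul, ← hN]
    exact hrN.mul_right d
  obtain ⟨u, rfl⟩ : ∃ u, q = u + 1 := ⟨q - 1, by omega⟩
  rw [Nat.add_sub_cancel] at h1 hN
  have hr1 : ¬ ((r : ℤ) ∣ 1) := by
    rw [← Nat.cast_one, Int.natCast_dvd_natCast, Nat.dvd_one]
    exact hr.one_lt.ne'
  rw [hMl, hr.dvd_mul] at hrM
  rcases hrM with hrR | hrl
  · apply hr1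
    zify at hR hrR h1
    rcases h1 with h1 | h1
    · have h2 : (r : ℤ) ∣ u + 1 := by
        have := h1.sub hrR
        rwa [← hR, add_sub_cancel_left] at this
      have := h1.sub (h2.mul_right (u + 1))
      rwa [show ((u : ℤ) + 1) ^ 2 + 1 - (u + 1) * (u + 1) = 1 by ring] at this
    · have := hrR.sub (h1.mul_right (u + 1))
      rwa [show (R : ℤ) - u * (u + 1) = 1 by linear_combination hR] at this
  · have hrq : r ∣ u + 1 + 1 := by rw [hl]; exact hrl.mul_left d
    have hr2 : (r : ℤ) ∣ 2 := by
      zify at h1 hrq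
      rcases h1 with h1 | h1
      · have := h1.sub (hrq.mul_right u)
        rwa [show ((u : ℤ) + 1) ^ 2 + 1 - (u + 1 + 1) * u = 2 by ring] at this
      · have := hrq.sub h1
        rwa [show (u : ℤ) + 1 + 1 - u = 2 by ring] at this
    have hr2' : r = 2 := (Nat.prime_dvd_prime_iff_eq hr Nat.prime_two).1 (by exact_mod_cast hr2)
    subst hr2'
    obtain ⟨k, hk⟩ := hq
    obtain ⟨j, rfl⟩ := hrl
    obtain ⟨n, rfl⟩ := hrN
    have hu : u = 2 * k := by omega
    subst hu
    have hd4 : d ∣ 4 := hd ▸ Nat.gcd_dvd_left 4 _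
    have : d ≤ 4 := Nat.le_of_dvd (by norm_num) hd4
    have h2d : 2 ∣ d := hd ▸ Nat.dvd_gcd (by norm_num) (by omega)
    have h4 : d = 4 := by
      have : 4 ∣ 2 * k + 1 + 1 := by
        rw [hl]
        obtain ⟨x, rfl⟩ := h2d
        exact ⟨x * j, by ring⟩
      rw [hd]
      exact Nat.gcd_eq_left this
    subst h4
    obtain ⟨x, rfl⟩ : ∃ x, k = 2 * x + 1 := ⟨k / 2, by omega⟩
    have h5 : n * 2 = (8 * x ^ 2 + 12 * x + 5) * (2 * x + 1) := by
      have : 4 * (n * 2) = 4 * ((8 * x ^ 2 + 12 * x + 5) * (2 * x + 1)) := by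
        linear_combination hN
      omega
    have h6 : n * 2 = 2 * (8 * x ^ 3 + 16 * x ^ 2 + 11 * x + 2) + 1 := by
      rw [h5]; ring
    omega

end Arithmetic

namespace IsUnitaryField

variable {F : Type*} [Field F] {p m q : ℕ} {σ : F →+* F}

theorem mem_range_algebraMap (h : IsUnitaryField F p m q σ) {K : Type*} [Field K] [Algebra F K]
    {x : K} (hx : x ^ q ^ 2 = x) : ∃ y : F, algebraMap F K y = x := by
  have := h.finite
  have := Fintype.ofFinite F
  have hcard : Fintype.card F = q ^ 2 := by rw [← Nat.card_eq_fintype_card, h.card]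
  have h1 := FiniteField.roots_X_pow_card_sub_X F
  have hq1 : 1 < Fintype.card F := Fintype.one_lt_card
  have hmon : (Polynomial.X ^ Fintype.card F - Polynomial.X : Polynomial F).Monic :=
    Polynomial.monic_X_pow_sub (by rw [Polynomial.degree_X]; exact_mod_cast hq1)
  have hspl := Polynomial.prod_multiset_X_sub_C_of_monic_of_roots_card_eq hmon (by
    rw [h1, FiniteField.X_pow_card_sub_X_natDegree_eq F hq1]; rfl)
  have h2 := congrArg (Polynomial.aeval x) hspl
  rw [h1, hcard] at h2
  simp only [map_sub, map_pow, Polynomial.aeval_X, hx, sub_self, Finset.prod_map_val,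
    map_prod, Polynomial.aeval_C, Finset.prod_eq_zero_iff] at h2
  obtain ⟨y, -, hy⟩ := h2
  exact ⟨y, (sub_eq_zero.1 hy).symm⟩

theorem exists_orderOf_algebraicClosure (h : IsUnitaryField F p m q σ) {k : ℕ}
    (hk : ¬ p ∣ k) : ∃ x : AlgebraicClosure F, orderOf x = k := by
  have := h.charP
  have : CharP (AlgebraicClosure F) p := charP_of_injective_algebraMap
    (algebraMap F (AlgebraicClosure F)).injective p
  have : NeZero (k : AlgebraicClosure F) := ⟨fun h0 =>
    hk ((CharP.cast_eq_zero_iff (AlgebraicClosure F) p k).1 h0)⟩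
  obtain ⟨x, hx⟩ := HasEnoughRootsOfUnity.exists_primitiveRoot (AlgebraicClosure F) k
  exact ⟨x, hx.eq_orderOf.symm⟩

theorem add_pow_q_pow (h : IsUnitaryField F p m q σ) {K : Type*} [Field K] [Algebra F K]
    (x y : K) (k : ℕ) : (x + y) ^ q ^ k = x ^ q ^ k + y ^ q ^ k := by
  have := h.charP
  have : CharP K p := charP_of_injective_algebraMap (algebraMap F K).injective p
  have := Fact.mk h.prime
  rw [h.q_eq, ← pow_mul]
  exact add_pow_char_pow x y p _

end IsUnitaryField

section Siegel

variable {F : Type*} [Field F] {p m q : ℕ} {σ : F →+* F}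

theorem eq_zero_of_bilinear {K : Type*} [Field K] {a b c d x y z w : K} (hab : a ≠ b)
    (hcd : c ≠ d) (h1 : x + y * c + a * (z + w * c) = 0) (h2 : x + y * d + a * (z + w * d) = 0)
    (h3 : x + y * c + b * (z + w * c) = 0) (h4 : x + y * d + b * (z + w * d) = 0) :
    x = 0 ∧ y = 0 ∧ z = 0 ∧ w = 0 := by
  have hab' := sub_ne_zero.2 hab
  have hcd' := sub_ne_zero.2 hcd
  obtain rfl : w = 0 := by
    have : (a - b) * (c - d) * w = 0 := by linear_combination h1 - h2 - h3 + h4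
    simpa [hab', hcd'] using this
  obtain rfl : z = 0 := by
    have : (a - b) * z = 0 := by linear_combination h1 - h3
    simpa [hab'] using this
  obtain rfl : y = 0 := by
    have : (c - d) * y = 0 := by linear_combination h1 - h2
    simpa [hcd'] using this
  obtain rfl : x = 0 := by linear_combination h1
  simp

/-- The unipotent radical of the stabiliser of a maximal isotropic subspace. -/
def siegelGroup (σ : F →+* F) : Subgroup (unitaryJ σ) where
  carrier := {g | mat g * diagonal ![1, 1, 0, 0] = diagonal ![1, 1, 0, 0] ∧
    diagonal ![0, 0, 1, 1] * mat g = diagonal ![0, 0, 1, 1]}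
  one_mem' := by simp
  mul_mem' := fun {a b} ha hb => by
    simp only [Set.mem_ofPred_eq, map_mul]
    rw [Matrix.mul_assoc, hb.1, ha.1, ← Matrix.mul_assoc, ha.2, hb.2]
    exact ⟨rfl, rfl⟩
  inv_mem' := fun {a} ha => by
    constructor
    · conv_lhs => rw [← ha.1]
      rw [← Matrix.mul_assoc, ← map_mul, inv_mul_cancel, map_one, Matrix.one_mul]
    · conv_lhs => rw [← ha.2]
      rw [Matrix.mul_assoc, ← map_mul, mul_inv_cancel, map_one, Matrix.mul_one]

theorem mem_siegelGroup {g : unitaryJ σ} : g ∈ siegelGroup σ ↔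
    mat g * diagonal ![1, 1, 0, 0] = diagonal ![1, 1, 0, 0] ∧
    diagonal ![0, 0, 1, 1] * mat g = diagonal ![0, 0, 1, 1] := Iff.rfl

theorem siegel_mem_siegelGroup (x y z : F) (hx : σ (σ x) = x) (hy : σ y = -y) (hz : σ z = -z) :
    siegel x y z hx hy hz ∈ siegelGroup σ := by
  rw [mem_siegelGroup, mat_siegel, ← Matrix.ext_iff, ← Matrix.ext_iff]
  simp [Fin.forall_fin_succ, Matrix.mul_apply, diagonal]

theorem exists_eq_of_mem_siegelGroup {g : unitaryJ σ} (hg : g ∈ siegelGroup σ) :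
    ∃ x y z w, mat g = !![1, 0, x, y; 0, 1, z, w; 0, 0, 1, 0; 0, 0, 0, 1] := by
  refine ⟨mat g 0 2, mat g 0 3, mat g 1 2, mat g 1 3, ?_⟩
  obtain ⟨h1, h2⟩ := mem_siegelGroup.1 hg
  rw [← Matrix.ext_iff] at h1 h2 ⊢
  simp [Fin.forall_fin_succ] at h1 h2 ⊢
  simp [h1, h2]

theorem IsUnitaryField.exists_card_siegelGroup (h : IsUnitaryField F p m q σ) :
    ∃ n, Nat.card (siegelGroup σ) = p ^ n := by
  have := h.finite
  have := h.charP
  have := Fact.mk h.prime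
  have : Finite (SpecialLinearGroup (Fin 4) F) := Subtype.finite
  refine IsPGroup.iff_card.1 fun g => ⟨1, ?_⟩
  obtain ⟨x, y, z, w, hM⟩ := exists_eq_of_mem_siegelGroup g.2
  apply Subtype.ext
  apply mat_injective
  have hN : (mat (g : unitaryJ σ) - 1) ^ p = 0 := by
    have h2 : (mat (g : unitaryJ σ) - 1) ^ 2 = 0 := by
      rw [hM, sq, ← Matrix.ext_iff]
      simp [Fin.forall_fin_succ, Matrix.mul_apply, Fin.sum_univ_succ, Matrix.one_apply]
    obtain ⟨k, hk⟩ := Nat.exists_eq_add_of_le h.p_ge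
    rw [hk, show 3 + k = 2 + (1 + k) by ring, pow_add, h2, Matrix.zero_mul]
  rw [sub_pow_char_of_commute p (Commute.one_right _), one_pow, sub_eq_zero] at hN
  simpa using hN

theorem IsUnitaryField.smul_eq_self_of_mem_siegelGroup (h : IsUnitaryField F p m q σ) {r : ℕ}
    (hr : r.Prime) (hrp : r ≠ p) {V : Type*} [AddCommGroup V]
    [DistribMulAction (unitaryJ σ) V] (hV : IsUnitaryModule σ r V) {g : unitaryJ σ}
    (hg : g ∈ siegelGroup σ) (v : V) : g • v = v := by
  have := h.finite
  have : Finite (SpecialLinearGroup (Fin 4) F) := Subtype.finite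
  have hq3 := h.q_ge
  obtain ⟨s, hs, hs2, hsq⟩ := exists_odd_prime_dvd_sq_add_one h.q_odd hq3
  obtain ⟨l, hl⟩ : Nat.gcd 4 (q + 1) ∣ q + 1 := Nat.gcd_dvd_right 4 (q + 1)
  set d := Nat.gcd 4 (q + 1) with hd
  have hdq : d ∣ q + 1 := ⟨l, hl⟩
  obtain ⟨N, hN⟩ : ∃ N, N * d = (q ^ 2 + 1) * (q - 1) := by
    have h4 : d ∣ (q ^ 2 + 1) * (q - 1) := by
      have h1 : d ∣ 4 := Nat.gcd_dvd_left 4 _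
      obtain ⟨u, rfl⟩ : ∃ u, q = u + 1 := ⟨q - 1, by omega⟩
      rw [Nat.add_sub_cancel]
      zify at h1 hdq ⊢
      have := (hdq.mul_left ((u : ℤ) ^ 2 + 2)).sub h1
      rwa [show ((u : ℤ) ^ 2 + 2) * (u + 1 + 1) - 4 = ((u + 1) ^ 2 + 1) * u by ring] at this
    obtain ⟨N, hN⟩ := h4
    exact ⟨N, by rw [hN, mul_comm]⟩
  have hsN : s ∣ N := by
    have h1 : s ∣ N * d := by rw [hN]; exact hsq.mul_right _
    refine ((hs.dvd_mul.1 h1).resolve_right fun h2 => ?_)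
    have h3 := h2.trans (Nat.gcd_dvd_left 4 (q + 1))
    rw [show 4 = 2 ^ 2 by norm_num] at h3
    exact hs2 ((Nat.prime_dvd_prime_iff_eq hs Nat.prime_two).1 (hs.dvd_of_dvd_pow h3))
  have hpk : ¬ p ∣ (q ^ 2 + 1) * (q - 1) := by
    rw [h.prime.dvd_mul]
    rintro (h1 | h1)
    · have := (Nat.dvd_add_right (dvd_pow h.p_dvd_q (by norm_num : 2 ≠ 0))).1 h1
      exact h.prime.one_lt.ne' (Nat.dvd_one.1 this)
    · have := (Nat.dvd_sub h.p_dvd_q h1)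
      rw [Nat.sub_sub_self (by omega)] at this
      exact h.prime.one_lt.ne' (Nat.dvd_one.1 this)
  obtain ⟨lam, hlam⟩ := h.exists_orderOf_algebraicClosure hpk
  have hpos : 0 < (q ^ 2 + 1) * (q - 1) := Nat.mul_pos (by positivity) (by omega)
  have hlam0 : lam ≠ 0 := by
    rintro rfl
    rw [orderOf_zero] at hlam
    omega
  have hroot : lam ^ ((q ^ 2 + 1) * (q - 1)) = 1 := by rw [← hlam, pow_orderOf_eq_one]
  have hq4 : lam ^ q ^ 4 = lam := by
    have h1 : (q ^ 2 + 1) * (q - 1) * (q + 1) + 1 = q ^ 4 := by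
      obtain ⟨u, rfl⟩ : ∃ u, q = u + 1 := ⟨q - 1, by omega⟩
      rw [Nat.add_sub_cancel]; ring
    rw [← h1, pow_succ, pow_mul, hroot, one_pow, one_mul]
  have hdvd : ∀ i, lam ^ ((q + 1) * i) = 1 → N ∣ i := fun i hi =>
    dvd_of_mul_dvd_add_one_mul hN hd hq3 (hlam ▸ orderOf_dvd_of_pow_eq_one hi)
  set mu := lam ^ q ^ 2 with hmu
  have hmuq : mu ^ q ^ 2 = lam := by rw [hmu, ← pow_mul, ← pow_add, hq4]
  obtain ⟨τ, hτ⟩ := h.mem_range_algebraMap (x := lam + mu) (by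
    rw [h.add_pow_q_pow, hmuq, ← hmu, add_comm])
  have hn0q : (lam * mu) ^ q = lam * mu := by
    have h1 : (lam * mu) ^ (q - 1) = 1 := by
      rw [hmu, ← pow_succ', ← pow_mul, hroot]
    rw [← Nat.sub_add_cancel (show 1 ≤ q by omega), pow_succ, h1, one_mul]
  obtain ⟨n0, hn0⟩ := h.mem_range_algebraMap (x := lam * mu) (by
    rw [sq, pow_mul, hn0q, hn0q])
  have hinj := (algebraMap F (AlgebraicClosure F)).injective
  have hmu0 : mu ≠ 0 := pow_ne_zero _ hlam0
  have hn00 : n0 ≠ 0 := by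
    rintro rfl
    rw [map_zero] at hn0
    exact mul_ne_zero hlam0 hmu0 hn0.symm
  have hσn0 : σ n0 = n0 := by
    apply hinj
    rw [h.conj, map_pow, hn0, hn0q]
  have hστ : algebraMap F (AlgebraicClosure F) (σ τ) = lam ^ q + mu ^ q := by
    rw [h.conj, map_pow, hτ]
    have := h.add_pow_q_pow lam mu 1
    rwa [pow_one] at this
  let t : unitaryJ σ := levi h.invol 0 (-n0) 1 τ n0 (by ring) hn00 hσn0
  set T := (mat t).map (algebraMap F (AlgebraicClosure F)) with hT
  have hleft : ∀ x, (x = lam ∨ x = mu) → ![1, x, 0, 0] ᵥ* T = x • ![1, x, 0, 0] := by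
    intro x hx
    have hx2 : x * (lam + mu) = lam * mu + x * x := by
      rcases hx with rfl | rfl <;> ring
    ext j
    fin_cases j <;>
      simp [hT, t, Matrix.vecMul, dotProduct, Fin.sum_univ_succ, hn0, hτ, hx2]
  have hright : ∀ x, (x = lam ∨ x = mu) →
      T *ᵥ ![0, 0, 1, (x ^ q)⁻¹] = (x ^ q)⁻¹ • ![0, 0, 1, (x ^ q)⁻¹] := by
    intro x hx
    have hxq : x ^ q ≠ 0 := by
      rcases hx with rfl | rfl
      exacts [pow_ne_zero _ hlam0, pow_ne_zero _ hmu0]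
    have hx2 : x ^ q * (lam ^ q + mu ^ q) = lam * mu + x ^ q * x ^ q := by
      rw [← hn0q, mul_pow]
      rcases hx with rfl | rfl <;> ring
    have hlm := mul_ne_zero hlam0 hmu0
    ext j
    fin_cases j
    · simp [hT, t, Matrix.mulVec, dotProduct, Fin.sum_univ_succ]
    · simp [hT, t, Matrix.mulVec, dotProduct, Fin.sum_univ_succ]
    · simp [hT, t, Matrix.mulVec, dotProduct, Fin.sum_univ_succ, hn0, hσn0, hlam0, hmu0]
    · simp [hT, t, Matrix.mulVec, dotProduct, Fin.sum_univ_succ, hn0, hστ]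
      field_simp
      linear_combination hx2
  have hleft' : ∀ x, (x = lam ∨ x = mu) → ∀ i : ℕ,
      ![1, x, 0, 0] ᵥ* T ^ i = x ^ i • ![1, x, 0, 0] := by
    intro x hx i
    induction i with
    | zero => simp
    | succ i ih => rw [pow_succ, ← Matrix.vecMul_vecMul, ih, Matrix.smul_vecMul, hleft x hx,
        smul_smul, ← pow_succ]
  have hright' : ∀ x, (x = lam ∨ x = mu) → ∀ i : ℕ,
      T ^ i *ᵥ ![0, 0, 1, (x ^ q)⁻¹] = ((x ^ q)⁻¹) ^ i • ![0, 0, 1, (x ^ q)⁻¹] := by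
    intro x hx i
    induction i with
    | zero => simp
    | succ i ih => rw [pow_succ', ← Matrix.mulVec_mulVec, ih, Matrix.mulVec_smul, hright x hx,
        smul_smul, ← pow_succ]
  set n := orderOf (t : projUnitary σ) with hn
  have hn_pos : 0 < n := orderOf_pos _
  have hNn : N ∣ n := by
    obtain ⟨ζ, hζ⟩ := (h.orderOf_dvd_iff t n).1 dvd_rfl
    have hζ1 : σ ζ * ζ = 1 := scalar_mul_conj (by rw [map_pow, hζ])
    have h1 := congrFun (hleft' lam (Or.inl rfl) n) 0
    rw [hT, ← Matrix.map_pow, hζ] at h1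
    simp [Matrix.vecMul, dotProduct, Fin.sum_univ_succ] at h1
    apply hdvd
    rw [mul_comm, pow_mul, ← h1, ← map_pow, pow_succ, ← h.conj, hζ1, map_one]
  have hnN : n ∣ N := h.orderOf_dvd_of_prime_dvd_sq_add_one hs hs2 hsq (hsN.trans hNn) hN hdq
  have hrn : r * n ∉ elementOrders (projUnitary σ) := by
    rintro ⟨y, hy⟩
    obtain ⟨y, rfl⟩ := QuotientGroup.mk_surjective y
    have h1 := h.orderOf_dvd_of_prime_dvd_sq_add_one hs hs2 hsq (y := y)
      (by rw [hy]; exact (hsN.trans hNn).mul_left r) hN hdq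
    rw [hy] at h1
    have h2 := Nat.le_of_dvd hn_pos (h1.trans hNn)
    have := hr.two_le
    nlinarith
  obtain ⟨c, hc⟩ := h.exists_card_siegelGroup
  refine smul_eq_self_of_fpf (siegelGroup σ) (t := t) hn_pos ?_ ?_ (hV.sum_smul t hrn)
    hV.nsmul_eq_zero ?_ hg v
  · intro e he
    have hcomm1 : mat t * diagonal ![1, 1, 0, 0] = diagonal ![1, 1, 0, 0] * mat t := by
      rw [← Matrix.ext_iff]
      simp [t, Fin.forall_fin_succ]
    have hcomm2 : mat t * diagonal ![0, 0, 1, 1] = diagonal ![0, 0, 1, 1] * mat t := by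
      rw [← Matrix.ext_iff]
      simp [t, Fin.forall_fin_succ]
    have hinv : mat t * mat t⁻¹ = 1 := by rw [← map_mul, mul_inv_cancel, map_one]
    have hinv' : mat t⁻¹ * mat t = 1 := by rw [← map_mul, inv_mul_cancel, map_one]
    rw [mem_siegelGroup] at he ⊢
    have hi1 : mat t⁻¹ * diagonal ![1, 1, 0, 0] = diagonal ![1, 1, 0, 0] * mat t⁻¹ := by
      calc _ = mat t⁻¹ * (diagonal ![1, 1, 0, 0] * mat t) * mat t⁻¹ := by
            simp only [Matrix.mul_assoc, hinv, Matrix.mul_one]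
        _ = _ := by rw [← hcomm1, ← Matrix.mul_assoc, hinv', Matrix.one_mul]
    constructor
    · rw [map_mul, map_mul, Matrix.mul_assoc, hi1, ← Matrix.mul_assoc, Matrix.mul_assoc (mat t),
        he.1, hcomm1, Matrix.mul_assoc, hinv, Matrix.mul_one]
    · rw [map_mul, map_mul, ← Matrix.mul_assoc, ← Matrix.mul_assoc, ← hcomm2,
        Matrix.mul_assoc (mat t), he.2, hcomm2, Matrix.mul_assoc, hinv, Matrix.mul_one]
  · intro i hi0 hin e he hcom
    by_contra hne
    obtain ⟨x, y, z, w, hM⟩ := exists_eq_of_mem_siegelGroup he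
    have hni : ¬ N ∣ i := fun hd => by
      have := Nat.le_of_dvd hi0 (hnN.trans hd)
      omega
    have hsep : ∀ a b, (lam = a ∨ mu = a) → (lam = b ∨ mu = b) → a ^ i * (b ^ q) ^ i ≠ 1 := by
      intro a b ha hb hab
      apply hni
      apply hdvd
      obtain rfl | rfl := ha <;> obtain rfl | rfl := hb
      · rw [pow_mul, pow_succ', mul_pow, hab]
      · calc lam ^ ((q + 1) * i) = lam ^ (i * q) * (lam ^ q ^ 4) ^ i := by rw [hq4]; ring
          _ = (lam ^ i * ((lam ^ q ^ 2) ^ q) ^ i) ^ q := by ring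
          _ = 1 := by rw [← hmu, hab, one_pow]
      · calc lam ^ ((q + 1) * i) = (lam ^ q ^ 4) ^ (q * i) * (lam ^ q ^ 4) ^ i := by
              rw [hq4]; ring
          _ = ((lam ^ q ^ 2) ^ i * (lam ^ q) ^ i) ^ q ^ 3 := by ring
          _ = 1 := by rw [← hmu, hab, one_pow]
      · calc lam ^ ((q + 1) * i) = (lam ^ q ^ 4) ^ i * (lam ^ q ^ 4) ^ (q * i) := by
              rw [hq4]; ring
          _ = ((lam ^ q ^ 2) ^ i * ((lam ^ q ^ 2) ^ q) ^ i) ^ q ^ 2 := by ring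
          _ = 1 := by rw [← hmu, hab, one_pow]
    set B := (mat e).map (algebraMap F (AlgebraicClosure F)) - 1 with hB
    have hBT : T ^ i * B = B * T ^ i := by
      have h1 := congrArg (fun g => (mat g).map (algebraMap F (AlgebraicClosure F))) hcom
      simp only [map_mul, map_pow, Matrix.map_mul, Matrix.map_pow] at h1
      rw [hB, Matrix.mul_sub, Matrix.sub_mul, hT, h1, Matrix.mul_one, Matrix.one_mul]
    have hzero : ∀ a b, (a = lam ∨ a = mu) → (b = lam ∨ b = mu) →
        ![1, a, 0, 0] ⬝ᵥ B *ᵥ ![0, 0, 1, (b ^ q)⁻¹] = 0 := by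
      intro a b ha hb
      have hb0 : b ^ q ≠ 0 := by
        rcases hb with rfl | rfl
        exacts [pow_ne_zero _ hlam0, pow_ne_zero _ hmu0]
      have h1 : ![1, a, 0, 0] ⬝ᵥ (T ^ i * B) *ᵥ ![0, 0, 1, (b ^ q)⁻¹] =
          ![1, a, 0, 0] ⬝ᵥ (B * T ^ i) *ᵥ ![0, 0, 1, (b ^ q)⁻¹] := by rw [hBT]
      rw [← Matrix.mulVec_mulVec, ← Matrix.mulVec_mulVec, hright' b hb, Matrix.mulVec_smul,
        dotProduct_smul, Matrix.dotProduct_mulVec, hleft' a ha, smul_dotProduct, smul_eq_mul,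
        smul_eq_mul, ← sub_eq_zero, ← sub_mul, mul_eq_zero] at h1
      refine h1.resolve_left fun h2 => hsep a b (ha.imp Eq.symm Eq.symm) (hb.imp Eq.symm Eq.symm) ?_
      rw [sub_eq_zero.1 h2, ← mul_pow, inv_mul_cancel₀ hb0, one_pow]
    have hlm : lam ≠ mu := by
      intro h1
      have h2 : lam ^ (q ^ 2 - 1) = 1 := by
        have h3 : lam ^ (q ^ 2 - 1) * lam = 1 * lam := by
          rw [← pow_succ, Nat.sub_add_cancel (Nat.one_le_pow _ _ (by omega)), one_mul, ← hmu, ← h1]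
        exact mul_right_cancel₀ hlam0 h3
      have h3 := orderOf_dvd_of_pow_eq_one h2
      rw [hlam, show q ^ 2 - 1 = (q + 1) * (q - 1) by
        rw [← Nat.sq_sub_sq, one_pow]] at h3
      have h4 := Nat.le_of_dvd (by omega) (Nat.dvd_of_mul_dvd_mul_right (by omega) h3)
      nlinarith
    have hlmq : lam ^ q ≠ mu ^ q := by
      intro h1
      have h2 := congrArg (· ^ q ^ 3) h1
      simp only [← pow_mul, ← pow_succ'] at h2
      rw [hq4, show q ^ (3 + 1) = q ^ 2 * q ^ 2 by ring, pow_mul, hmuq, ← hmu] at h2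
      exact hlm h2
    have hlq := pow_ne_zero q hlam0
    have hmq := pow_ne_zero q hmu0
    have e1 := hzero lam lam (Or.inl rfl) (Or.inl rfl)
    have e2 := hzero lam mu (Or.inl rfl) (Or.inr rfl)
    have e3 := hzero mu lam (Or.inr rfl) (Or.inl rfl)
    have e4 := hzero mu mu (Or.inr rfl) (Or.inr rfl)
    simp [hB, hM, dotProduct, Matrix.mulVec, Fin.sum_univ_succ, Matrix.one_apply] at e1 e2 e3 e4
    obtain ⟨rfl, rfl, rfl, rfl⟩ : x = 0 ∧ y = 0 ∧ z = 0 ∧ w = 0 := by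
      simpa using eq_zero_of_bilinear hlm (inv_injective.ne hlmq) e1 e2 e3 e4
    apply hne
    apply mat_injective
    rw [hM, map_one, ← Matrix.ext_iff]
    simp [Fin.forall_fin_succ, Matrix.one_apply]
  · rw [hc]
    exact ((Nat.coprime_primes hr h.prime).2 hrp).pow_right c

end Siegel

section RootElements

variable {F : Type*} [Field F] {p m q : ℕ} {σ : F →+* F}

theorem map_inv_eq_neg {y : F} (hy : σ y = -y) : σ (-y⁻¹) = -(-y⁻¹) := by
  rw [map_neg, map_inv₀, hy, inv_neg]

theorem Subgroup.Normal.mem_of_mat_mul_eq {K : Subgroup (unitaryJ σ)} (hK : K.Normal)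
    {g n : unitaryJ σ} (hn : n ∈ K) (c : unitaryJ σ) (h : mat g * mat c = mat c * mat n) :
    g ∈ K := by
  have h1 : g * c = c * n := mat_injective (by rw [map_mul, map_mul, h])
  rw [eq_mul_inv_of_mul_eq h1]
  exact hK.conj_mem n hn c

theorem lowerSiegel_mem {K : Subgroup (unitaryJ σ)} (hK : K.Normal) (hs : siegelGroup σ ≤ K)
    (x y z : F) (hx : σ (σ x) = x) (hy : σ y = -y) (hz : σ z = -z) :
    lowerSiegel x y z hx hy hz ∈ K := by
  let c : unitaryJ σ := mkForm (antiDiag F) det_antiDiag (by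
    rw [← Matrix.ext_iff]
    simp [Fin.forall_fin_succ, antiDiag, Matrix.mul_apply, Fin.sum_univ_succ])
  refine hK.mem_of_mat_mul_eq
    (hs (siegel_mem_siegelGroup (-σ x) y z (by simp [hx]) hy hz)) c ?_
  rw [mat_lowerSiegel, mat_siegel, show mat c = antiDiag F from rfl, ← Matrix.ext_iff]
  simp [Fin.forall_fin_succ, antiDiag, Matrix.mul_apply, Fin.sum_univ_succ, hx]

theorem levi_upper_mem {K : Subgroup (unitaryJ σ)} (hK : K.Normal) (hs : siegelGroup σ ≤ K)
    (hσ : ∀ x, σ (σ x) = x) {y : F} (hy0 : y ≠ 0) (hy : σ y = -y) (b : F) :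
    levi hσ 1 b 0 1 1 (by ring) one_ne_zero (map_one σ) ∈ K := by
  let c : unitaryJ σ := mkForm !![1, 0, 0, 0; 0, 0, y, 0; 0, -y⁻¹, 0, 0; 0, 0, 0, 1]
    (by simp [det_succ_row_zero, Fin.sum_univ_succ, Fin.succAbove, hy0])
    (by
      rw [← Matrix.ext_iff]
      simp [Fin.forall_fin_succ, antiDiag, Matrix.mul_apply, Fin.sum_univ_succ, hy, hy0])
  refine hK.mem_of_mat_mul_eq
    (hs (siegel_mem_siegelGroup (b * y) 0 0 (hσ _) (by simp) (by simp))) c ?_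
  rw [← Matrix.ext_iff]
  simp [c, Fin.forall_fin_succ, Matrix.mul_apply, Fin.sum_univ_succ, hy]
  field_simp

theorem levi_lower_mem {K : Subgroup (unitaryJ σ)} (hK : K.Normal) (hs : siegelGroup σ ≤ K)
    (hσ : ∀ x, σ (σ x) = x) {y : F} (hy0 : y ≠ 0) (hy : σ y = -y) (b : F) :
    levi hσ 1 0 b 1 1 (by ring) one_ne_zero (map_one σ) ∈ K := by
  let c : unitaryJ σ := mkForm !![1, 0, 0, 0; 0, 0, y, 0; 0, -y⁻¹, 0, 0; 0, 0, 0, 1]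
    (by simp [det_succ_row_zero, Fin.sum_univ_succ, Fin.succAbove, hy0])
    (by
      rw [← Matrix.ext_iff]
      simp [Fin.forall_fin_succ, antiDiag, Matrix.mul_apply, Fin.sum_univ_succ, hy, hy0])
  refine hK.mem_of_mat_mul_eq
    (lowerSiegel_mem hK hs (y⁻¹ * b) 0 0 (hσ _) (by simp) (by simp)) c ?_
  rw [← Matrix.ext_iff]
  simp [c, Fin.forall_fin_succ, Matrix.mul_apply, Fin.sum_univ_succ, hy]
  field_simp
  simp

theorem levi_companion_mem {K : Subgroup (unitaryJ σ)} (hK : K.Normal) (hs : siegelGroup σ ≤ K)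
    (hσ : ∀ x, σ (σ x) = x) {y : F} (hy0 : y ≠ 0) (hy : σ y = -y) (b : F) :
    levi hσ 0 (-1) 1 b 1 (by ring) one_ne_zero (map_one σ) ∈ K := by
  have h1 := mul_mem (mul_mem (levi_upper_mem hK hs hσ hy0 hy (-1))
    (levi_lower_mem hK hs hσ hy0 hy 1)) (levi_upper_mem hK hs hσ hy0 hy (b - 1))
  convert h1 using 1
  apply mat_injective
  rw [map_mul, map_mul, ← Matrix.ext_iff]
  simp [Fin.forall_fin_succ, Matrix.mul_apply, Fin.sum_univ_succ]

theorem IsUnitaryField.prime_dvd_orderOf (h : IsUnitaryField F p m q σ) {s : ℕ} (hs : s.Prime)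
    (hs2 : s ≠ 2) {g : unitaryJ σ} {x : AlgebraicClosure F} (hx : orderOf x = s)
    {v : Fin 4 → AlgebraicClosure F} {j : Fin 4} (hj : v j ≠ 0)
    (hv : v ᵥ* (mat g).map (algebraMap F (AlgebraicClosure F)) = x • v) :
    s ∣ orderOf (g : projUnitary σ) := by
  set T := (mat g).map (algebraMap F (AlgebraicClosure F)) with hT
  have hpow : ∀ i : ℕ, v ᵥ* T ^ i = x ^ i • v := by
    intro i
    induction i with
    | zero => simp
    | succ i ih =>
      rw [pow_succ, ← Matrix.vecMul_vecMul, ih, Matrix.smul_vecMul, hv, smul_smul, ← pow_succ]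
  have h1 := h.pow_eq_one_of_dvd g (dvd_refl _)
  have h2 := congrFun (hpow (orderOf (g : projUnitary σ) * 4)) j
  rw [hT, ← Matrix.map_pow, h1, Matrix.map_one _ (map_zero _) (map_one _), Matrix.vecMul_one,
    Pi.smul_apply, smul_eq_mul] at h2
  have h3 := mul_right_cancel₀ hj ((one_mul (v j)).trans h2)
  have h4 := orderOf_dvd_of_pow_eq_one h3.symm
  rw [hx] at h4
  refine (hs.dvd_mul.1 h4).resolve_right fun h5 => hs2 ?_
  rw [show 4 = 2 ^ 2 by norm_num] at h5
  exact (Nat.prime_dvd_prime_iff_eq hs Nat.prime_two).1 (hs.dvd_of_dvd_pow h5)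

theorem IsUnitaryField.exists_mem_of_dvd_sq_add_one (h : IsUnitaryField F p m q σ) {s : ℕ}
    (hs : s.Prime) (hs2 : s ≠ 2) (hsq : s ∣ q ^ 2 + 1) :
    ∃ b, s ∣ orderOf ((levi h.invol 0 (-1) 1 b 1 (by ring) one_ne_zero (map_one σ) :
      unitaryJ σ) : projUnitary σ) := by
  have hps : ¬ p ∣ s := fun hd => by
    obtain rfl := (Nat.prime_dvd_prime_iff_eq h.prime hs).1 hd
    have := (Nat.dvd_add_right (dvd_pow h.p_dvd_q (by norm_num : 2 ≠ 0))).1 hsq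
    exact hs.one_lt.ne' (Nat.dvd_one.1 this)
  obtain ⟨x, hx⟩ := h.exists_orderOf_algebraicClosure hps
  have hx0 : x ≠ 0 := by
    rintro rfl
    rw [orderOf_zero] at hx
    exact hs.pos.ne hx
  have hxq : x ^ q ^ 2 = x⁻¹ := by
    refine eq_inv_of_mul_eq_one_left ?_
    rw [← pow_succ]
    exact orderOf_dvd_iff_pow_eq_one.1 (hx ▸ hsq)
  obtain ⟨b, hb⟩ := h.mem_range_algebraMap (x := x + x⁻¹) (by
    rw [h.add_pow_q_pow, inv_pow, hxq, inv_inv, add_comm])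
  refine ⟨b, h.prime_dvd_orderOf hs hs2 hx (v := ![1, x, 0, 0]) (j := 0) (by simp) ?_⟩
  ext j
  fin_cases j <;> simp [Matrix.vecMul, dotProduct, Fin.sum_univ_succ, hb]
  field_simp
  ring

theorem IsUnitaryField.exists_mem_of_dvd_sq_sub_add_one (h : IsUnitaryField F p m q σ)
    {K : Subgroup (unitaryJ σ)} (hK : K.Normal) (hsK : siegelGroup σ ≤ K) {R w : ℕ}
    (hR : R + q = q ^ 2 + 1) (hw : w.Prime) (hwR : w ∣ R) :
    ∃ g ∈ K, w ∣ orderOf (g : projUnitary σ) := by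
  have hpw : ¬ p ∣ w := fun hd => by
    obtain rfl := (Nat.prime_dvd_prime_iff_eq h.prime hw).1 hd
    have h1 : p ∣ q ^ 2 + 1 := hR ▸ dvd_add hwR h.p_dvd_q
    have := (Nat.dvd_add_right (dvd_pow h.p_dvd_q (by norm_num : 2 ≠ 0))).1 h1
    exact hw.one_lt.ne' (Nat.dvd_one.1 this)
  have hw2 : w ≠ 2 := by
    rintro rfl
    obtain ⟨k, hk⟩ := h.q_odd
    obtain ⟨j, rfl⟩ := hwR
    rw [hk] at hR
    ring_nf at hR
    omega
  obtain ⟨y, hy0, hy⟩ := h.exists_conj_eq_neg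
  obtain ⟨x, hx⟩ := h.exists_orderOf_algebraicClosure hpw
  have hx0 : x ≠ 0 := by
    rintro rfl
    rw [orderOf_zero] at hx
    exact hw.pos.ne hx
  have hxR : x ^ R = 1 := orderOf_dvd_iff_pow_eq_one.1 (hx ▸ hwR)
  have hxq0 := pow_ne_zero q hx0
  have hx2 : x ^ q ^ 2 * x = x ^ q := by
    rw [← pow_succ, ← hR, pow_add, hxR, one_mul]
  have hx2' : x ^ q ^ 2 = x ^ q * x⁻¹ := (eq_mul_inv_iff_mul_eq₀ hx0).2 hx2
  have hx3 : x ^ q ^ 3 = x⁻¹ := by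
    have : x ^ q ^ 3 * x ^ q = x ^ q ^ 2 := by
      calc x ^ q ^ 3 * x ^ q = (x ^ q ^ 2 * x) ^ q := by ring
        _ = x ^ q ^ 2 := by rw [hx2]; ring
    rw [hx2'] at this
    apply mul_right_cancel₀ hxq0
    rw [this, mul_comm]
  have hx4 : x ^ q ^ 4 = (x ^ q)⁻¹ := by
    calc x ^ q ^ 4 = (x ^ q ^ 3) ^ q := by ring
      _ = (x ^ q)⁻¹ := by rw [hx3, inv_pow]
  have hx5 : x ^ q ^ 5 = (x ^ q)⁻¹ * x := by
    calc x ^ q ^ 5 = (x ^ q ^ 3) ^ q ^ 2 := by ring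
      _ = (x ^ q)⁻¹ * x := by rw [hx3, inv_pow, hx2', mul_inv, inv_inv]
  have hx6 : x ^ q ^ 6 = x := by
    calc x ^ q ^ 6 = (x ^ q ^ 3) ^ q ^ 3 := by ring
      _ = x := by rw [hx3, inv_pow, hx3, inv_inv]
  obtain ⟨b, hb⟩ := h.mem_range_algebraMap (x := x + x ^ q ^ 2 + x ^ q ^ 4) (by
    rw [h.add_pow_q_pow, h.add_pow_q_pow]
    calc x ^ q ^ 2 + (x ^ q ^ 2) ^ q ^ 2 + (x ^ q ^ 4) ^ q ^ 2
        = x ^ q ^ 2 + x ^ q ^ 4 + x ^ q ^ 6 := by ring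
      _ = _ := by rw [hx6]; ring)
  have hσb : algebraMap F (AlgebraicClosure F) (σ b) = x ^ q + x⁻¹ + (x ^ q)⁻¹ * x := by
    rw [h.conj, map_pow, hb]
    have h1 := h.add_pow_q_pow (x + x ^ q ^ 2) (x ^ q ^ 4) 1
    have h2 := h.add_pow_q_pow x (x ^ q ^ 2) 1
    rw [pow_one] at h1 h2
    rw [h1, h2, ← hx3, ← hx5]
    ring
  rw [hx2', hx4] at hb
  set z := y * (1 - b) with hz
  have hs1 := siegel_mem_siegelGroup (σ := σ) 1 (z - σ z) 0 (by simp) (by simp [h.invol]) (by simp)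
  have hs2 := siegel_mem_siegelGroup (σ := σ) 0 y 0 (by simp) hy (by simp)
  have hs3 := lowerSiegel_mem hK hsK 0 (-y⁻¹) 0 (by simp) (map_inv_eq_neg hy) (by simp)
  have hs4 := levi_upper_mem hK hsK h.invol hy0 hy (-z)
  refine ⟨_, mul_mem (mul_mem (hsK hs1) hs4) (mul_mem (mul_mem (hsK hs2) hs3) (hsK hs2)),
    h.prime_dvd_orderOf hw hw2 hx (j := 2) (v := ![x - 1, -algebraMap _ _ z, 1,
      algebraMap _ _ y * (x - 1) * x⁻¹]) (by simp) ?_⟩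
  have hM : mat (siegel 1 (z - σ z) 0 (by simp) (by simp [h.invol]) (by simp) *
      levi h.invol 1 (-z) 0 1 1 (by ring) one_ne_zero (map_one σ) *
      (siegel 0 y 0 (by simp) hy (by simp) *
      lowerSiegel 0 (-y⁻¹) 0 (by simp) (map_inv_eq_neg hy) (by simp) *
      siegel 0 y 0 (by simp) hy (by simp)) : unitaryJ σ) =
      !![-z * y⁻¹, -z, 1, y; y⁻¹, 1, 0, 0; -σ z * y⁻¹, 0, 1, 0; -y⁻¹, 0, 0, 0] := by
    simp only [map_mul]
    rw [← Matrix.ext_iff]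
    simp [Fin.forall_fin_succ, Matrix.mul_apply, Fin.sum_univ_succ, hy0]
  rw [hM]
  have hay : algebraMap F (AlgebraicClosure F) y ≠ 0 := by simpa using hy0
  ext j
  fin_cases j
  · simp [Matrix.vecMul, dotProduct, Fin.sum_univ_succ, hz, hy, hb, hσb]
    field_simp
    ring
  · simp [Matrix.vecMul, dotProduct, Fin.sum_univ_succ]
    ring
  · simp [Matrix.vecMul, dotProduct, Fin.sum_univ_succ]
  · simp [Matrix.vecMul, dotProduct, Fin.sum_univ_succ]
    field_simp

end RootElements

section CrossCharacteristic

variable {F : Type*} [Field F] {p m q : ℕ} {σ : F →+* F} {r : ℕ} {V : Type*} [AddCommGroup V]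
  [DistribMulAction (unitaryJ σ) V]

theorem IsUnitaryModule.eq_zero_of_smul_eq_self (hV : IsUnitaryModule σ r V) (hr : r.Prime)
    {x : unitaryJ σ} (hx : ¬ r ∣ orderOf (x : projUnitary σ))
    (hω : r * orderOf (x : projUnitary σ) ∉ elementOrders (projUnitary σ)) {v : V}
    (hv : x • v = v) : v = 0 := by
  have h1 := hV.sum_smul x hω v
  have h2 : ∀ i : ℕ, x ^ i • v = v := by
    intro i
    induction i with
    | zero => simp
    | succ i ih => rw [pow_succ, mul_smul, hv, ih]
  simp only [h2, Finset.sum_const, Finset.card_range] at h1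
  have h3 : addOrderOf v ∣ 1 := by
    rw [← (Nat.Prime.coprime_iff_not_dvd hr).2 hx]
    exact Nat.dvd_gcd (addOrderOf_dvd_of_nsmul_eq_zero (hV.nsmul_eq_zero v))
      (addOrderOf_dvd_of_nsmul_eq_zero h1)
  rwa [Nat.dvd_one, AddMonoid.addOrderOf_eq_one_iff] at h3

theorem IsUnitaryField.finite_projUnitary (h : IsUnitaryField F p m q σ) :
    Finite (projUnitary σ) := by
  have := h.finite
  have : Finite (SpecialLinearGroup (Fin 4) F) := Subtype.finite
  infer_instance

theorem IsUnitaryField.gcd_dvd (h : IsUnitaryField F p m q σ) :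
    Nat.gcd 4 (q + 1) ∣ (q ^ 2 + 1) * (q - 1) := by
  have hdq : Nat.gcd 4 (q + 1) ∣ q + 1 := Nat.gcd_dvd_right 4 (q + 1)
  have h1 : Nat.gcd 4 (q + 1) ∣ 4 := Nat.gcd_dvd_left 4 _
  have := h.q_ge
  obtain ⟨u, rfl⟩ : ∃ u, q = u + 1 := ⟨q - 1, by omega⟩
  rw [Nat.add_sub_cancel]
  zify at h1 hdq ⊢
  have := (hdq.mul_left ((u : ℤ) ^ 2 + 2)).sub h1
  rwa [show ((u : ℤ) ^ 2 + 2) * (u + 1 + 1) - 4 = ((u + 1) ^ 2 + 1) * u by ring] at this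

theorem IsUnitaryField.eq_zero_of_levi_smul (h : IsUnitaryField F p m q σ)
    (hV : IsUnitaryModule σ r V) (hr : r.Prime) {N : ℕ}
    (hN : N * Nat.gcd 4 (q + 1) = (q ^ 2 + 1) * (q - 1)) (hrN : ¬ r ∣ N) {v : V}
    (hv : ∀ b, (levi h.invol 0 (-1) 1 b 1 (by ring) one_ne_zero (map_one σ) : unitaryJ σ) • v = v) :
    v = 0 := by
  have := h.finite_projUnitary
  obtain ⟨s, hs, hs2, hsq⟩ := exists_odd_prime_dvd_sq_add_one h.q_odd h.q_ge
  obtain ⟨b, hb⟩ := h.exists_mem_of_dvd_sq_add_one hs hs2 hsq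
  have hdq := Nat.gcd_dvd_right 4 (q + 1)
  have h1 := h.orderOf_dvd_of_prime_dvd_sq_add_one hs hs2 hsq hb hN hdq
  refine hV.eq_zero_of_smul_eq_self hr (fun h2 => hrN (h2.trans h1)) ?_ (hv b)
  rintro ⟨y, hy⟩
  obtain ⟨y, rfl⟩ := QuotientGroup.mk_surjective y
  have h2 := h.orderOf_dvd_of_prime_dvd_sq_add_one hs hs2 hsq (y := y)
    (by rw [hy]; exact hb.mul_left r) hN hdq
  rw [hy] at h2
  exact hrN ((dvd_mul_right r _).trans h2)

theorem IsUnitaryField.subsingleton_of_ne (h : IsUnitaryField F p m q σ)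
    (hV : IsUnitaryModule σ r V) (hr : r.Prime) (hrp : r ≠ p) : Subsingleton V := by
  have := h.finite_projUnitary
  have hq3 := h.q_ge
  refine subsingleton_of_forall_eq 0 fun v => ?_
  set K := (MulAction.toPermHom (unitaryJ σ) V).ker with hKdef
  have hmem : ∀ g ∈ K, ∀ w : V, g • w = w := fun g hg w =>
    congrFun (congrArg DFunLike.coe hg) w
  have hK : K.Normal := MonoidHom.normal_ker _
  have hsK : siegelGroup σ ≤ K := fun g hg =>
    Equiv.ext fun w => h.smul_eq_self_of_mem_siegelGroup hr hrp hV hg w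
  obtain ⟨y, hy0, hy⟩ := h.exists_conj_eq_neg
  obtain ⟨N, hN⟩ := h.gcd_dvd
  have hN' : N * Nat.gcd 4 (q + 1) = (q ^ 2 + 1) * (q - 1) := by rw [hN, mul_comm]
  by_cases hrN : r ∣ N
  · have hdq := Nat.gcd_dvd_right 4 (q + 1)
    obtain ⟨R, hR⟩ : ∃ R, R + q = q ^ 2 + 1 := ⟨q ^ 2 + 1 - q, Nat.sub_add_cancel (by nlinarith)⟩
    obtain ⟨M, hM⟩ : Nat.gcd 4 (q + 1) ∣ q ^ 3 + 1 := by
      refine hdq.trans ⟨R, ?_⟩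
      zify at hR ⊢
      linear_combination (-(q : ℤ) - 1) * hR
    have hM' : M * Nat.gcd 4 (q + 1) = q ^ 3 + 1 := by rw [hM, mul_comm]
    have hrM := not_prime_dvd_of_coprime_torus_orders h.q_odd hq3 hR hN' hM' rfl hr hrN
    obtain ⟨w, hw, hw3, hwR⟩ := exists_prime_dvd_sq_sub_add_one hq3 hR
    obtain ⟨g, hg, hgw⟩ := h.exists_mem_of_dvd_sq_sub_add_one hK hsK hR hw hwR
    have hd4 := Nat.gcd_dvd_left 4 (q + 1)
    have h1 := h.orderOf_dvd_of_prime_dvd_sq_sub_add_one hR hw hw3 hwR hgw hM' hdq hd4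
    refine hV.eq_zero_of_smul_eq_self hr (fun h2 => hrM (h2.trans h1)) ?_ (hmem g hg v)
    rintro ⟨x, hx⟩
    obtain ⟨x, rfl⟩ := QuotientGroup.mk_surjective x
    have h2 := h.orderOf_dvd_of_prime_dvd_sq_sub_add_one hR hw hw3 hwR (y := x)
      (by rw [hx]; exact hgw.mul_left r) hM' hdq hd4
    rw [hx] at h2
    exact hrM ((dvd_mul_right r _).trans h2)
  · exact h.eq_zero_of_levi_smul hV hr hN' hrN fun b =>
      hmem _ (levi_companion_mem hK hsK h.invol hy0 hy b) v

end CrossCharacteristic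

section FormModule

variable {F : Type*} [Field F] {σ : F →+* F} {Φ : Matrix (Fin 4) (Fin 4) F}

/-- The subgroup of scalar matrices. -/
def scalarSubgroup (σ : F →+* F) (Φ : Matrix (Fin 4) (Fin 4) F) : Subgroup (formGroup σ Φ) where
  carrier := { g | ∃ ζ : F, mat g = ζ • (1 : Matrix (Fin 4) (Fin 4) F) }
  one_mem' := ⟨1, by simp⟩
  mul_mem' := by
    rintro a b ⟨ζ, ha⟩ ⟨ξ, hb⟩
    exact ⟨ζ * ξ, by rw [map_mul, ha, hb]; simp [smul_smul, mul_comm]⟩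
  inv_mem' := by
    rintro a ⟨ζ, ha⟩
    have h1 : mat a * mat a⁻¹ = 1 := by rw [← map_mul, mul_inv_cancel, map_one]
    rw [ha, smul_mul_assoc, one_mul] at h1
    have h0 : ζ ≠ 0 := by
      rintro rfl
      simp at h1
    exact ⟨ζ⁻¹, by rw [← h1, smul_smul, inv_mul_cancel₀ h0, one_smul]⟩

theorem mem_scalarSubgroup {g : formGroup σ Φ} :
    g ∈ scalarSubgroup σ Φ ↔ ∃ ζ : F, mat g = ζ • (1 : Matrix (Fin 4) (Fin 4) F) := Iff.rfl

theorem scalarSubgroup_le_center : scalarSubgroup σ Φ ≤ Subgroup.center (formGroup σ Φ) :=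
  fun _ ⟨_, h⟩ => mem_center_of_scalar h

instance : (scalarSubgroup σ Φ).Normal :=
  ⟨fun n hn g => by
    rwa [Subgroup.mem_center_iff.1 (scalarSubgroup_le_center hn) g, mul_inv_cancel_right]⟩

/-- A module for a form group on which scalars act trivially, and in which the elements whose
projective order is not of the form `s / r`, `s ∈ S`, have vanishing norm. -/
structure IsFormModule (σ : F →+* F) (Φ : Matrix (Fin 4) (Fin 4) F) (r : ℕ) (S : Set ℕ)
    (V : Type*) [AddCommGroup V] [DistribMulAction (formGroup σ Φ) V] : Prop where
  nsmul_eq_zero : ∀ v : V, r • v = 0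
  smul_eq : ∀ (g h : formGroup σ Φ) (ζ : F), mat g = ζ • mat h → ∀ v : V, g • v = h • v
  sum_smul : ∀ x : formGroup σ Φ, r * orderOf (x : formGroup σ Φ ⧸ scalarSubgroup σ Φ) ∉ S →
    ∀ v : V, ∑ i ∈ Finset.range (orderOf (x : formGroup σ Φ ⧸ scalarSubgroup σ Φ)), x ^ i • v = 0

theorem IsUnitaryModule.isFormModule {p m q r : ℕ} (h : IsUnitaryField F p m q σ) {V : Type*}
    [AddCommGroup V] [DistribMulAction (unitaryJ σ) V] (hV : IsUnitaryModule σ r V) :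
    IsFormModule σ (antiDiag F) r (elementOrders (projUnitary σ)) V := by
  have hc : scalarSubgroup σ (antiDiag F) = Subgroup.center (unitaryJ σ) := by
    ext g
    rw [mem_scalarSubgroup, ← h.mk_eq_one_iff, QuotientGroup.eq_one_iff]
  refine ⟨hV.nsmul_eq_zero, fun g k ζ hg v => ?_, fun x hx => ?_⟩
  · have h1 := hV.smul_of_scalar (g * k⁻¹) ζ (by
      rw [map_mul, hg, smul_mul_assoc, ← map_mul, mul_inv_cancel, map_one]) (k • v)
    rwa [smul_smul, inv_mul_cancel_right] at h1
  · rw [(orderOf_eq_orderOf_iff (y := (x : projUnitary σ))).2 (fun n => by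
      rw [← QuotientGroup.mk_pow, ← QuotientGroup.mk_pow, QuotientGroup.eq_one_iff,
        QuotientGroup.eq_one_iff, hc])] at hx ⊢
    exact hV.sum_smul x hx

theorem IsFormModule.transfer {Ψ : Matrix (Fin 4) (Fin 4) F} {r : ℕ} {S : Set ℕ} {V : Type*}
    [AddCommGroup V] [DistribMulAction (formGroup σ Φ) V] (hV : IsFormModule σ Φ r S V)
    (e : formGroup σ Ψ →* formGroup σ Φ)
    (he : ∀ g h : formGroup σ Ψ, ∀ ζ : F, mat g = ζ • mat h ↔ mat (e g) = ζ • mat (e h)) :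
    @IsFormModule F _ σ Ψ r S V _ (DistribMulAction.compHom V e) := by
  let _ : DistribMulAction (formGroup σ Ψ) V := DistribMulAction.compHom V e
  have hs : ∀ (g : formGroup σ Ψ) (v : V), g • v = e g • v := fun _ _ => rfl
  refine ⟨hV.nsmul_eq_zero, fun g k ζ hg v => hV.smul_eq _ _ ζ ((he _ _ _).1 hg) v,
    fun x hx => ?_⟩
  rw [(orderOf_eq_orderOf_iff (y := (e x : formGroup σ Φ ⧸ scalarSubgroup σ Φ))).2 (fun n => by
    rw [← QuotientGroup.mk_pow, ← QuotientGroup.mk_pow, QuotientGroup.eq_one_iff,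
      QuotientGroup.eq_one_iff, mem_scalarSubgroup, mem_scalarSubgroup, ← map_pow]
    refine exists_congr fun ζ => ?_
    have := he (x ^ n) 1 ζ
    rwa [map_one, map_one, map_one] at this)] at hx ⊢
  simpa only [hs, map_pow] using hV.sum_smul (e x) hx

theorem mat_formGroupEquiv {Ψ : Matrix (Fin 4) (Fin 4) F} (C : SpecialLinearGroup (Fin 4) F)
    (hC : ((slMat C).map σ)ᵀ * Φ * (slMat C) = Ψ) (g : formGroup σ Ψ) :
    mat (formGroupEquiv σ Φ Ψ C hC g) = slMat C * mat g * slMat C⁻¹ := by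
  change slMat (C * (g : SpecialLinearGroup (Fin 4) F) * C⁻¹) = _
  rw [map_mul, map_mul]
  rfl

theorem mat_eq_smul_iff {Ψ : Matrix (Fin 4) (Fin 4) F} (C : SpecialLinearGroup (Fin 4) F)
    (hC : ((slMat C).map σ)ᵀ * Φ * (slMat C) = Ψ) (g k : formGroup σ Ψ) (ζ : F) :
    mat (formGroupEquiv σ Φ Ψ C hC g) = ζ • mat (formGroupEquiv σ Φ Ψ C hC k) ↔
      mat g = ζ • mat k := by
  have h1 : slMat C⁻¹ * slMat C = 1 := by rw [← map_mul, inv_mul_cancel, map_one]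
  rw [mat_formGroupEquiv, mat_formGroupEquiv]
  constructor
  · intro h
    have h2 := congrArg (fun M => slMat C⁻¹ * M * slMat C) h
    simp only [mul_smul_comm, smul_mul_assoc] at h2
    simpa only [mul_assoc, h1, mul_one, ← mul_assoc (slMat C⁻¹) (slMat C), one_mul] using h2
  · intro h
    rw [h, mul_smul_comm, smul_mul_assoc]

end FormModule

section CharacteristicThree

variable {F : Type*} [Field F] {σ : F →+* F} {Φ : Matrix (Fin 4) (Fin 4) F} {S : Set ℕ}
  {V : Type*} [AddCommGroup V] [DistribMulAction (formGroup σ Φ) V]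

theorem IsFormModule.add_smul_add_smul_eq_zero (hV : IsFormModule σ Φ 3 S V) (hS : 18 ∉ S)
    {u z : formGroup σ Φ} (hu : u ∉ scalarSubgroup σ Φ) (hu3 : mat u ^ 3 = 1)
    (hz : z ∉ scalarSubgroup σ Φ) {ζ : F} (hz2 : mat z ^ 2 = ζ • (1 : Matrix (Fin 4) (Fin 4) F))
    (huz : mat u * mat z = mat z * mat u) {w : V} (hw : z • w = w) :
    w + u • w + u • u • w = 0 := by
  have hcomm : u * z = z * u := mat_injective (by rw [map_mul, map_mul, huz])
  have : Fact (Nat.Prime 3) := ⟨Nat.prime_three⟩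
  have o1 : orderOf (u : formGroup σ Φ ⧸ scalarSubgroup σ Φ) = 3 := by
    refine orderOf_eq_prime ?_ (by rwa [Ne, QuotientGroup.eq_one_iff])
    rw [← QuotientGroup.mk_pow, QuotientGroup.eq_one_iff]
    exact ⟨1, by rw [map_pow, hu3, one_smul]⟩
  have o2 : orderOf (z : formGroup σ Φ ⧸ scalarSubgroup σ Φ) = 2 := by
    refine orderOf_eq_prime ?_ (by rwa [Ne, QuotientGroup.eq_one_iff])
    rw [← QuotientGroup.mk_pow, QuotientGroup.eq_one_iff]
    exact ⟨ζ, by rw [map_pow, hz2]⟩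
  have o3 : orderOf ((u * z : formGroup σ Φ) : formGroup σ Φ ⧸ scalarSubgroup σ Φ) = 6 := by
    rw [QuotientGroup.mk_mul, Commute.orderOf_mul_eq_mul_orderOf_of_coprime, o1, o2]
    · change (u : formGroup σ Φ ⧸ scalarSubgroup σ Φ) * z = z * u
      rw [← QuotientGroup.mk_mul, hcomm, QuotientGroup.mk_mul]
    · rw [o1, o2]; decide
  have h1 := hV.sum_smul (u * z) (by rw [o3]; exact hS) w
  have hzpow : ∀ i : ℕ, (u * z) ^ i • w = u ^ i • w := by
    intro i
    induction i with
    | zero => simp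
    | succ i ih =>
      rw [pow_succ, mul_smul, mul_smul, hw, smul_smul,
        ((show Commute (u * z) u by
          change u * z * u = u * (u * z); rw [mul_assoc, hcomm]).pow_left i).eq, mul_smul, ih,
        smul_smul, ← pow_succ']
  have hu3' : u ^ 3 = 1 := mat_injective (by rw [map_pow, hu3, map_one])
  rw [o3] at h1
  simp only [hzpow, Finset.sum_range_succ, Finset.sum_range_zero, zero_add, pow_zero, one_smul,
    pow_one] at h1
  rw [show u ^ 5 = u ^ 3 * u ^ 2 by rw [← pow_add], show u ^ 4 = u ^ 3 * u by rw [← pow_succ], hu3',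
    one_mul, one_mul, one_smul, sq, mul_smul] at h1
  have h3 := hV.nsmul_eq_zero (w + u • w + u • u • w)
  have h2 : 2 • (w + u • w + u • u • w) = 0 := by
    rw [two_nsmul, ← h1]; abel
  rw [show (3 : ℕ) = 2 + 1 from rfl, add_nsmul, h2, zero_add, one_nsmul] at h3
  exact h3

/-- A Klein four-group normalised by an element of order three with vanishing norm acts
trivially. -/
theorem smul_eq_self_of_klein {G : Type*} [Group G] [DistribMulAction G V] {a b u : G} {w : V}
    (h3 : ∀ v : V, 3 • v = 0) {P : V → Prop} (hP : P w)
    (hPa : ∀ v, P v → P (a • v)) (hPb : ∀ v, P v → P (b • v))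
    (haa : ∀ v, P v → a • a • v = v) (hbb : ∀ v, P v → b • b • v = v)
    (hab : ∀ v, P v → a • b • v = b • a • v) (hPu : ∀ v, P v → P (u • v))
    (hua : ∀ v, P v → u • a • v = b • u • v) (hub : ∀ v, P v → u • b • v = a • b • u • v)
    (hu : ∀ v, P v → v + u • v + u • u • v = 0) : a • w = w ∧ b • w = w := by
  have P1 := hPu w hP
  have P2 := hPu _ P1
  have hbab : ∀ v, P v → b • a • b • v = a • v := fun v hv => by rw [← hab _ (hPb _ hv), hbb _ hv]
  have e0 := hu w hP
  have ea := hu _ (hPa _ hP)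
  rw [hua _ hP, hub _ P1] at ea
  have eb := hu _ (hPb _ hP)
  rw [hub _ hP, hua _ (hPb _ P1), hub _ P1, hbab _ P2] at eb
  have ec := hu _ (hPa _ (hPb _ hP))
  rw [hua _ (hPb _ hP), hub _ hP, hbab _ P1, hua _ P1] at ec
  have fa : w + a • b • u • w + b • u • u • w = 0 := by
    rw [← smul_zero a, ← ea, smul_add, smul_add, haa _ hP, haa _ (hPb _ P2)]
  have fb : w + a • u • w + a • b • u • u • w = 0 := by
    rw [← smul_zero b, ← eb, smul_add, smul_add, hbb _ hP, hbab _ P1, hab _ P2]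
  have fc : w + b • u • w + a • u • u • w = 0 := by
    rw [← smul_zero b, ← smul_zero a, ← ec, smul_add, smul_add, smul_add, smul_add,
      haa _ (hPb _ hP), hbb _ hP, haa _ P1, hbab _ P2]
  have g0 := (congrArg (a • ·) e0).trans (smul_zero a)
  have g1 := (congrArg (b • ·) e0).trans (smul_zero b)
  have g2 := (congrArg (fun v => a • b • v) e0).trans (by rw [smul_zero, smul_zero])
  simp only [smul_add] at g0 g1 g2
  have hw3 := h3 w
  rw [show (3 : ℕ) = 1 + 1 + 1 from rfl, add_nsmul, add_nsmul, one_nsmul] at hw3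
  have hsum : a • w + b • w + a • b • w = 0 := by
    calc _ = (a • w + a • u • w + a • u • u • w) + (b • w + b • u • w + b • u • u • w) +
          (a • b • w + a • b • u • w + a • b • u • u • w) + (w + u • w + u • u • w) + (w + w + w) -
          (w + u • w + u • u • w) - (w + a • b • u • w + b • u • u • w) -
          (w + a • u • w + a • b • u • u • w) - (w + b • u • w + a • u • u • w) := by abel
      _ = 0 := by rw [g0, g1, g2, e0, fa, fb, fc, hw3]; simp
  have k1 := (congrArg (a • ·) hsum).trans (smul_zero a)
  have k2 := (congrArg (b • ·) hsum).trans (smul_zero b)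
  simp only [smul_add] at k1 k2
  rw [haa _ hP, haa _ (hPb _ hP)] at k1
  rw [hbb _ hP, hbab _ hP, ← hab _ hP] at k2
  refine ⟨?_, ?_⟩
  · rw [← sub_eq_zero, ← sub_eq_zero.2 (hsum.trans k1.symm)]; abel
  · rw [← sub_eq_zero, ← sub_eq_zero.2 (hsum.trans k2.symm)]; abel

end CharacteristicThree

section CharacteristicThree

variable {F : Type*} [Field F] {σ : F →+* F} {S : Set ℕ} {V : Type*} [AddCommGroup V]

section
variable {Φ : Matrix (Fin 4) (Fin 4) F} [DistribMulAction (formGroup σ Φ) V] {r : ℕ}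

theorem IsFormModule.smul_smul_eq (hV : IsFormModule σ Φ r S V) {g h k : formGroup σ Φ}
    (ζ : F) (H : mat g * mat h = ζ • mat k) (v : V) : g • h • v = k • v := by
  rw [smul_smul]
  exact hV.smul_eq _ _ ζ (by rw [map_mul, H]) v

theorem IsFormModule.smul_smul_eq_smul_smul (hV : IsFormModule σ Φ r S V)
    {g h k l : formGroup σ Φ} (ζ : F) (H : mat g * mat h = ζ • (mat k * mat l)) (v : V) :
    g • h • v = k • l • v := by
  rw [smul_smul k]
  exact hV.smul_smul_eq ζ (by rw [map_mul, H]) v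

end

/-- A unitary matrix for the standard form acting on the first two coordinates. -/
def upperBlock (a b c d : F) (hD : a * d - b * c = 1) (h1 : σ a = d) (h2 : σ b = -c)
    (h3 : σ c = -b) (h4 : σ d = a) : formGroup σ (1 : Matrix (Fin 4) (Fin 4) F) :=
  mkForm !![a, b, 0, 0; c, d, 0, 0; 0, 0, 1, 0; 0, 0, 0, 1]
    (by simp [det_succ_row_zero, Fin.sum_univ_succ, Fin.succAbove]; linear_combination hD)
    (by
      rw [mul_one, ← Matrix.ext_iff]
      simp [Fin.forall_fin_succ, Matrix.mul_apply, Fin.sum_univ_succ, h1, h2, h3, h4]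
      split_ands <;> first | ring1 | linear_combination hD)

variable [DistribMulAction (formGroup σ (1 : Matrix (Fin 4) (Fin 4) F)) V]

/-- The element `diag(-1, -1, 1, 1)`. -/
def upperNeg (σ : F →+* F) : formGroup σ (1 : Matrix (Fin 4) (Fin 4) F) :=
  upperBlock (-1) 0 0 (-1) (by ring) (by simp) (by simp) (by simp) (by simp)

theorem mat_upperBlock (a b c d : F) (hD : a * d - b * c = 1) (h1 : σ a = d) (h2 : σ b = -c)
    (h3 : σ c = -b) (h4 : σ d = a) :
    mat (upperBlock a b c d hD h1 h2 h3 h4) =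
      !![a, b, 0, 0; c, d, 0, 0; 0, 0, 1, 0; 0, 0, 0, 1] := rfl

theorem mat_upperNeg :
    mat (upperNeg σ) = !![-1, 0, 0, 0; 0, -1, 0, 0; 0, 0, 1, 0; 0, 0, 0, 1] := by
  rw [upperNeg, mat_upperBlock]

theorem IsFormModule.smul_upperBlock_eq_self (hV : IsFormModule σ 1 3 S V) (hS : 18 ∉ S)
    (h3 : (3 : F) = 0) {i : F} (hi : i * i = -1) (hσi : σ i = -i) {w : V}
    (hw : upperNeg σ • w = w) :
    (upperBlock 0 (-1) 1 0 (by ring) (by simp) (by simp) (by simp) (by simp) :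
      formGroup σ (1 : Matrix (Fin 4) (Fin 4) F)) • w = w ∧
    (upperBlock i 0 0 (-i) (by linear_combination -hi) hσi (by simp) (by simp) (by simp [hσi]) :
      formGroup σ (1 : Matrix (Fin 4) (Fin 4) F)) • w = w := by
  set z := upperNeg σ with hz
  set J : formGroup σ (1 : Matrix (Fin 4) (Fin 4) F) :=
    upperBlock 0 (-1) 1 0 (by ring) (by simp) (by simp) (by simp) (by simp) with hJ
  set I : formGroup σ (1 : Matrix (Fin 4) (Fin 4) F) := upperBlock i 0 0 (-i)
    (by linear_combination -hi) hσi (by simp) (by simp) (by simp [hσi]) with hI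
  let u : formGroup σ (1 : Matrix (Fin 4) (Fin 4) F) :=
    upperBlock (1 - i) (1 + i) (-1 + i) (1 + i) (by linear_combination h3 - 2 * hi)
      (by simp [hσi]) (by simp [hσi]; ring) (by simp [hσi]; ring) (by simp [hσi]; ring)
  have mz : mat z = !![-1, 0, 0, 0; 0, -1, 0, 0; 0, 0, 1, 0; 0, 0, 0, 1] := mat_upperNeg
  have mJ : mat J = !![0, -1, 0, 0; 1, 0, 0, 0; 0, 0, 1, 0; 0, 0, 0, 1] := rfl
  have mI : mat I = !![i, 0, 0, 0; 0, -i, 0, 0; 0, 0, 1, 0; 0, 0, 0, 1] := rfl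
  have mu : mat u = !![1 - i, 1 + i, 0, 0; -1 + i, 1 + i, 0, 0; 0, 0, 1, 0; 0, 0, 0, 1] := rfl
  have comm : ∀ {g : formGroup σ (1 : Matrix (Fin 4) (Fin 4) F)}, mat z * mat g = mat g * mat z →
      ∀ v : V, z • v = v → z • g • v = g • v := fun {g} hg v hv => by
    rw [hV.smul_smul_eq_smul_smul (k := g) (l := z) 1 (by rw [hg, one_smul]), hv]
  have mzJ : mat z * mat J = mat J * mat z := by
    rw [mz, mJ, ← Matrix.ext_iff]
    simp [Fin.forall_fin_succ, Matrix.mul_apply, Fin.sum_univ_succ]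
  have mzI : mat z * mat I = mat I * mat z := by
    rw [mz, mI, ← Matrix.ext_iff]
    simp [Fin.forall_fin_succ, Matrix.mul_apply, Fin.sum_univ_succ]
  have mzu : mat z * mat u = mat u * mat z := by
    rw [mz, mu, ← Matrix.ext_iff]
    simp [Fin.forall_fin_succ, Matrix.mul_apply, Fin.sum_univ_succ]
  refine smul_eq_self_of_klein (P := fun v => z • v = v) (u := u) hV.nsmul_eq_zero hw
    (comm mzJ) (comm mzI) (fun v hv => ?_) (fun v hv => ?_) (fun v hv => ?_) (comm mzu)
    (fun v hv => ?_) (fun v hv => ?_) (fun v hv => ?_)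
  · rw [hV.smul_smul_eq (k := z) 1 ?_, hv]
    rw [mz, mJ, ← Matrix.ext_iff]
    simp [Fin.forall_fin_succ, Matrix.mul_apply, Fin.sum_univ_succ]
  · rw [hV.smul_smul_eq (k := z) 1 ?_, hv]
    rw [mz, mI, ← Matrix.ext_iff]
    simp [Fin.forall_fin_succ, Matrix.mul_apply, Fin.sum_univ_succ, hi]
  · rw [hV.smul_smul_eq_smul_smul (k := I) (l := J * z) 1 ?_, mul_smul, hv]
    rw [map_mul, mz, mI, mJ, ← Matrix.ext_iff]
    simp [Fin.forall_fin_succ, Matrix.mul_apply, Fin.sum_univ_succ]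
  · refine hV.smul_smul_eq_smul_smul 1 ?_ v
    rw [mu, mI, mJ, ← Matrix.ext_iff]
    simp [Fin.forall_fin_succ, Matrix.mul_apply, Fin.sum_univ_succ]
    split_ands <;> first | linear_combination hi | linear_combination -hi
  · rw [hV.smul_smul_eq_smul_smul (k := J * I) (l := u * z) 1 ?_, mul_smul, mul_smul, hv]
    rw [map_mul, map_mul, mz, mu, mI, mJ, ← Matrix.ext_iff]
    simp [Fin.forall_fin_succ, Matrix.mul_apply, Fin.sum_univ_succ]
    split_ands <;> ring1
  · have h11 : (1 : F) ≠ -1 := fun h => one_ne_zero (α := F) (by linear_combination h3 - h)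
    refine hV.add_smul_add_smul_eq_zero hS (u := u) (z := z) ?_ ?_ ?_ (ζ := 1) ?_ mzu.symm hv
    · rintro ⟨ζ, hζ⟩
      rw [mu, ← Matrix.ext_iff] at hζ
      simp [Fin.forall_fin_succ] at hζ
      exact h11 (by linear_combination 2 * hζ.2.2 - 2 * hζ.2.1.2 + 2 * hζ.1.2)
    · rw [mu, ← Matrix.ext_iff, pow_succ, sq]
      simp [Fin.forall_fin_succ, Matrix.mul_apply, Fin.sum_univ_succ]
      exact ⟨⟨by linear_combination (6 - 2 * i) * hi - 3 * h3, by linear_combination (2 + 2 * i) * hi⟩,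
        by linear_combination (-2 + 2 * i) * hi, by linear_combination (6 + 2 * i) * hi - 3 * h3⟩
    · rintro ⟨ζ, hζ⟩
      rw [mz, ← Matrix.ext_iff] at hζ
      simp [Fin.forall_fin_succ] at hζ
      exact h11 (hζ.2.trans hζ.1.symm)
    · rw [mz, ← Matrix.ext_iff, sq]
      simp [Fin.forall_fin_succ, Matrix.mul_apply, Fin.sum_univ_succ]

end CharacteristicThree

section CharacteristicThree

variable {F : Type*} [Field F] {σ : F →+* F} {S : Set ℕ} {V : Type*} [AddCommGroup V]
  [DistribMulAction (formGroup σ (1 : Matrix (Fin 4) (Fin 4) F)) V]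

theorem eq_zero_of_add_self {V : Type*} [AddCommGroup V] (h3 : ∀ v : V, 3 • v = 0) {v : V}
    (h : v + v = 0) : v = 0 := by
  have := h3 v
  rwa [show (3 : ℕ) = 2 + 1 from rfl, add_nsmul, two_nsmul, h, zero_add, one_nsmul] at this

/-- The permutation matrix of `(0 2)(1 3)`. -/
def blockSwap (σ : F →+* F) : formGroup σ (1 : Matrix (Fin 4) (Fin 4) F) :=
  mkForm !![0, 0, 1, 0; 0, 0, 0, 1; 1, 0, 0, 0; 0, 1, 0, 0]
    (by simp [det_succ_row_zero, Fin.sum_univ_succ, Fin.succAbove])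
    (by
      rw [mul_one, ← Matrix.ext_iff]
      simp [Fin.forall_fin_succ, Matrix.mul_apply, Fin.sum_univ_succ])

/-- A signed permutation matrix of `(1 2)`. -/
def innerSwap (σ : F →+* F) : formGroup σ (1 : Matrix (Fin 4) (Fin 4) F) :=
  mkForm !![1, 0, 0, 0; 0, 0, 1, 0; 0, -1, 0, 0; 0, 0, 0, 1]
    (by simp [det_succ_row_zero, Fin.sum_univ_succ, Fin.succAbove])
    (by
      rw [mul_one, ← Matrix.ext_iff]
      simp [Fin.forall_fin_succ, Matrix.mul_apply, Fin.sum_univ_succ])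

/-- A signed permutation matrix of `(1 3)`. -/
def outerSwap (σ : F →+* F) : formGroup σ (1 : Matrix (Fin 4) (Fin 4) F) :=
  mkForm !![1, 0, 0, 0; 0, 0, 0, 1; 0, 0, 1, 0; 0, -1, 0, 0]
    (by simp [det_succ_row_zero, Fin.sum_univ_succ, Fin.succAbove])
    (by
      rw [mul_one, ← Matrix.ext_iff]
      simp [Fin.forall_fin_succ, Matrix.mul_apply, Fin.sum_univ_succ])

/-- A diagonal unitary matrix. -/
def diagForm (a b c d : F) (hd : a * b * c * d = 1) (ha : σ a * a = 1) (hb : σ b * b = 1)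
    (hc : σ c * c = 1) (hd' : σ d * d = 1) : formGroup σ (1 : Matrix (Fin 4) (Fin 4) F) :=
  mkForm !![a, 0, 0, 0; 0, b, 0, 0; 0, 0, c, 0; 0, 0, 0, d]
    (by simp [det_succ_row_zero, Fin.sum_univ_succ, Fin.succAbove]; linear_combination hd)
    (by
      rw [mul_one, ← Matrix.ext_iff]
      simp [Fin.forall_fin_succ, Matrix.mul_apply, Fin.sum_univ_succ, ha, hb, hc, hd'])

theorem IsFormModule.eq_zero_of_upperNeg_smul (hV : IsFormModule σ 1 3 S V) (hS : 18 ∉ S)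
    (hS' : 24 ∉ S) (h3 : (3 : F) = 0) {i : F} (hi : i * i = -1) (hσi : σ i = -i) {w : V}
    (hw : upperNeg σ • w = w) : w = 0 := by
  have hi' : σ i * i = 1 := by rw [hσi]; linear_combination -hi
  have hi'' : σ (-i) * -i = 1 := by rw [map_neg, hσi]; linear_combination -hi
  let z13 : formGroup σ (1 : Matrix (Fin 4) (Fin 4) F) :=
    diagForm (-1) 1 (-1) 1 (by ring) (by simp) (by simp) (by simp) (by simp)
  let I' : formGroup σ (1 : Matrix (Fin 4) (Fin 4) F) :=
    diagForm 1 1 i (-i) (by linear_combination -hi) (by simp) (by simp) hi' hi''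
  let x : formGroup σ (1 : Matrix (Fin 4) (Fin 4) F) :=
    diagForm 1 i 1 (-i) (by linear_combination -hi) (by simp) hi' (by simp) hi''
  have m13 : mat z13 = !![-1, 0, 0, 0; 0, 1, 0, 0; 0, 0, -1, 0; 0, 0, 0, 1] := rfl
  have mI' : mat I' = !![1, 0, 0, 0; 0, 1, 0, 0; 0, 0, i, 0; 0, 0, 0, -i] := rfl
  have mx : mat x = !![1, 0, 0, 0; 0, i, 0, 0; 0, 0, 1, 0; 0, 0, 0, -i] := rfl
  have mQ : mat (blockSwap σ) = !![0, 0, 1, 0; 0, 0, 0, 1; 1, 0, 0, 0; 0, 1, 0, 0] := rfl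
  have mP : mat (innerSwap σ) = !![1, 0, 0, 0; 0, 0, 1, 0; 0, -1, 0, 0; 0, 0, 0, 1] := rfl
  have key : ∀ v : V, upperNeg σ • v = v → I' • v = v := by
    intro v hv
    have h1 := (hV.smul_upperBlock_eq_self hS h3 hi hσi (w := blockSwap σ • v) (by
      rw [hV.smul_smul_eq_smul_smul (k := blockSwap σ) (l := upperNeg σ) (-1) ?_, hv]
      rw [mQ, mat_upperNeg, ← Matrix.ext_iff]
      simp [Fin.forall_fin_succ, Matrix.mul_apply, Fin.sum_univ_succ])).2
    rw [hV.smul_smul_eq_smul_smul (k := blockSwap σ) (l := I') 1 (by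
      rw [mQ, mI', mat_upperBlock, ← Matrix.ext_iff]
      simp [Fin.forall_fin_succ, Matrix.mul_apply, Fin.sum_univ_succ])] at h1
    exact (MulAction.injective _) h1
  obtain ⟨hJ, hI⟩ := hV.smul_upperBlock_eq_self hS h3 hi hσi hw
  set J : formGroup σ (1 : Matrix (Fin 4) (Fin 4) F) :=
    upperBlock 0 (-1) 1 0 (by ring) (by simp) (by simp) (by simp) (by simp)
  have mJ : mat J = !![0, -1, 0, 0; 1, 0, 0, 0; 0, 0, 1, 0; 0, 0, 0, 1] := rfl
  have h13 : z13 • w = w := by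
    rw [← hV.smul_smul_eq (k := z13) (h := I') (-i) ?_ w, key w hw, hI]
    rw [mI', m13, mat_upperBlock, ← Matrix.ext_iff]
    simp [Fin.forall_fin_succ, Matrix.mul_apply, Fin.sum_univ_succ]
  obtain ⟨w', rfl⟩ : ∃ w', w = innerSwap σ • w' := ⟨(innerSwap σ)⁻¹ • w, by simp⟩
  have hx : x • innerSwap σ • w' = innerSwap σ • w' := by
    rw [hV.smul_smul_eq_smul_smul (k := innerSwap σ) (l := I') 1, key]
    · rw [hV.smul_smul_eq_smul_smul (k := innerSwap σ) (l := upperNeg σ) 1] at h13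
      · exact (MulAction.injective _) h13
      · rw [m13, mP, mat_upperNeg, ← Matrix.ext_iff]
        simp [Fin.forall_fin_succ, Matrix.mul_apply, Fin.sum_univ_succ]
    · rw [mx, mP, mI', ← Matrix.ext_iff]
      simp [Fin.forall_fin_succ, Matrix.mul_apply, Fin.sum_univ_succ]
  generalize innerSwap σ • w' = w at *
  have h2 : mat (x * J) ^ 2 = !![-i, 0, 0, 0; 0, -i, 0, 0; 0, 0, 1, 0; 0, 0, 0, -1] := by
    rw [map_mul, mx, mJ, sq, ← Matrix.ext_iff]
    simp [Fin.forall_fin_succ, Matrix.mul_apply, Fin.sum_univ_succ, hi]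
  have h4 : mat (x * J) ^ 4 = !![-1, 0, 0, 0; 0, -1, 0, 0; 0, 0, 1, 0; 0, 0, 0, 1] := by
    rw [show mat (x * J) ^ 4 = (mat (x * J) ^ 2) ^ 2 from pow_mul _ 2 2, h2, sq, ← Matrix.ext_iff]
    simp [Fin.forall_fin_succ, Matrix.mul_apply, Fin.sum_univ_succ, hi]
  have h8 : mat (x * J) ^ 8 = 1 := by
    rw [show mat (x * J) ^ 8 = (mat (x * J) ^ 4) ^ 2 from pow_mul _ 4 2, h4, sq, ← Matrix.ext_iff]
    simp [Fin.forall_fin_succ, Matrix.mul_apply, Fin.sum_univ_succ]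
  have h11 : (1 : F) ≠ -1 := fun h => one_ne_zero (α := F) (by linear_combination h3 - h)
  have : Fact (Nat.Prime 2) := ⟨Nat.prime_two⟩
  have ho : orderOf ((x * J : formGroup σ (1 : Matrix (Fin 4) (Fin 4) F)) :
      formGroup σ (1 : Matrix (Fin 4) (Fin 4) F) ⧸ scalarSubgroup σ _) = 2 ^ (2 + 1) := by
    refine orderOf_eq_prime_pow ?_ ?_
    · rw [← QuotientGroup.mk_pow, QuotientGroup.eq_one_iff]
      rintro ⟨ζ, hζ⟩
      rw [map_pow, show 2 ^ 2 = 4 from rfl, h4, ← Matrix.ext_iff] at hζ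
      simp [Fin.forall_fin_succ] at hζ
      exact h11 (hζ.2.trans hζ.1.symm)
    · rw [← QuotientGroup.mk_pow, QuotientGroup.eq_one_iff]
      exact ⟨1, by rw [map_pow, show 2 ^ (2 + 1) = 8 from rfl, h8, one_smul]⟩
  have hs := hV.sum_smul (x * J) (by rw [ho]; exact hS') w
  have hpow : ∀ k : ℕ, (x * J) ^ k • w = w := by
    intro k
    induction k with
    | zero => simp
    | succ k ih => rw [pow_succ, mul_smul, mul_smul, hJ, hx, ih]
  simp only [hpow, Finset.sum_const, Finset.card_range, ho] at hs
  refine eq_zero_of_add_self hV.nsmul_eq_zero ?_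
  rw [show 2 ^ (2 + 1) = 2 * 3 + 2 from rfl, add_nsmul, mul_nsmul', hV.nsmul_eq_zero, smul_zero,
    zero_add, two_nsmul] at hs
  exact hs

theorem IsFormModule.subsingleton_of_conj_eq_neg (hV : IsFormModule σ 1 3 S V) (hS : 18 ∉ S)
    (hS' : 24 ∉ S) (h3 : (3 : F) = 0) {i : F} (hi : i * i = -1) (hσi : σ i = -i) :
    Subsingleton V := by
  let z13 : formGroup σ (1 : Matrix (Fin 4) (Fin 4) F) :=
    diagForm (-1) 1 (-1) 1 (by ring) (by simp) (by simp) (by simp) (by simp)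
  have m13 : mat z13 = !![-1, 0, 0, 0; 0, 1, 0, 0; 0, 0, -1, 0; 0, 0, 0, 1] := rfl
  have mP : mat (innerSwap σ) = !![1, 0, 0, 0; 0, 0, 1, 0; 0, -1, 0, 0; 0, 0, 0, 1] := rfl
  have mR : mat (outerSwap σ) = !![1, 0, 0, 0; 0, 0, 0, 1; 0, 0, 1, 0; 0, -1, 0, 0] := rfl
  have hz : ∀ v : V, upperNeg σ • v = -v := by
    intro v
    rw [eq_neg_iff_add_eq_zero]
    refine hV.eq_zero_of_upperNeg_smul hS hS' h3 hi hσi ?_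
    rw [smul_add, hV.smul_smul_eq (k := 1) 1 ?_, one_smul, add_comm]
    rw [mat_upperNeg, map_one, ← Matrix.ext_iff]
    simp [Fin.forall_fin_succ, Matrix.mul_apply, Fin.sum_univ_succ]
  have hz13 : ∀ v : V, z13 • v = -v := by
    intro v
    obtain ⟨w, rfl⟩ : ∃ w, v = innerSwap σ • w := ⟨(innerSwap σ)⁻¹ • v, by simp⟩
    rw [hV.smul_smul_eq_smul_smul (k := innerSwap σ) (l := upperNeg σ) 1 ?_, hz, smul_neg]
    rw [m13, mP, mat_upperNeg, ← Matrix.ext_iff]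
    simp [Fin.forall_fin_succ, Matrix.mul_apply, Fin.sum_univ_succ]
  refine subsingleton_of_forall_eq 0 fun v => eq_zero_of_add_self hV.nsmul_eq_zero ?_
  have h1 : (upperNeg σ * z13) • outerSwap σ • v = outerSwap σ • upperNeg σ • v := by
    refine hV.smul_smul_eq_smul_smul (-1) ?_ v
    rw [map_mul, m13, mR, mat_upperNeg, ← Matrix.ext_iff]
    simp [Fin.forall_fin_succ, Matrix.mul_apply, Fin.sum_univ_succ]
  rw [mul_smul, hz, hz13, hz, neg_neg] at h1
  have h2 := (MulAction.injective _) h1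
  rw [eq_neg_iff_add_eq_zero] at h2
  exact h2

end CharacteristicThree

section CharacteristicThree

variable {F : Type*} [Field F] {m q : ℕ} {σ : F →+* F} {V : Type*} [AddCommGroup V]
  [DistribMulAction (unitaryJ σ) V]

/-- The image of a matrix with entries fixed by `σ` under a twisted tensor embedding. -/
def tensorForm {ε : F} (hε0 : ε ≠ 0) (hε : σ ε = -ε) (a b c d : F) (hD : a * d - b * c = 1)
    (ha : σ a = a) (hb : σ b = b) (hc : σ c = c) (hd : σ d = d) : unitaryJ σ :=
  mkForm !![a, 0, b * ε, 0; 0, a, 0, b * ε; c / ε, 0, d, 0; 0, c / ε, 0, d]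
    (by
      simp [det_succ_row_zero, Fin.sum_univ_succ, Fin.succAbove]
      field_simp
      linear_combination (a * d - b * c + 1) * hD)
    (by
      rw [← Matrix.ext_iff]
      simp [Fin.forall_fin_succ, antiDiag, Matrix.mul_apply, Fin.sum_univ_succ, ha, hb, hc, hd, hε]
      split_ands <;> field_simp <;> first | ring1 | linear_combination hD)

theorem IsUnitaryField.levi_smul_eq_self (h : IsUnitaryField F 3 m q σ)
    (hV : IsUnitaryModule σ 3 V) {i : F} (hi : i * i = -1) (hσi : σ i = i) {w : V}
    (hw : (levi h.invol i 0 0 i (-1) (by rw [hi]; ring) (by simp) (by simp) : unitaryJ σ) • w = w) :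
    (levi h.invol 0 (-1) 1 0 1 (by ring) one_ne_zero (map_one σ) : unitaryJ σ) • w = w ∧
    (levi h.invol i 0 0 (-i) 1 (by linear_combination -hi) one_ne_zero (map_one σ) :
      unitaryJ σ) • w = w := by
  have h3 : (3 : F) = 0 := by
    have := h.charP
    exact_mod_cast CharP.cast_eq_zero F 3
  have hV' := hV.isFormModule h
  set z := levi h.invol i 0 0 i (-1) (by rw [hi]; ring) (by simp) (by simp)
  set J := levi h.invol 0 (-1) 1 0 1 (by ring) one_ne_zero (map_one σ)
  set I := levi h.invol i 0 0 (-i) 1 (by linear_combination -hi) one_ne_zero (map_one σ)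
  let u := levi h.invol (1 - i) (1 + i) (-1 + i) (1 + i) 1 (by linear_combination h3 - 2 * hi)
    one_ne_zero (map_one σ)
  have mz : mat z = !![i, 0, 0, 0; 0, i, 0, 0; 0, 0, -i, 0; 0, 0, 0, -i] := by
    simp [z, hσi, div_neg]
  have mJ : mat J = !![0, -1, 0, 0; 1, 0, 0, 0; 0, 0, 0, 1; 0, 0, -1, 0] := by
    simp [J]
  have mI : mat I = !![i, 0, 0, 0; 0, -i, 0, 0; 0, 0, i, 0; 0, 0, 0, -i] := by
    simp [I, hσi]
  have mu : mat u = !![1 - i, 1 + i, 0, 0; -1 + i, 1 + i, 0, 0;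
      0, 0, 1 - i, -(1 + i); 0, 0, -(-1 + i), 1 + i] := by
    simp [u, hσi]
  have comm : ∀ {g : unitaryJ σ}, mat z * mat g = mat g * mat z →
      ∀ v : V, z • v = v → z • g • v = g • v := fun {g} hg v hv => by
    rw [hV'.smul_smul_eq_smul_smul (k := g) (l := z) 1 (by rw [hg, one_smul]), hv]
  have hone : ∀ g k : unitaryJ σ, ∀ ζ : F, mat g * mat k = ζ • 1 → ∀ v : V, g • k • v = v :=
    fun g k ζ hg v => by
      rw [hV'.smul_smul_eq (k := 1) ζ (by rw [hg, map_one]), one_smul]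
  have mzu : mat z * mat u = mat u * mat z := by
    rw [mz, mu, ← Matrix.ext_iff]
    simp [Fin.forall_fin_succ, Matrix.mul_apply, Fin.sum_univ_succ]
    split_ands <;> ring1
  refine smul_eq_self_of_klein (P := fun v => z • v = v) (u := u) hV.nsmul_eq_zero hw
    (comm ?_) (comm ?_) (fun v _ => hone J J (-1) ?_ v) (fun v _ => hone I I (-1) ?_ v)
    (fun v _ => hV'.smul_smul_eq_smul_smul (-1) ?_ v) (comm mzu)
    (fun v _ => hV'.smul_smul_eq_smul_smul 1 ?_ v) (fun v _ => ?_) (fun v hv => ?_)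
  · rw [mz, mJ, ← Matrix.ext_iff]
    simp [Fin.forall_fin_succ, Matrix.mul_apply, Fin.sum_univ_succ]
  · rw [mz, mI, ← Matrix.ext_iff]
    simp [Fin.forall_fin_succ, Matrix.mul_apply, Fin.sum_univ_succ]
  · rw [mJ, ← Matrix.ext_iff]
    simp [Fin.forall_fin_succ, Matrix.mul_apply, Fin.sum_univ_succ]
  · rw [mI, ← Matrix.ext_iff]
    simp [Fin.forall_fin_succ, Matrix.mul_apply, Fin.sum_univ_succ, hi]
  · rw [mI, mJ, ← Matrix.ext_iff]
    simp [Fin.forall_fin_succ, Matrix.mul_apply, Fin.sum_univ_succ]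
  · rw [mu, mI, mJ, ← Matrix.ext_iff]
    simp [Fin.forall_fin_succ, Matrix.mul_apply, Fin.sum_univ_succ]
    split_ands <;> first | linear_combination hi | linear_combination -hi
  · rw [hV'.smul_smul_eq_smul_smul (k := J * I) (l := u) (-1) ?_, mul_smul]
    rw [map_mul, mu, mI, mJ, ← Matrix.ext_iff]
    simp [Fin.forall_fin_succ, Matrix.mul_apply, Fin.sum_univ_succ]
    split_ands <;> ring1
  · have h11 : (1 : F) ≠ -1 := fun h => one_ne_zero (α := F) (by linear_combination h3 - h)
    have hi0 : i ≠ 0 := by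
      rintro rfl
      simp at hi
    refine hV'.add_smul_add_smul_eq_zero h.eighteen_notMem_elementOrders (u := u) (z := z)
      ?_ ?_ ?_ (ζ := -1) ?_ mzu.symm hv
    · rintro ⟨ζ, hζ⟩
      rw [mu, ← Matrix.ext_iff] at hζ
      simp [Fin.forall_fin_succ] at hζ
      exact h11 (by linear_combination hζ.1.1 + 2 * hζ.1.2 - hζ.2.1.2)
    · rw [mu, ← Matrix.ext_iff, pow_succ, sq]
      simp [Fin.forall_fin_succ, Matrix.mul_apply, Fin.sum_univ_succ]
      split_ands <;> first
        | linear_combination (6 - 2 * i) * hi - 3 * h3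
        | linear_combination (2 + 2 * i) * hi
        | linear_combination (-2 + 2 * i) * hi
        | linear_combination (6 + 2 * i) * hi - 3 * h3
        | linear_combination (-2 - 2 * i) * hi
        | linear_combination (2 - 2 * i) * hi
    · rintro ⟨ζ, hζ⟩
      rw [mz, ← Matrix.ext_iff] at hζ
      simp [Fin.forall_fin_succ] at hζ
      exact hi0 (by linear_combination 2 * hζ.1 - hζ.2 * 2 - i * h3)
    · rw [mz, ← Matrix.ext_iff, sq]
      simp [Fin.forall_fin_succ, Matrix.mul_apply, Fin.sum_univ_succ, hi]

theorem IsUnitaryField.eq_zero_of_levi_scalar_smul (h : IsUnitaryField F 3 m q σ)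
    (hV : IsUnitaryModule σ 3 V) {i : F} (hi : i * i = -1) (hσi : σ i = i) {w : V}
    (hw : (levi h.invol i 0 0 i (-1) (by rw [hi]; ring) (by simp) (by simp) : unitaryJ σ) • w = w) :
    w = 0 := by
  have hV' := hV.isFormModule h
  let x : F → unitaryJ σ := fun t => levi h.invol 1 t 0 1 1 (by ring) one_ne_zero (map_one σ)
  have h3 : (3 : F) = 0 := by
    have := h.charP
    exact_mod_cast CharP.cast_eq_zero F 3
  have mx : ∀ t, mat (x t) = !![1, t, 0, 0; 0, 1, 0, 0; 0, 0, 1, -σ t; 0, 0, 0, 1] := by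
    intro t
    simp [x]
  have hx : ∀ t, x t • w = w := by
    intro t
    have hxw : (levi h.invol i 0 0 i (-1) (by rw [hi]; ring) (by simp) (by simp) : unitaryJ σ) •
        x t • w = x t • w := by
      rw [hV'.smul_smul_eq_smul_smul (k := x t) (l := levi h.invol i 0 0 i (-1)
        (by rw [hi]; ring) (by simp) (by simp)) 1 ?_, hw]
      rw [mx, mat_levi, ← Matrix.ext_iff]
      simp [Fin.forall_fin_succ, Matrix.mul_apply, Fin.sum_univ_succ, mul_comm]
    have h1 := (h.levi_smul_eq_self hV hi hσi hxw).2
    have h2 := (h.levi_smul_eq_self hV hi hσi hw).2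
    rw [hV'.smul_smul_eq_smul_smul (k := x (-t)) (l := levi h.invol i 0 0 (-i) 1 _ _ _) 1 (by
      rw [mx, mx, mat_levi, ← Matrix.ext_iff]
      simp [Fin.forall_fin_succ, Matrix.mul_apply, Fin.sum_univ_succ, hσi, mul_comm]), h2] at h1
    have h4 := hV'.smul_smul_eq (g := x t) (h := x t) (k := x (-t)) 1 (by
      rw [mx, mx, ← Matrix.ext_iff]
      simp [Fin.forall_fin_succ, Matrix.mul_apply, Fin.sum_univ_succ]
      have h5 : σ 3 = 0 := by rw [h3, map_zero]
      split_ands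
      · linear_combination t * h3
      · linear_combination -σ t * h3) w
    rw [h1] at h4
    exact MulAction.injective _ h4
  have hN := h.gcd_dvd
  obtain ⟨N, hN⟩ := hN
  refine h.eq_zero_of_levi_smul hV Nat.prime_three (N := N) (by rw [hN, mul_comm]) ?_ fun b => ?_
  · intro h5
    have h6 : 3 ∣ (q ^ 2 + 1) * (q - 1) := hN ▸ h5.mul_left _
    have h7 := h.p_dvd_q
    have h8 := h.q_ge
    rcases (Nat.Prime.dvd_mul Nat.prime_three).1 h6 with h9 | h9
    · have := (Nat.dvd_add_right (h7.trans (dvd_pow_self q (_root_.two_ne_zero)))).1 h9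
      omega
    · omega
  · rw [← hV'.smul_smul_eq (g := levi h.invol 0 (-1) 1 0 1 (by ring) one_ne_zero (map_one σ))
      (h := x b) 1, hx, (h.levi_smul_eq_self hV hi hσi hw).1]
    rw [mx, mat_levi, mat_levi, ← Matrix.ext_iff]
    simp [Fin.forall_fin_succ, Matrix.mul_apply, Fin.sum_univ_succ]

theorem IsUnitaryField.subsingleton_of_conj_eq_self (h : IsUnitaryField F 3 m q σ)
    (hV : IsUnitaryModule σ 3 V) {i : F} (hi : i * i = -1) (hσi : σ i = i) : Subsingleton V := by
  have hV' := hV.isFormModule h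
  have h3 : (3 : F) = 0 := by
    have := h.charP
    exact_mod_cast CharP.cast_eq_zero F 3
  obtain ⟨ε, hε0, hε⟩ := h.exists_conj_eq_neg
  let z : unitaryJ σ := levi h.invol i 0 0 i (-1) (by rw [hi]; ring) (by simp) (by simp)
  let y : unitaryJ σ :=
    tensorForm hε0 hε 0 (-1) 1 0 (by ring) (by simp) (by simp) (by simp) (by simp)
  let u : unitaryJ σ := tensorForm hε0 hε (1 - i) (1 + i) (-1 + i) (1 + i)
    (by linear_combination h3 - 2 * hi) (by simp [hσi]) (by simp [hσi]) (by simp [hσi])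
    (by simp [hσi])
  have mz : mat z = !![i, 0, 0, 0; 0, i, 0, 0; 0, 0, -i, 0; 0, 0, 0, -i] := by
    simp [z, hσi, div_neg]
  have my : mat y = !![0, 0, -1 * ε, 0; 0, 0, 0, -1 * ε; 1 / ε, 0, 0, 0; 0, 1 / ε, 0, 0] := rfl
  have mu : mat u = !![1 - i, 0, (1 + i) * ε, 0; 0, 1 - i, 0, (1 + i) * ε;
    (-1 + i) / ε, 0, 1 + i, 0; 0, (-1 + i) / ε, 0, 1 + i] := rfl
  have hz : ∀ v : V, z • v = -v := by
    intro v
    rw [eq_neg_iff_add_eq_zero]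
    refine h.eq_zero_of_levi_scalar_smul hV hi hσi ?_
    change z • (z • v + v) = _
    rw [smul_add, hV'.smul_smul_eq (k := 1) (-1) ?_, one_smul, add_comm]
    rw [mz, map_one, ← Matrix.ext_iff]
    simp [Fin.forall_fin_succ, Matrix.mul_apply, Fin.sum_univ_succ, hi]
  have hy : ∀ v : V, y • v = -v := by
    intro v
    have h1 := hV'.smul_smul_eq_smul_smul (g := u) (h := y) (k := z) (l := u) 1 (by
      rw [mz, mu, my, ← Matrix.ext_iff]
      simp [Fin.forall_fin_succ, Matrix.mul_apply, Fin.sum_univ_succ]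
      split_ands <;> field_simp <;> first | linear_combination hi | linear_combination -hi) v
    rw [hz, ← smul_neg] at h1
    exact MulAction.injective _ h1
  refine subsingleton_of_forall_eq 0 fun v => eq_zero_of_add_self hV.nsmul_eq_zero ?_
  have h1 := hV'.smul_smul_eq_smul_smul (g := u) (h := z) (k := z * y) (l := u) 1 (by
      rw [map_mul, mz, mu, my, ← Matrix.ext_iff]
      simp [Fin.forall_fin_succ, Matrix.mul_apply, Fin.sum_univ_succ]
      split_ands <;> field_simp <;> ring1) v
  rw [mul_smul, hz v, hy, hz, neg_neg] at h1
  have h2 := MulAction.injective _ h1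
  rw [eq_comm, eq_neg_iff_add_eq_zero] at h2
  exact h2

end CharacteristicThree

section CharacteristicThree

variable {F : Type*} [Field F] {m q : ℕ} {σ : F →+* F} {V : Type*} [AddCommGroup V]
  [DistribMulAction (unitaryJ σ) V]

theorem three_pow_mod_eight (m : ℕ) : 3 ^ m % 8 = 1 ∨ 3 ^ m % 8 = 3 := by
  induction m with
  | zero => left; rfl
  | succ m ih => omega

theorem IsUnitaryField.subsingleton_of_three (h : IsUnitaryField F 3 m q σ)
    (hV : IsUnitaryModule σ 3 V) : Subsingleton V := by
  have h3 : (3 : F) = 0 := by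
    have := h.charP
    exact_mod_cast CharP.cast_eq_zero F 3
  obtain ⟨k, hk⟩ := h.q_odd
  obtain ⟨i, hi⟩ := h.exists_orderOf (k := 4)
    ⟨k * (k + 1), by rw [hk, Nat.sub_eq_iff_eq_add (by nlinarith)]; ring⟩
  have hi4 : i ^ 4 = 1 := hi ▸ pow_orderOf_eq_one i
  have hi2 : i ^ 2 ≠ 1 := fun h2 => by
    have := hi ▸ orderOf_dvd_of_pow_eq_one h2
    norm_num at this
  have hii : i * i = -1 := by
    rcases mul_self_eq_one_iff.1 (show i ^ 2 * i ^ 2 = 1 by rw [← hi4]; ring) with h1 | h1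
    · exact absurd h1 hi2
    · rw [← h1, sq]
  rcases three_pow_mod_eight m with h8 | h8 <;> rw [← h.q_eq] at h8
  · refine h.subsingleton_of_conj_eq_self hV hii ?_
    rw [h.conj, ← Nat.div_add_mod q 4, pow_add, pow_mul, hi4, one_pow, one_mul,
      show q % 4 = 1 by omega, pow_one]
  · have hσi : σ i = -i := by
      rw [h.conj, ← Nat.div_add_mod q 4, pow_add, pow_mul, hi4, one_pow, one_mul,
        show q % 4 = 3 by omega]
      linear_combination i * hii
    have := h.finite
    have := Fintype.ofFinite F
    obtain ⟨C, hC⟩ := exists_antiDiag_congruence h.q_odd (by rw [← h.card, Nat.card_eq_fintype_card])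
      h.two_ne_zero σ h.conj
    have h24 : 24 ∉ elementOrders (projUnitary σ) := by
      obtain ⟨j, hj⟩ : ∃ j, q = 8 * j + 3 := ⟨q / 8, by omega⟩
      exact h.mul_two_pow_notMem_elementOrders (e := 2) (c := 8 * j ^ 2 + 6 * j + 1)
        (by rw [hj, Nat.sub_eq_iff_eq_add (by nlinarith)]; ring)
        ⟨4 * j ^ 2 + 3 * j, by ring⟩
    let e := formGroupEquiv σ 1 (antiDiag F) C hC
    let _ : DistribMulAction (formGroup σ (1 : Matrix (Fin 4) (Fin 4) F)) V :=
      DistribMulAction.compHom V e.symm.toMonoidHom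
    refine ((hV.isFormModule h).transfer e.symm.toMonoidHom fun g k ζ => ?_).subsingleton_of_conj_eq_neg
      h.eighteen_notMem_elementOrders h24 h3 hii hσi
    rw [← mat_eq_smul_iff C hC]
    change _ ↔ mat (e (e.symm g)) = ζ • mat (e (e.symm k))
    rw [e.apply_symm_apply, e.apply_symm_apply]

end CharacteristicThree

section Eigenvector

open Polynomial

variable {F M : Type*} [Field F] [AddCommGroup M] [Module F M]

theorem exists_eigenvector_of_aeval_prod (W : Submodule F M) (T : Module.End F M)
    (hT : ∀ w ∈ W, T w ∈ W) (S : Multiset F) {w : M} (hw : w ∈ W) (h0 : w ≠ 0)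
    (h : aeval T (S.map fun a => X - C a).prod w = 0) :
    ∃ a : F, ∃ v ∈ W, v ≠ 0 ∧ T v = a • v := by
  induction S using Multiset.induction_on generalizing w with
  | empty => simp_all
  | cons a S ih =>
    by_cases h1 : T w - a • w = 0
    · exact ⟨a, w, hw, h0, sub_eq_zero.1 h1⟩
    · refine ih (w := T w - a • w) (W.sub_mem (hT w hw) (W.smul_mem a hw)) h1 ?_
      rw [Multiset.map_cons, Multiset.prod_cons, mul_comm, map_mul] at h
      simpa [Module.End.mul_apply] using h

/-- An endomorphism of finite order dividing `|F| - 1` has an eigenvector in every nonzero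
invariant subspace. -/
theorem exists_eigenvector_of_pow_card [Fintype F] (W : Submodule F M) (T : Module.End F M)
    (hT : ∀ w ∈ W, T w ∈ W) (hc : T ^ Fintype.card F = T) {w : M} (hw : w ∈ W) (h0 : w ≠ 0) :
    ∃ a : F, ∃ v ∈ W, v ≠ 0 ∧ T v = a • v := by
  refine exists_eigenvector_of_aeval_prod W T hT (X ^ Fintype.card F - X : F[X]).roots hw h0 ?_
  have h1 := FiniteField.X_pow_card_sub_X_natDegree_eq F (Fintype.one_lt_card (α := F))
  have hm : (X ^ Fintype.card F - X : F[X]).Monic := by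
    refine monic_X_pow_sub (by simpa using Fintype.one_lt_card)
  rw [prod_multiset_X_sub_C_of_monic_of_roots_card_eq hm]
  · simp [hc]
  · rw [FiniteField.roots_X_pow_card_sub_X, h1]
    simp

end Eigenvector

section WeightFunction

variable {F : Type*} [Field F] {p m q : ℕ} {σ : F →+* F}

theorem exists_addMonoidHom_zmod_ne_zero [Fact p.Prime] {V : Type*} [AddCommGroup V]
    [Module (ZMod p) V] {v : V} (hv : v ≠ 0) : ∃ φ : V →+ ZMod p, φ v ≠ 0 := by
  obtain ⟨φ, hφ⟩ := not_forall.1 (mt (Module.forall_dual_apply_eq_zero_iff (ZMod p) v).1 hv)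
  exact ⟨φ.toAddMonoidHom, hφ⟩

/-- The functions all of whose translates sum to zero over those cyclic subgroups of the
projective unitary group to whose order no factor `p` may be added. -/
def spectralFunctions (σ : F →+* F) (p : ℕ) : Submodule F (unitaryJ σ → F) where
  carrier := {f | ∀ x : unitaryJ σ,
    p * orderOf (x : projUnitary σ) ∉ elementOrders (projUnitary σ) →
    ∀ a b, ∑ i ∈ Finset.range (orderOf (x : projUnitary σ)), f (a * x ^ i * b) = 0}
  add_mem' hf hg x hx a b := by
    simp [Finset.sum_add_distrib, hf x hx a b, hg x hx a b]
  zero_mem' := by simp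
  smul_mem' c f hf x hx a b := by
    simp [← Finset.mul_sum, hf x hx a b]

theorem IsUnitaryField.finite_unitaryJ (h : IsUnitaryField F p m q σ) : Finite (unitaryJ σ) := by
  have := h.finite
  have : Finite (SpecialLinearGroup (Fin 4) F) := Subtype.finite
  infer_instance

instance : MulAction (unitaryJ σ × unitaryJ σ) (spectralFunctions σ p) where
  smul c f := ⟨fun g => f.1 (c.1⁻¹ * g * c.2), fun x hx a b => by
    simpa only [mul_assoc] using f.2 x hx (c.1⁻¹ * a) (b * c.2)⟩
  one_smul f := Subtype.ext (funext fun g => congrArg f.1 (by simp))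
  mul_smul c d f := Subtype.ext (funext fun g => congrArg f.1 (by simp [mul_assoc]))

theorem IsUnitaryModule.exists_spectralFunction (h : IsUnitaryField F p m q σ) {V : Type*}
    [AddCommGroup V] [DistribMulAction (unitaryJ σ) V] (hV : IsUnitaryModule σ p V)
    [Nontrivial V] : ∃ f ∈ spectralFunctions σ p, f ≠ 0 := by
  have := Fact.mk h.prime
  have := h.charP
  have := AddCommGroup.zmodModule hV.nsmul_eq_zero
  obtain ⟨v, hv⟩ := exists_ne (0 : V)
  obtain ⟨φ, hφ⟩ := exists_addMonoidHom_zmod_ne_zero (p := p) hv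
  let ψ : V →+ F := (ZMod.castHom dvd_rfl F).toAddMonoidHom.comp φ
  refine ⟨fun g => ψ (g • v), fun x hx a b => ?_, fun h0 => hφ ?_⟩
  · simp only [mul_smul]
    rw [← map_sum, ← Finset.smul_sum, hV.sum_smul x hx, smul_zero, map_zero]
  · have := congrFun h0 1
    simp only [one_smul, Pi.zero_apply] at this
    exact (map_eq_zero_iff _ (ZMod.castHom dvd_rfl F).injective).1 this

end WeightFunction

section Triangular

variable {F : Type*} [Field F] {p m q : ℕ} {σ : F →+* F}

/-- Lower triangular matrices with ones on the diagonal. -/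
def IsLowerUnitriangular (M : Matrix (Fin 4) (Fin 4) F) : Prop :=
  ∀ i j, i ≤ j → M i j = if i = j then 1 else 0

namespace IsLowerUnitriangular

variable {M N : Matrix (Fin 4) (Fin 4) F}

theorem one : IsLowerUnitriangular (1 : Matrix (Fin 4) (Fin 4) F) := fun i j _ => by
  rw [Matrix.one_apply]

theorem mul (hM : IsLowerUnitriangular M) (hN : IsLowerUnitriangular N) :
    IsLowerUnitriangular (M * N) := fun i j hij => by
  rw [Matrix.mul_apply, Finset.sum_eq_single i]
  · rw [hM i i le_rfl, if_pos rfl, one_mul, hN i j hij]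
  · intro k _ hk
    rcases lt_or_gt_of_ne hk with h1 | h1
    · rw [hN k j (h1.le.trans hij), if_neg (h1.trans_le hij).ne, mul_zero]
    · rw [hM i k h1.le, if_neg h1.ne, zero_mul]
  · simp

theorem pow (hM : IsLowerUnitriangular M) (k : ℕ) : IsLowerUnitriangular (M ^ k) := by
  induction k with
  | zero => rw [pow_zero]; exact one
  | succ k ih => rw [pow_succ]; exact ih.mul hM

theorem pow_prime_eq_one (h : IsUnitaryField F p m q σ) (hp : 5 ≤ p)
    (hM : IsLowerUnitriangular M) : M ^ p = 1 := by
  have := h.charP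
  have := Fact.mk h.prime
  have hM' := fun i j => hM i j
  have hN : (M - 1) ^ 4 = 0 := by
    have e : M - 1 = !![0, 0, 0, 0; M 1 0, 0, 0, 0; M 2 0, M 2 1, 0, 0;
        M 3 0, M 3 1, M 3 2, 0] := by
      rw [← Matrix.ext_iff]
      simp [Fin.forall_fin_succ, hM']
    rw [e]
    simp [pow_succ, ← Matrix.ext_iff, Fin.forall_fin_succ]
  have h4 : (M - 1) ^ p = 0 := pow_eq_zero_of_le (by omega) hN
  rwa [sub_pow_char_of_commute p (Commute.one_right _), one_pow, sub_eq_zero] at h4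

/-- Conjugation by a diagonal matrix preserves lower unitriangular matrices. -/
theorem conj {d : Fin 4 → F} (hd : ∀ i, d i ≠ 0) (hM : IsLowerUnitriangular M)
    (e : diagonal d * M = N * diagonal d) : IsLowerUnitriangular N := fun i j hij => by
  have := congrFun (congrFun e i) j
  rw [mul_diagonal, diagonal_mul, hM i j hij] at this
  split_ifs with hc
  · subst hc
    simpa [hd i, eq_comm] using this
  · simpa [hc, hd j, eq_comm] using this

end IsLowerUnitriangular

theorem pow_prime_eq_one_of_transpose (h : IsUnitaryField F p m q σ) (hp : 5 ≤ p)
    {M : Matrix (Fin 4) (Fin 4) F} (hM : IsLowerUnitriangular Mᵀ) : M ^ p = 1 := by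
  rw [← transpose_inj, transpose_pow, hM.pow_prime_eq_one h hp, transpose_one]

/-- The pairs of a lower and an upper unitriangular element of the unitary group. -/
def unipotentPairs (h : IsUnitaryField F p m q σ) (hp : 5 ≤ p) :
    Subgroup (unitaryJ σ × unitaryJ σ) where
  carrier := {c | IsLowerUnitriangular (mat c.1) ∧ IsLowerUnitriangular (mat c.2)ᵀ}
  one_mem' := by
    refine ⟨?_, ?_⟩ <;> simp only [Prod.fst_one, Prod.snd_one, map_one, transpose_one] <;>
      exact .one
  mul_mem' {a b} ha hb := by
    refine ⟨?_, ?_⟩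
    · rw [Prod.fst_mul, map_mul]
      exact ha.1.mul hb.1
    · rw [Prod.snd_mul, map_mul, transpose_mul]
      exact hb.2.mul ha.2
  inv_mem' {a} ha := by
    have h1 : a.1 ^ p = 1 := mat_injective (by
      rw [map_pow, map_one, ha.1.pow_prime_eq_one h hp])
    have h2 : a.2 ^ p = 1 := mat_injective (by
      rw [map_pow, map_one, pow_prime_eq_one_of_transpose h hp ha.2])
    refine ⟨?_, ?_⟩
    · rw [Prod.fst_inv, inv_eq_of_mul_eq_one_right (b := a.1 ^ (p - 1))
        (by rw [← pow_succ', Nat.sub_add_cancel (by omega), h1]), map_pow]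
      exact ha.1.pow _
    · rw [Prod.snd_inv, inv_eq_of_mul_eq_one_right (b := a.2 ^ (p - 1))
        (by rw [← pow_succ', Nat.sub_add_cancel (by omega), h2]), map_pow, transpose_pow]
      exact ha.2.pow _

theorem isPGroup_unipotentPairs (h : IsUnitaryField F p m q σ) (hp : 5 ≤ p) :
    IsPGroup p (unipotentPairs h hp) := fun c => ⟨1, Subtype.ext (Prod.ext
  (mat_injective (by
    simpa using c.2.1.pow_prime_eq_one h hp))
  (mat_injective (by
    simpa using pow_prime_eq_one_of_transpose h hp c.2.2)))⟩

theorem IsUnitaryModule.exists_invariant_spectralFunction (h : IsUnitaryField F p m q σ)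
    (hp : 5 ≤ p) {V : Type*} [AddCommGroup V] [DistribMulAction (unitaryJ σ) V]
    (hV : IsUnitaryModule σ p V) [Nontrivial V] :
    ∃ f ∈ spectralFunctions σ p, f ≠ 0 ∧
      ∀ a b, IsLowerUnitriangular (mat a) → IsLowerUnitriangular (mat b)ᵀ →
        ∀ g, f (a * g * b) = f g := by
  have := h.finite
  have := h.finite_unitaryJ
  have := h.charP
  have := Fact.mk h.prime
  obtain ⟨f₀, hf₀, h0⟩ := hV.exists_spectralFunction h
  have hdvd : p ∣ Nat.card (spectralFunctions σ p) := by
    have h1 := addOrderOf_dvd_natCard (⟨f₀, hf₀⟩ : spectralFunctions σ p)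
    rwa [addOrderOf_eq_prime (p := p)] at h1
    · exact Subtype.ext (funext fun g => by simp)
    · exact fun h2 => h0 (congrArg Subtype.val h2)
  obtain ⟨f, hf, hf0⟩ :=
    (isPGroup_unipotentPairs h hp).exists_fixed_point_of_prime_dvd_card_of_fixed_point
      (spectralFunctions σ p) hdvd (a := 0) (fun c => Subtype.ext (funext fun g => rfl))
  refine ⟨f.1, f.2, fun h1 => hf0 (Subtype.ext h1.symm), fun a b ha hb g => ?_⟩
  let c : unipotentPairs h hp := ⟨(a, 1), ha, (unipotentPairs h hp).one_mem.2⟩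
  let d : unipotentPairs h hp := ⟨(1, b), (unipotentPairs h hp).one_mem.1, hb⟩
  have h1 : f.1 (a⁻¹ * (a * g * b) * 1) = f.1 (a * g * b) :=
    congrFun (congrArg Subtype.val (hf c)) (a * g * b)
  have h2 : f.1 (1⁻¹ * g * b) = f.1 g := congrFun (congrArg Subtype.val (hf d)) g
  rw [← h1, ← h2, mul_assoc a, inv_mul_cancel_left, inv_one, one_mul, mul_one]

end Triangular

section Weight

variable {F : Type*} [Field F] {p m q : ℕ} {σ : F →+* F}

/-- A nonzero spectral function which is left invariant under lower and right invariant under upper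
unitriangular elements, and an eigenvector for left translation by diagonal elements. -/
structure IsWeightFunction (σ : F →+* F) (p A B : ℕ) (f : unitaryJ σ → F) : Prop where
  mem : f ∈ spectralFunctions σ p
  ne_zero : f ≠ 0
  mul_mul : ∀ a b, IsLowerUnitriangular (mat a) → IsLowerUnitriangular (mat b)ᵀ →
    ∀ g, f (a * g * b) = f g
  torus_mul : ∀ t a c, a ≠ 0 → c ≠ 0 → σ c = c →
    mat t = diagonal ![a, c / a, σ a / c, (σ a)⁻¹] → ∀ g, f (t * g) = a ^ A * c ^ B * f g

namespace IsUnitaryField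

/-- The diagonal elements of the unitary group. -/
def torus (h : IsUnitaryField F p m q σ) (a c : F) (ha : a ≠ 0) (hc : c ≠ 0) (hσ : σ c = c) :
    unitaryJ σ :=
  levi h.invol a 0 0 (c / a) c (by field_simp; ring) hc hσ

theorem mat_torus (h : IsUnitaryField F p m q σ) (a c : F) (ha : a ≠ 0) (hc : c ≠ 0)
    (hσ : σ c = c) :
    mat (h.torus a c ha hc hσ) = diagonal ![a, c / a, σ a / c, (σ a)⁻¹] := by
  rw [torus, mat_levi, ← Matrix.ext_iff]
  simp [Fin.forall_fin_succ, hσ]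
  field_simp

end IsUnitaryField

theorem translate_mem_spectralFunctions {t : unitaryJ σ} {d : Fin 4 → F}
    (ht : mat t = diagonal d) {f : unitaryJ σ → F} (hf : f ∈ spectralFunctions σ p)
    (hi : ∀ a b, IsLowerUnitriangular (mat a) → IsLowerUnitriangular (mat b)ᵀ →
      ∀ g, f (a * g * b) = f g) :
    (fun g => f (t * g)) ∈ spectralFunctions σ p ∧
      ∀ a b, IsLowerUnitriangular (mat a) → IsLowerUnitriangular (mat b)ᵀ →
        ∀ g, f (t * (a * g * b)) = f (t * g) := by
  refine ⟨fun x hx a b => by simpa only [mul_assoc] using hf x hx (t * a) b,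
    fun a b ha hb g => ?_⟩
  have hd : ∀ i, d i ≠ 0 := fun i hi => by
    have := det_mat t
    rw [ht, det_diagonal, Finset.prod_eq_zero (Finset.mem_univ i) hi] at this
    exact zero_ne_one this
  rw [← hi (t * a * t⁻¹) b (ha.conj hd (N := mat (t * a * t⁻¹)) ?_) hb (t * g)]
  · congr 1
    group
  · rw [← ht, ← map_mul, ← map_mul, inv_mul_cancel_right]

theorem IsUnitaryModule.exists_weightFunction (h : IsUnitaryField F p m q σ)
    (hp : 5 ≤ p) {V : Type*} [AddCommGroup V] [DistribMulAction (unitaryJ σ) V]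
    (hV : IsUnitaryModule σ p V) [Nontrivial V] :
    ∃ A B, ∃ f : unitaryJ σ → F, A < q ^ 2 - 1 ∧ B < q - 1 ∧ IsWeightFunction σ p A B f := by
  have := h.finite
  have := Fintype.ofFinite F
  have hcard : Fintype.card F = q ^ 2 := by rw [← h.card, Nat.card_eq_fintype_card]
  have hq := h.q_ge
  have hq2 : (q - 1) * (q + 1) = q ^ 2 - 1 := by
    obtain ⟨k, rfl⟩ : ∃ k, q = k + 1 := ⟨q - 1, by omega⟩
    rw [Nat.add_sub_cancel, eq_comm, Nat.sub_eq_iff_eq_add (by nlinarith)]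
    ring
  have : NeZero (q ^ 2 - 1) := ⟨by rw [← hq2]; exact (Nat.mul_pos (by omega) (by omega)).ne'⟩
  have : NeZero (q - 1) := ⟨by omega⟩
  obtain ⟨ω, hω⟩ := h.exists_orderOf dvd_rfl
  have hω' := IsPrimitiveRoot.orderOf ω
  rw [hω] at hω'
  have hc' : IsPrimitiveRoot (ω ^ (q + 1)) (q - 1) := hω'.pow (NeZero.pos _) (by rw [← hq2, mul_comm])
  have ha : ω ≠ 0 := hω'.ne_zero (NeZero.ne _)
  have hc : ω ^ (q + 1) ≠ 0 := pow_ne_zero _ ha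
  have hσc : σ (ω ^ (q + 1)) = ω ^ (q + 1) := by
    rw [h.conj, show q = q - 1 + 1 by omega, pow_succ _ (q - 1), show q - 1 + 1 = q by omega,
      hc'.pow_eq_one, one_mul]
  let W : Submodule F (unitaryJ σ → F) :=
    { carrier := {f | f ∈ spectralFunctions σ p ∧ ∀ a b, IsLowerUnitriangular (mat a) →
        IsLowerUnitriangular (mat b)ᵀ → ∀ g, f (a * g * b) = f g}
      add_mem' := fun hf hg => ⟨add_mem hf.1 hg.1, fun a b ha hb g => by
        simp only [Pi.add_apply, hf.2 a b ha hb, hg.2 a b ha hb]⟩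
      zero_mem' := ⟨zero_mem _, fun _ _ _ _ _ => rfl⟩
      smul_mem' := fun c f hf => ⟨Submodule.smul_mem _ c hf.1, fun a b ha hb g => by
        simp only [Pi.smul_apply, hf.2 a b ha hb]⟩ }
  obtain ⟨f₀, hf₀, h0, hi₀⟩ := hV.exists_invariant_spectralFunction h hp
  let T : unitaryJ σ → Module.End F (unitaryJ σ → F) := fun t => LinearMap.funLeft F F (t * ·)
  have hT : ∀ t f g, T t f g = f (t * g) := fun _ _ _ => rfl
  have hTW : ∀ t d, mat t = diagonal d → ∀ f ∈ W, T t f ∈ W := fun t d ht f hf =>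
    translate_mem_spectralFunctions ht hf.1 hf.2
  have hTp : ∀ t f k g, (T t ^ k) f g = f (t ^ k * g) := by
    intro t f k
    induction k with
    | zero => simp
    | succ k ih =>
      intro g
      rw [pow_succ', Module.End.mul_apply, hT, ih, ← mul_assoc, pow_succ]
  have hTc : ∀ t d, mat t = diagonal d → T t ^ Fintype.card F = T t := fun t d ht => by
    refine LinearMap.ext fun f => funext fun g => ?_
    rw [hTp, hT, hcard]
    congr 2
    apply mat_injective
    rw [map_pow, ht, diagonal_pow]
    exact congrArg _ (funext fun i => h.pow_card _)
  let α := h.torus ω 1 ha one_ne_zero (map_one σ)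
  let γ := h.torus 1 (ω ^ (q + 1)) one_ne_zero hc hσc
  have hα : mat α = _ := h.mat_torus ω 1 ha one_ne_zero (map_one σ)
  have hγ : mat γ = _ := h.mat_torus 1 (ω ^ (q + 1)) one_ne_zero hc hσc
  have hαγ : α * γ = γ * α := mat_injective (by
    rw [map_mul, map_mul, hα, hγ, diagonal_mul_diagonal, diagonal_mul_diagonal]
    simp_rw [mul_comm])
  obtain ⟨l, f₁, hf₁, h1, hl⟩ := exists_eigenvector_of_pow_card W (T α) (hTW α _ hα) (hTc α _ hα)
    (w := f₀) ⟨hf₀, hi₀⟩ h0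
  obtain ⟨μ, f, hf, hf0, hμ⟩ := exists_eigenvector_of_pow_card
    (W ⊓ Module.End.eigenspace (T α) l) (T γ) (fun f hf => ⟨hTW γ _ hγ f hf.1, by
      have := Module.End.mem_eigenspace_iff.1 hf.2
      refine Module.End.mem_eigenspace_iff.2 (funext fun g => ?_)
      have h2 := congrFun this (γ * g)
      rw [hT] at h2
      rw [hT, hT, ← mul_assoc, ← hαγ, mul_assoc, h2]
      rfl⟩) (hTc γ _ hγ) (w := f₁) ⟨hf₁, Module.End.mem_eigenspace_iff.2 hl⟩ h1
  have hl := Module.End.mem_eigenspace_iff.1 hf.2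
  have hpow : ∀ (t : unitaryJ σ) (ν : F), T t f = ν • f → ∀ k g, f (t ^ k * g) = ν ^ k * f g := by
    intro t ν ht k
    induction k with
    | zero => simp
    | succ k ih =>
      intro g
      rw [pow_succ, mul_assoc, ih, pow_succ, mul_assoc]
      exact congrArg _ (congrFun ht g)
  obtain ⟨g₀, hg₀⟩ : ∃ g, f g ≠ 0 := by
    by_contra! hc
    exact hf0 (funext hc)
  have hdp : ∀ (t : unitaryJ σ) (d : Fin 4 → F) (k : ℕ), mat t = diagonal d → (∀ i, d i ^ k = 1) → t ^ k = 1 := by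
    intro t d k ht hd
    apply mat_injective
    rw [map_pow, map_one, ht, diagonal_pow, ← diagonal_one]
    exact congrArg _ (funext hd)
  have hl1 : l ^ (q ^ 2 - 1) = 1 := by
    have := hpow α l hl (q ^ 2 - 1) g₀
    rw [hdp α _ _ hα, one_mul] at this
    · exact mul_right_cancel₀ hg₀ (by rw [← this, one_mul])
    · simp [Fin.forall_fin_succ, hω'.pow_eq_one, ← map_pow]
  have hμ1 : μ ^ (q - 1) = 1 := by
    have := hpow γ μ hμ (q - 1) g₀
    rw [hdp γ _ _ hγ, one_mul] at this
    · exact mul_right_cancel₀ hg₀ (by rw [← this, one_mul])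
    · simp [Fin.forall_fin_succ, hc'.pow_eq_one]
  obtain ⟨A, hA, rfl⟩ := hω'.eq_pow_of_pow_eq_one hl1
  obtain ⟨B, hB, rfl⟩ := hc'.eq_pow_of_pow_eq_one hμ1
  refine ⟨A, B, f, hA, hB, hf.1.1, hf0, hf.1.2, fun t a c ha0 hc0 hσ ht g => ?_⟩
  obtain ⟨i, -, hi⟩ := hω'.eq_pow_of_pow_eq_one (ξ := a) (by
    rw [← hcard]; exact FiniteField.pow_card_sub_one_eq_one a ha0)
  obtain ⟨j, -, hj⟩ := hc'.eq_pow_of_pow_eq_one (ξ := c) (by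
    refine mul_right_cancel₀ hc0 ?_
    rw [← pow_succ, one_mul, Nat.sub_add_cancel (by omega), ← h.conj, hσ])
  have : t = α ^ i * γ ^ j := mat_injective (by
    rw [map_mul, map_pow, map_pow, hα, hγ, ht, diagonal_pow, diagonal_pow, diagonal_mul_diagonal]
    refine congrArg _ (funext fun k => ?_)
    fin_cases k <;> simp [hi, hj, ← map_pow, div_eq_mul_inv, mul_comm])
  rw [this, mul_assoc, hpow α _ hl, hpow γ _ hμ, ← hi, ← hj]
  simp only [← pow_mul, mul_comm, mul_left_comm]

end Weight

section LeadingMinors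

variable {F : Type*} [Field F] {p m q A B : ℕ} {σ : F →+* F} {f : unitaryJ σ → F}

/-- The leading principal minor of size two. -/
def minorTwo (M : Matrix (Fin 4) (Fin 4) F) : F := M 0 0 * M 1 1 - M 0 1 * M 1 0

theorem mat_row (g : unitaryJ σ) (i j : Fin 4) :
    mat g i 0 * σ (mat g j 3) + mat g i 1 * σ (mat g j 2) + mat g i 2 * σ (mat g j 1) +
      mat g i 3 * σ (mat g j 0) = if i = Fin.rev j then 1 else 0 := by
  have hJ : antiDiag F * antiDiag F = 1 := by
    rw [← Matrix.ext_iff]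
    simp [antiDiag, Fin.forall_fin_succ]
  have h1 : antiDiag F * ((mat g).map σ)ᵀ * antiDiag F * mat g = 1 := by
    rw [mul_assoc, mul_assoc, ← mul_assoc _ (antiDiag F), mat_form, hJ]
  have h2 : mat g * antiDiag F * ((mat g).map σ)ᵀ = antiDiag F := by
    have := mul_eq_one_comm.1 h1
    rw [← mul_assoc, ← mul_assoc] at this
    calc _ = mat g * antiDiag F * ((mat g).map σ)ᵀ * antiDiag F * antiDiag F := by
          rw [mul_assoc _ _ (antiDiag F), hJ, mul_one]
      _ = _ := by rw [this, one_mul]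
  have h3 : antiDiag F i j = if i = Fin.rev j then 1 else 0 := by
    fin_cases i <;> fin_cases j <;> rfl
  rw [← h3]
  refine Eq.trans ?_ (congrFun (congrFun h2 i) j)
  simp [antiDiag, Matrix.mul_apply, Fin.sum_univ_four]
  ring

/-- Upper unitriangular elements fixing the first vector and acting trivially on the quotient of
its orthogonal complement. -/
def heisenberg (hσ : ∀ x, σ (σ x) = x) (x y z : F)
    (h : z + σ z + x * σ y + y * σ x = 0) : unitaryJ σ :=
  mkForm !![1, x, y, z; 0, 1, 0, -σ y; 0, 0, 1, -σ x; 0, 0, 0, 1]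
    (by simp [det_succ_row_zero, Fin.sum_univ_succ, Fin.succAbove])
    (by
      rw [← Matrix.ext_iff]
      simp [Fin.forall_fin_succ, antiDiag, Matrix.mul_apply, Fin.sum_univ_succ, hσ]
      linear_combination h)

namespace IsWeightFunction

theorem apply_of_lower (h : IsUnitaryField F p m q σ) (hf : IsWeightFunction σ p A B f)
    {g : unitaryJ σ} (hg : ∀ i j, i < j → mat g i j = 0) :
    f g = mat g 0 0 ^ A * minorTwo (mat g) ^ B * f 1 := by
  have r3 := mat_row g 0 3
  have r2 := mat_row g 1 2
  have hd := det_mat g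
  have hg' := fun i j => hg i j
  simp [hg'] at r3 r2
  rw [det_of_isLowerTriangular _ (fun i j hij => hg i j hij), Fin.prod_univ_four] at hd
  have h0 : mat g 0 0 ≠ 0 := left_ne_zero_of_mul (r3 ▸ one_ne_zero)
  have h1 : mat g 1 1 ≠ 0 := left_ne_zero_of_mul (r2 ▸ one_ne_zero)
  have s3 := congrArg σ r3
  have s2 := congrArg σ r2
  rw [map_mul, h.invol, map_one] at s3 s2
  have s0 : σ (mat g 0 0) ≠ 0 := left_ne_zero_of_mul (s3 ▸ one_ne_zero)
  have s1 : σ (mat g 1 1) ≠ 0 := left_ne_zero_of_mul (s2 ▸ one_ne_zero)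
  have e3 : mat g 3 3 = (σ (mat g 0 0))⁻¹ := by field_simp; linear_combination s3
  have e2 : mat g 2 2 = (σ (mat g 1 1))⁻¹ := by field_simp; linear_combination s2
  have hc : σ (mat g 0 0 * mat g 1 1) = mat g 0 0 * mat g 1 1 := by
    rw [e2, e3] at hd
    field_simp at hd
    rw [map_mul, hd, mul_comm]
  have h2 : mat g 0 0 * mat g 1 1 ≠ 0 := mul_ne_zero h0 h1
  have ht := h.mat_torus _ _ h0 h2 hc
  set t := h.torus _ _ h0 h2 hc
  have hm : minorTwo (mat g) = mat g 0 0 * mat g 1 1 := by simp [minorTwo, hg']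
  rw [hm]
  have key := hf.mul_mul (g * t⁻¹) 1 ?_ (by rw [map_one, transpose_one]; exact .one) t
  · rw [inv_mul_cancel_right, mul_one] at key
    rw [key, ← mul_one t, hf.torus_mul t _ _ h0 h2 hc ht]
  · intro i j hij
    have e : mat (g * t⁻¹) * mat t = mat g := by rw [← map_mul, inv_mul_cancel_right]
    have := congrFun (congrFun e i) j
    rw [ht, mul_diagonal] at this
    have hd0 : (![mat g 0 0, mat g 0 0 * mat g 1 1 / mat g 0 0,
      σ (mat g 0 0) / (mat g 0 0 * mat g 1 1), (σ (mat g 0 0))⁻¹] : Fin 4 → F) j = mat g j j := by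
      rw [map_mul] at hc
      fin_cases j <;> simp
      · field_simp
      · rw [e2]; field_simp; linear_combination hc
      · exact e3.symm
    rw [hd0] at this
    have hj : mat g j j ≠ 0 := by
      rw [← hd0]; fin_cases j <;> simp [h0, h1, s0]
    split_ifs with hc
    · subst hc; exact mul_right_cancel₀ hj (by rw [this, one_mul])
    · exact mul_right_cancel₀ hj (by rw [this, zero_mul, hg i j (lt_of_le_of_ne hij hc)])

theorem apply_of_row (h : IsUnitaryField F p m q σ) (hf : IsWeightFunction σ p A B f)
    {g : unitaryJ σ} (h0 : mat g 0 0 ≠ 0) (h1 : mat g 0 1 = 0) (h2 : mat g 0 2 = 0)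
    (h3 : mat g 0 3 = 0) (hm : minorTwo (mat g) ≠ 0) :
    f g = mat g 0 0 ^ A * minorTwo (mat g) ^ B * f 1 := by
  have r1 := mat_row g 0 1
  have r2 := mat_row g 0 2
  have r3 := mat_row g 1 1
  have e0 : (0 : Fin 4) ≠ Fin.rev 1 := by decide
  have e1 : (0 : Fin 4) ≠ Fin.rev 2 := by decide
  have e2 : (1 : Fin 4) ≠ Fin.rev 1 := by decide
  simp only [h1, h2, h3, zero_mul, add_zero, if_neg e0, if_neg e1, mul_eq_zero, h0, false_or,
    map_eq_zero] at r1 r2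
  have hm' : minorTwo (mat g) = mat g 0 0 * mat g 1 1 := by simp [minorTwo, h1]
  have h11 : mat g 1 1 ≠ 0 := fun h => hm (by rw [hm', h, mul_zero])
  have s11 : σ (mat g 1 1) ≠ 0 := (map_ne_zero σ).2 h11
  rw [if_neg e2, r1, map_zero, mul_zero, zero_mul, zero_add, add_zero] at r3
  let u : unitaryJ σ := siegel 0 0 (-(mat g 1 2 / mat g 1 1)) (by simp) (by simp) (by
    rw [map_neg, map_div₀]; field_simp; linear_combination -r3)
  have hu : mat u = !![1, 0, 0, 0; 0, 1, -(mat g 1 2 / mat g 1 1), -σ 0; 0, 0, 1, 0; 0, 0, 0, 1] :=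
    mat_siegel ..
  have key := hf.mul_mul 1 u (by rw [map_one]; exact .one) ?_ g
  · have hgu : ∀ i j, mat (g * u) i j = (mat g * !![1, 0, 0, 0; 0, 1, -(mat g 1 2 / mat g 1 1), -σ 0;
      0, 0, 1, 0; 0, 0, 0, 1]) i j := fun i j => by rw [map_mul, hu]
    rw [one_mul] at key
    rw [← key, hf.apply_of_lower h, minorTwo, minorTwo]
    · simp [hgu, Matrix.mul_apply, Fin.sum_univ_four]
    · simp [Fin.forall_fin_succ, hgu, Matrix.mul_apply, Fin.sum_univ_four, h1, h2, h3, r1, r2]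
      field_simp
      ring
  · rw [hu]
    simp [IsLowerUnitriangular, Fin.forall_fin_succ]

theorem apply_of_ne_zero (h : IsUnitaryField F p m q σ) (hf : IsWeightFunction σ p A B f)
    {g : unitaryJ σ} (h0 : mat g 0 0 ≠ 0) (hm : minorTwo (mat g) ≠ 0) :
    f g = mat g 0 0 ^ A * minorTwo (mat g) ^ B * f 1 := by
  have r := mat_row g 0 0
  have e0 : (0 : Fin 4) ≠ Fin.rev 0 := by decide
  rw [if_neg e0] at r
  have s0 : σ (mat g 0 0) ≠ 0 := (map_ne_zero σ).2 h0
  set x := -(mat g 0 1 / mat g 0 0)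
  set y := -(mat g 0 2 / mat g 0 0)
  set z := (mat g 0 1 * σ y + mat g 0 2 * σ x - mat g 0 3) / mat g 0 0
  let u : unitaryJ σ := heisenberg h.invol x y z (by
    simp only [x, y, z, map_neg, map_div₀, map_sub, map_add, map_mul, h.invol]
    field_simp
    linear_combination -r)
  have hu : mat u = !![1, x, y, z; 0, 1, 0, -σ y; 0, 0, 1, -σ x; 0, 0, 0, 1] := rfl
  have key := hf.mul_mul 1 u (by rw [map_one]; exact .one) ?_ g
  · have hgu : ∀ i j, mat (g * u) i j = (mat g * !![1, x, y, z; 0, 1, 0, -σ y; 0, 0, 1, -σ x;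
      0, 0, 0, 1]) i j := fun i j => by rw [map_mul, hu]
    have h00 : mat (g * u) 0 0 = mat g 0 0 := by
      simp [hgu, Matrix.mul_apply, Fin.sum_univ_four]
    have hm0 : minorTwo (mat (g * u)) = minorTwo (mat g) := by
      simp [minorTwo, hgu, Matrix.mul_apply, Fin.sum_univ_four]
      ring
    rw [one_mul] at key
    rw [← key, hf.apply_of_row h, h00, hm0]
    · rwa [h00]
    · simp [hgu, Matrix.mul_apply, Fin.sum_univ_four, x]
      field_simp
      ring
    · simp [hgu, Matrix.mul_apply, Fin.sum_univ_four, y]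
      field_simp
      ring
    · simp [hgu, Matrix.mul_apply, Fin.sum_univ_four, z]
      field_simp
      ring
    · rwa [hm0]
  · rw [hu]
    simp [IsLowerUnitriangular, Fin.forall_fin_succ]

end IsWeightFunction

end LeadingMinors

theorem one_add_pow_of_mul_self_eq_zero {R : Type*} [Ring R] {N : R} (hN : N * N = 0) (j : ℕ) :
    (1 + N) ^ j = 1 + (j : R) * N := by
  induction j with
  | zero => simp
  | succ j ih =>
    rw [pow_succ, ih, add_mul, mul_add, mul_assoc, mul_add, hN]
    push_cast
    noncomm_ring

section

variable {F : Type*} [Field F] {p m q A B : ℕ} {σ : F →+* F} {f : unitaryJ σ → F}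

theorem pow_eq_one_of_mat_eq_one_add [CharP F p] {u : unitaryJ σ}
    {N : Matrix (Fin 4) (Fin 4) F} (hu : mat u = 1 + N) (hN : N * N = 0) : u ^ p = 1 := by
  apply mat_injective
  rw [map_pow, hu, one_add_pow_of_mul_self_eq_zero hN, map_one, CharP.cast_eq_zero, zero_mul,
    add_zero]

theorem mat_mul_pow_of_eq_one_add {g u : unitaryJ σ} {N : Matrix (Fin 4) (Fin 4) F}
    (hu : mat u = 1 + N) (hN : N * N = 0) (j : ℕ) (i k : Fin 4) :
    mat (g * u ^ j) i k = mat g i k + j * (mat g * N) i k := by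
  rw [map_mul, map_pow, hu, one_add_pow_of_mul_self_eq_zero hN, mul_add, mul_one, Matrix.add_apply,
    ← nsmul_eq_mul, mul_smul_comm, Matrix.smul_apply, nsmul_eq_mul]

theorem IsUnitaryField.exists_orderOf_fixed (h : IsUnitaryField F p m q σ) :
    ∃ x : F, orderOf x = q - 1 ∧ σ x = x := by
  have hq := h.q_ge
  obtain ⟨x, hx⟩ := h.exists_orderOf (k := q - 1) ⟨q + 1, by
    obtain ⟨k, rfl⟩ : ∃ k, q = k + 1 := ⟨q - 1, by omega⟩
    rw [Nat.add_sub_cancel, Nat.sub_eq_iff_eq_add (by nlinarith)]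
    ring⟩
  refine ⟨x, hx, ?_⟩
  rw [h.conj]
  calc x ^ q = x ^ (q - 1 + 1) := by rw [Nat.sub_add_cancel (by omega)]
    _ = x := by rw [pow_succ, ← hx, pow_orderOf_eq_one, one_mul]

namespace IsWeightFunction

theorem sum_mul_pow_mul (h : IsUnitaryField F p m q σ) (hp : 5 ≤ p)
    (hf : IsWeightFunction σ p A B f) {x : unitaryJ σ} (hx : x ^ p = 1) (a b : unitaryJ σ) :
    ∑ i ∈ Finset.range p, f (a * x ^ i * b) = 0 := by
  have := h.charP
  have hprime := h.prime
  have h1 : orderOf (x : projUnitary σ) ∣ p := orderOf_dvd_of_pow_eq_one (by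
    rw [← QuotientGroup.mk_pow, hx, QuotientGroup.mk_one])
  rcases (Nat.dvd_prime hprime).1 h1 with h1 | h1
  · obtain ⟨ζ, hζ⟩ := (h.orderOf_dvd_iff x 1).1 (by rw [h1])
    rw [pow_one] at hζ
    have hx1 : x = 1 := by
      have h2 : mat (x ^ p) = (ζ ^ p) • 1 := by rw [map_pow, hζ, smul_pow, one_pow]
      rw [hx, map_one] at h2
      have h3 := congrFun (congrFun h2 0) 0
      simp only [one_apply_eq, Matrix.smul_apply, smul_eq_mul, mul_one] at h3
      have : Fact p.Prime := ⟨hprime⟩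
      have h4 : ζ = 1 := frobenius_inj F p (by simp [frobenius_def, ← h3])
      exact mat_injective (by rw [hζ, h4, one_smul, map_one])
    simp [hx1]
  · have := hf.mem x (by rw [h1]; exact h.sq_notMem_elementOrders hp) a b
    rwa [h1] at this

theorem apply_eq_of_forall_pow (h : IsUnitaryField F p m q σ) (hp : 5 ≤ p)
    (hf : IsWeightFunction σ p A B f) {g : unitaryJ σ} {e : ℕ} {X ω : F} (he : e < orderOf ω)
    (H : ∀ s, s = 1 ∨ s = ω → ∃ u : unitaryJ σ, u ^ p = 1 ∧
      ∀ j : ℕ, 0 < j → j < p → f (g * u ^ j) = (j * s) ^ e * X) :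
    f g = 0 ^ e * X := by
  have := h.charP
  obtain ⟨k, rfl⟩ : ∃ k, p = k + 1 := ⟨p - 1, by omega⟩
  have key : ∀ s, s = 1 ∨ s = ω → f g = -(s ^ e * ∑ i ∈ Finset.range k, ((i : F) + 1) ^ e * X) := by
    intro s hs
    obtain ⟨u, hu, H⟩ := H s hs
    have h1 := hf.sum_mul_pow_mul h hp hu g 1
    rw [Finset.sum_range_succ', pow_zero, mul_one, mul_one] at h1
    rw [← add_eq_zero_iff_eq_neg, ← h1, add_comm, Finset.mul_sum]
    congr 1
    refine Finset.sum_congr rfl fun i hi => ?_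
    rw [mul_one, H (i + 1) i.succ_pos (by simpa using hi), mul_pow]
    push_cast
    ring
  have h1 := key 1 (.inl rfl)
  rcases Nat.eq_zero_or_pos e with rfl | he0
  · have hk : (k : F) = -1 := by
      rw [← add_eq_zero_iff_eq_neg]
      exact_mod_cast CharP.cast_eq_zero F (k + 1)
    rw [h1]
    simp [hk]
  · have h2 := key ω (.inr rfl)
    rw [zero_pow he0.ne', zero_mul, h1]
    rw [h1, one_pow, one_mul, neg_inj] at h2
    by_contra hc
    rw [neg_eq_zero, one_pow, one_mul] at hc
    exact pow_ne_one_of_lt_orderOf he0.ne' he (mul_right_cancel₀ hc (by rw [one_mul, ← h2]))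

theorem apply_of_zero_ne_zero (h : IsUnitaryField F p m q σ) (hp : 5 ≤ p)
    (hf : IsWeightFunction σ p A B f) (hB : B < q - 1) {g : unitaryJ σ} (h0 : mat g 0 0 ≠ 0) :
    f g = mat g 0 0 ^ A * minorTwo (mat g) ^ B * f 1 := by
  by_cases hm : minorTwo (mat g) = 0
  swap
  · exact hf.apply_of_ne_zero h h0 hm
  have := h.charP
  obtain ⟨ε, hε, hσε⟩ := h.exists_conj_eq_neg
  obtain ⟨ω, hω, hσω⟩ := h.exists_orderOf_fixed
  set D := mat g 0 0 * mat g 1 2 - mat g 0 2 * mat g 1 0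
  have hD : D ≠ 0 := by
    intro hD
    have r0 := mat_row g 0 0
    have r1 := mat_row g 1 0
    have r2 := mat_row g 1 2
    have r3 := mat_row g 0 2
    have e0 : (0 : Fin 4) ≠ Fin.rev 0 := by decide
    have e1 : (1 : Fin 4) ≠ Fin.rev 0 := by decide
    have e2 : (1 : Fin 4) = Fin.rev 2 := by decide
    have e3 : (0 : Fin 4) ≠ Fin.rev 2 := by decide
    rw [if_neg e0] at r0
    rw [if_neg e1] at r1
    rw [if_pos e2] at r2
    rw [if_neg e3] at r3
    have s0 : σ (mat g 0 0) ≠ 0 := (map_ne_zero σ).2 h0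
    unfold minorTwo at hm
    have h3 : (mat g 0 0 * mat g 1 3 - mat g 0 3 * mat g 1 0) * σ (mat g 0 0) = 0 := by
      linear_combination mat g 0 0 * r1 - mat g 1 0 * r0 - hm * σ (mat g 0 2) - hD * σ (mat g 0 1)
    have h3 := (mul_eq_zero.1 h3).resolve_right s0
    refine h0 ?_
    linear_combination -mat g 0 0 * r2 + mat g 1 0 * r3 + hm * σ (mat g 2 2) + hD * σ (mat g 2 1) +
      h3 * σ (mat g 2 0)
  have key := hf.apply_eq_of_forall_pow h hp (g := g) (e := B) (ω := ω)
    (X := mat g 0 0 ^ A * (ε * D) ^ B * f 1) (by rwa [hω]) ?_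
  · rw [key, hm]
    ring_nf
    rcases eq_or_ne B 0 with rfl | hB0
    · simp
    · simp [hB0]
  · intro s hs
    have hσs : σ s = s := by rcases hs with rfl | rfl <;> simp [hσω]
    have hs0 : s ≠ 0 := by
      rcases hs with rfl | rfl
      · exact one_ne_zero
      · rintro rfl
        simp at hω
        omega
    let u : unitaryJ σ := lowerSiegel 0 0 (s * ε) (by simp) (by simp)
      (by rw [map_mul, hσs, hσε, mul_neg])
    have hu : mat u = 1 + !![0, 0, 0, 0; 0, 0, 0, 0; 0, s * ε, 0, 0; 0, 0, 0, 0] := by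
      rw [mat_lowerSiegel, ← Matrix.ext_iff]
      simp [Fin.forall_fin_succ]
    have hN : !![0, 0, 0, 0; 0, 0, 0, 0; 0, s * ε, 0, 0; 0, 0, 0, 0] *
        !![0, 0, 0, 0; 0, 0, 0, 0; 0, s * ε, 0, 0; 0, 0, 0, 0] = 0 := by
      simp [← Matrix.ext_iff, Fin.forall_fin_succ]
    refine ⟨u, pow_eq_one_of_mat_eq_one_add hu hN, fun j hj hjp => ?_⟩
    have hj0 : (j : F) ≠ 0 := by
      rw [Ne, CharP.cast_eq_zero_iff F p]
      exact Nat.not_dvd_of_pos_of_lt hj hjp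
    have h00 : mat (g * u ^ j) 0 0 = mat g 0 0 := by
      simp [mat_mul_pow_of_eq_one_add hu hN, Matrix.mul_apply, Fin.sum_univ_four]
    have hmj : minorTwo (mat (g * u ^ j)) = j * s * (ε * D) := by
      simp [minorTwo, mat_mul_pow_of_eq_one_add hu hN, Matrix.mul_apply, Fin.sum_univ_four]
      unfold minorTwo at hm
      linear_combination hm
    rw [hf.apply_of_ne_zero h, h00, hmj]
    · ring_nf
    · rwa [h00]
    · rw [hmj]
      exact mul_ne_zero (mul_ne_zero hj0 hs0) (mul_ne_zero hε hD)

/-- A weight function is determined by its value at the identity. -/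
theorem apply_eq (h : IsUnitaryField F p m q σ) (hp : 5 ≤ p)
    (hf : IsWeightFunction σ p A B f) (hA : A < q ^ 2 - 1) (hB : B < q - 1) (g : unitaryJ σ) :
    f g = mat g 0 0 ^ A * minorTwo (mat g) ^ B * f 1 := by
  have := h.charP
  obtain ⟨ε, hε, hσε⟩ := h.exists_conj_eq_neg
  have hj0 : ∀ j : ℕ, 0 < j → j < p → (j : F) ≠ 0 := fun j hj hjp => by
    rw [Ne, CharP.cast_eq_zero_iff F p]
    exact Nat.not_dvd_of_pos_of_lt hj hjp
  have left : ∀ s : F, ∃ u : unitaryJ σ, u ^ p = 1 ∧ ∀ (g : unitaryJ σ) (j : ℕ) i,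
      mat (g * u ^ j) i 0 = mat g i 0 + j * s * mat g i 1 ∧
      mat (g * u ^ j) i 1 = mat g i 1 ∧
      mat (g * u ^ j) i 2 = mat g i 2 - j * σ s * mat g i 3 ∧
      mat (g * u ^ j) i 3 = mat g i 3 := by
    intro s
    let u := levi h.invol 1 0 s 1 1 (by ring) one_ne_zero (map_one σ)
    have hu : mat u = 1 + !![0, 0, 0, 0; s, 0, 0, 0; 0, 0, 0, 0; 0, 0, -σ s, 0] := by
      rw [mat_levi, ← Matrix.ext_iff]
      simp [Fin.forall_fin_succ]
    have hN : !![0, 0, 0, 0; s, 0, 0, 0; 0, 0, 0, 0; 0, 0, -σ s, 0] *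
        !![0, 0, 0, 0; s, 0, 0, 0; 0, 0, 0, 0; 0, 0, -σ s, 0] = 0 := by
      simp [← Matrix.ext_iff, Fin.forall_fin_succ]
    refine ⟨u, pow_eq_one_of_mat_eq_one_add hu hN, fun g j i => ?_⟩
    simp [mat_mul_pow_of_eq_one_add hu hN, Matrix.mul_apply, Fin.sum_univ_four]
    split_ands <;> ring
  have low : ∀ s : F, σ s = s → ∃ u : unitaryJ σ, u ^ p = 1 ∧ ∀ (g : unitaryJ σ) (j : ℕ) i,
      mat (g * u ^ j) i 0 = mat g i 0 ∧
      mat (g * u ^ j) i 1 = mat g i 1 + j * s * (ε * mat g i 2) := by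
    intro s hσs
    let u : unitaryJ σ := lowerSiegel 0 0 (s * ε) (by simp) (by simp)
      (by rw [map_mul, hσs, hσε, mul_neg])
    have hu : mat u = 1 + !![0, 0, 0, 0; 0, 0, 0, 0; 0, s * ε, 0, 0; 0, 0, 0, 0] := by
      rw [mat_lowerSiegel, ← Matrix.ext_iff]
      simp [Fin.forall_fin_succ]
    have hN : !![0, 0, 0, 0; 0, 0, 0, 0; 0, s * ε, 0, 0; 0, 0, 0, 0] *
        !![0, 0, 0, 0; 0, 0, 0, 0; 0, s * ε, 0, 0; 0, 0, 0, 0] = 0 := by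
      simp [← Matrix.ext_iff, Fin.forall_fin_succ]
    refine ⟨u, pow_eq_one_of_mat_eq_one_add hu hN, fun g j i => ?_⟩
    simp [mat_mul_pow_of_eq_one_add hu hN, Matrix.mul_apply, Fin.sum_univ_four]
    ring
  have c1 : ∀ g : unitaryJ σ, mat g 0 1 ≠ 0 →
      f g = mat g 0 0 ^ A * minorTwo (mat g) ^ B * f 1 := by
    intro g h1
    by_cases h0 : mat g 0 0 = 0
    swap
    · exact hf.apply_of_zero_ne_zero h hp hB h0
    obtain ⟨ω, hω⟩ := h.exists_orderOf dvd_rfl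
    rw [hf.apply_eq_of_forall_pow h hp (g := g) (e := A) (ω := ω)
      (X := mat g 0 1 ^ A * minorTwo (mat g) ^ B * f 1) (by rwa [hω]), h0]
    · rcases eq_or_ne A 0 with rfl | hA0
      · simp
      · simp [hA0]
    · intro s hs
      have hs0 : s ≠ 0 := by
        rcases hs with rfl | rfl
        · exact one_ne_zero
        · rintro rfl
          simp at hω
          omega
      obtain ⟨u, hu, H⟩ := left s
      refine ⟨u, hu, fun j hj hjp => ?_⟩
      rw [hf.apply_of_zero_ne_zero h hp hB, minorTwo, (H g j 0).1, (H g j 0).2.1, (H g j 1).1,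
        (H g j 1).2.1, h0, minorTwo, h0]
      · ring
      · rw [(H g j 0).1, h0, zero_add]
        exact mul_ne_zero (mul_ne_zero (hj0 j hj hjp) hs0) h1
  have c2 : ∀ g : unitaryJ σ, mat g 0 2 ≠ 0 →
      f g = mat g 0 0 ^ A * minorTwo (mat g) ^ B * f 1 := by
    intro g h2
    by_cases h1 : mat g 0 1 = 0
    swap
    · exact c1 g h1
    by_cases h0 : mat g 0 0 = 0
    swap
    · exact hf.apply_of_zero_ne_zero h hp hB h0
    obtain ⟨ω, hω, hσω⟩ := h.exists_orderOf_fixed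
    rw [hf.apply_eq_of_forall_pow h hp (g := g) (e := B) (ω := ω)
      (X := 0 ^ A * (-(ε * mat g 0 2 * mat g 1 0)) ^ B * f 1) (by rwa [hω]), minorTwo, h0, h1]
    · rcases eq_or_ne B 0 with rfl | hB0
      · simp
      · simp [hB0]
    · intro s hs
      have hσs : σ s = s := by rcases hs with rfl | rfl <;> simp [hσω]
      have hs0 : s ≠ 0 := by
        rcases hs with rfl | rfl
        · exact one_ne_zero
        · rintro rfl
          simp at hω
          omega
      obtain ⟨u, hu, H⟩ := low s hσs
      refine ⟨u, hu, fun j hj hjp => ?_⟩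
      rw [c1, minorTwo, (H g j 0).1, (H g j 0).2, (H g j 1).1, h0, h1]
      · ring
      · rw [(H g j 0).2, h1, zero_add]
        exact mul_ne_zero (mul_ne_zero (hj0 j hj hjp) hs0) (mul_ne_zero hε h2)
  by_cases h2 : mat g 0 2 = 0
  swap
  · exact c2 g h2
  by_cases h1 : mat g 0 1 = 0
  swap
  · exact c1 g h1
  by_cases h0 : mat g 0 0 = 0
  swap
  · exact hf.apply_of_zero_ne_zero h hp hB h0
  have h3 : mat g 0 3 ≠ 0 := fun h3 => by
    have := mat_row g 0 3
    simp [h0, h1, h2, h3] at this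
  obtain ⟨u, hu, H⟩ := left 1
  rw [hf.apply_eq_of_forall_pow h hp (g := g) (e := 0) (ω := (1 : F))
    (X := 0 ^ A * 0 ^ B * f 1) (by simp), minorTwo, h0, h1]
  · simp
  · intro s hs
    refine ⟨u, hu, fun j hj hjp => ?_⟩
    rw [c2, minorTwo, (H g j 0).1, (H g j 0).2.1, h0, h1]
    · simp
    · rw [(H g j 0).2.2.1, h2, map_one, mul_one, zero_sub, neg_ne_zero]
      exact mul_ne_zero (hj0 j hj hjp) h3

theorem apply_one_ne_zero (h : IsUnitaryField F p m q σ) (hp : 5 ≤ p)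
    (hf : IsWeightFunction σ p A B f) (hA : A < q ^ 2 - 1) (hB : B < q - 1) : f 1 ≠ 0 :=
  fun h1 => hf.ne_zero (funext fun g => by rw [hf.apply_eq h hp hA hB, h1, mul_zero, Pi.zero_apply])

end IsWeightFunction

end

section

variable {F : Type*} [Field F] {p m q A B : ℕ} {σ : F →+* F} {f : unitaryJ σ → F}

/-- The rank one matrix attached to an isotropic vector. -/
def isotropicMatrix (σ : F →+* F) (w : Fin 4 → F) : Matrix (Fin 4) (Fin 4) F :=
  vecMulVec w fun k => σ (w (Fin.rev k))

theorem isotropicMatrix_apply (w : Fin 4 → F) (i j : Fin 4) :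
    isotropicMatrix σ w i j = w i * σ (w (Fin.rev j)) := rfl

/-- Isotropic vectors for the antidiagonal hermitian form. -/
def IsIsotropic (σ : F →+* F) (w : Fin 4 → F) : Prop :=
  w 0 * σ (w 3) + w 1 * σ (w 2) + w 2 * σ (w 1) + w 3 * σ (w 0) = 0

theorem IsIsotropic.dotProduct_eq_zero {w : Fin 4 → F} (hw : IsIsotropic σ w) :
    (fun k => σ (w (Fin.rev k))) ⬝ᵥ w = 0 := by
  refine Eq.trans ?_ hw
  simp [dotProduct, Fin.sum_univ_four, Fin.rev]
  ring

theorem IsIsotropic.mul_self {w : Fin 4 → F} (hw : IsIsotropic σ w) :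
    isotropicMatrix σ w * isotropicMatrix σ w = 0 := by
  rw [isotropicMatrix, vecMulVec_mul_vecMulVec, hw.dotProduct_eq_zero]
  simp

theorem IsIsotropic.det_one_add_smul {w : Fin 4 → F} (hw : IsIsotropic σ w) (τ : F) :
    (1 + τ • isotropicMatrix σ w).det = 1 := by
  rw [isotropicMatrix, ← smul_vecMulVec, vecMulVec_eq Unit, det_one_add_replicateCol_mul_replicateRow,
    dotProduct_smul, hw.dotProduct_eq_zero, smul_zero, add_zero]

theorem IsIsotropic.exists_transvection (hσ : ∀ x, σ (σ x) = x) {w : Fin 4 → F}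
    (hw : IsIsotropic σ w) {τ : F} (hτ : σ τ = -τ) :
    ∃ u : unitaryJ σ, mat u = 1 + τ • isotropicMatrix σ w := by
  refine ⟨mkForm _ (hw.det_one_add_smul τ) ?_, rfl⟩
  have h1 : ((isotropicMatrix σ w).map σ)ᵀ * antiDiag F = antiDiag F * isotropicMatrix σ w := by
    ext i j
    fin_cases i <;> fin_cases j <;>
      simp [antiDiag, Matrix.mul_apply, Fin.sum_univ_four, isotropicMatrix, vecMulVec_apply, hσ,
        Fin.rev, mul_comm]
  have h2 : ((1 + τ • isotropicMatrix σ w).map σ)ᵀ = 1 - τ • ((isotropicMatrix σ w).map σ)ᵀ := by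
    rw [Matrix.map_add _ (map_add σ), Matrix.map_one _ (map_zero σ) (map_one σ),
      Matrix.map_smul' _ _ _ (map_mul σ), hτ]
    simp [sub_eq_add_neg]
  rw [h2, sub_mul, smul_mul_assoc, h1, one_mul, mul_add, mul_one, sub_mul, smul_mul_assoc,
    mul_smul_comm, mul_smul_comm, mul_assoc, hw.mul_self]
  simp

theorem IsWeightFunction.sum_one_add_mul_pow (h : IsUnitaryField F p m q σ) (hp : 5 ≤ p)
    (hf : IsWeightFunction σ p A B f) (hA : A < q ^ 2 - 1) (hB : B < q - 1) (c r : F)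
    (hr : σ r = r) :
    ∑ j ∈ Finset.range p, (1 + (j : F) * c) ^ A * (1 + (j : F) * r) ^ B = 0 := by
  have := h.charP
  obtain ⟨ε, hε, hσε⟩ := h.exists_conj_eq_neg
  let w : Fin 4 → F := ![1, ε * (r - c), 1, -(ε * (σ c - 1))]
  have hw : IsIsotropic σ w := by
    simp [IsIsotropic, w, h.invol, hσε, hr]
    ring
  obtain ⟨x, hx⟩ := hw.exists_transvection h.invol (τ := ε⁻¹) (by rw [map_inv₀, hσε, inv_neg])
  let u : unitaryJ σ := lowerSiegel 0 ε 0 (by simp) hσε (by simp)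
  have hu : mat u = !![1, 0, 0, 0; 0, 1, 0, 0; 0, 0, 1, 0; ε, -σ 0, 0, 1] := mat_lowerSiegel ..
  have hN : ε⁻¹ • isotropicMatrix σ w * ε⁻¹ • isotropicMatrix σ w = 0 := by
    rw [smul_mul_smul_comm, hw.mul_self, smul_zero]
  have hval : ∀ j : ℕ, f (1 * x ^ j * u) = (1 + (j : F) * c) ^ A * (1 + (j : F) * r) ^ B * f 1 := by
    intro j
    have hm : mat (1 * x ^ j * u) = (1 + (j : F) • ε⁻¹ • isotropicMatrix σ w) * mat u := by
      rw [one_mul, map_mul, map_pow, hx, one_add_pow_of_mul_self_eq_zero hN, ← nsmul_eq_mul,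
        Nat.cast_smul_eq_nsmul]
    rw [hf.apply_eq h hp hA hB, minorTwo, hm, hu]
    congr 2
    · simp [Matrix.mul_apply, Fin.sum_univ_four, isotropicMatrix_apply, Fin.rev, w,
        h.invol, hσε]
      field_simp
      ring
    · simp [Matrix.mul_apply, Fin.sum_univ_four, isotropicMatrix_apply, Fin.rev, w,
        h.invol, hσε]
      field_simp
      ring
  have key := hf.sum_mul_pow_mul h hp (pow_eq_one_of_mat_eq_one_add hx hN) 1 u
  simp only [hval, ← Finset.sum_mul] at key
  exact (mul_eq_zero.1 key).resolve_right (hf.apply_one_ne_zero h hp hA hB)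

end

theorem choose_prime_pow_mul_modEq {p : ℕ} [Fact p.Prime] (n i k : ℕ) :
    n.choose (p ^ i * k) ≡ (n / p ^ i).choose k [MOD p] := by
  induction i generalizing n with
  | zero => simp [Nat.ModEq.refl]
  | succ i ih =>
    have h1 := Choose.choose_modEq_choose_mod_mul_choose_div_nat (p := p) (n := n)
      (k := p ^ (i + 1) * k)
    rw [pow_succ', mul_assoc, Nat.mul_mod_right, Nat.choose_zero_right, one_mul,
      Nat.mul_div_cancel_left _ (Fact.out : p.Prime).pos] at h1
    rw [pow_succ', mul_assoc, ← Nat.div_div_eq_div_mul]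
    exact h1.trans (ih _)

theorem not_dvd_choose_of_lt_prime {p n k : ℕ} (hp : p.Prime) (hn : n < p) (hk : k ≤ n) :
    ¬ p ∣ n.choose k := fun h => by
  have := (h.trans ⟨k.factorial * (n - k).factorial, by
    rw [← mul_assoc, Nat.choose_mul_factorial_mul_factorial hk]⟩ : p ∣ n.factorial)
  exact absurd (hp.dvd_factorial.1 this) (by omega)

theorem not_dvd_choose_of_digit_le {p m : ℕ} (hp : p.Prime) (hm : 0 < m) {n i x y : ℕ}
    (hx : x ≤ n / p ^ i % p) (hy : y ≤ n / p ^ (i + m) % p) :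
    ¬ p ∣ n.choose (p ^ i * (x + p ^ m * y)) := by
  have := Fact.mk hp
  have hlt : ∀ a, a % p < p := fun a => Nat.mod_lt _ hp.pos
  obtain ⟨l, rfl⟩ : ∃ l, m = l + 1 := ⟨m - 1, by omega⟩
  have hxp := hx.trans_lt (hlt _)
  have hyp := hy.trans_lt (hlt _)
  have h1 := Choose.choose_modEq_choose_mod_mul_choose_div_nat (p := p) (n := n / p ^ i)
      (k := x + p ^ (l + 1) * y)
  have e1 : (x + p ^ (l + 1) * y) % p = x := by
    rw [pow_succ', mul_assoc, Nat.add_mul_mod_self_left, Nat.mod_eq_of_lt hxp]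
  have e2 : (x + p ^ (l + 1) * y) / p = p ^ l * y := by
    rw [pow_succ', mul_assoc, Nat.add_mul_div_left _ _ hp.pos, Nat.div_eq_of_lt hxp, zero_add]
  have h2 := choose_prime_pow_mul_modEq (p := p) (n / p ^ i / p) l y
  rw [Nat.div_div_eq_div_mul, Nat.div_div_eq_div_mul, mul_assoc, ← pow_succ', ← pow_add] at h2
  have h3 := Choose.choose_modEq_choose_mod_mul_choose_div_nat (p := p)
    (n := n / p ^ (i + (l + 1))) (k := y)
  rw [Nat.mod_eq_of_lt hyp, Nat.div_eq_of_lt hyp, Nat.choose_zero_right, mul_one] at h3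
  rw [e1, e2, Nat.div_div_eq_div_mul] at h1
  have h4 := (choose_prime_pow_mul_modEq (p := p) n i _).trans
    (h1.trans (Nat.ModEq.mul_left _ (h2.trans h3)))
  rw [h4.dvd_iff dvd_rfl, hp.dvd_mul, not_or]
  exact ⟨not_dvd_choose_of_lt_prime hp (hlt _) hx, not_dvd_choose_of_lt_prime hp (hlt _) hy⟩

theorem eq_zero_of_sum_pow_eq_zero {F : Type*} [Field F] {n : ℕ} {ω : F} (hω : n < orderOf ω)
    (d : ℕ → F) (h : ∀ i, ∑ k ∈ Finset.range (n + 1), (ω ^ i) ^ k * d k = 0) {k : ℕ} (hk : k ≤ n) :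
    d k = 0 := by
  classical
  let P : Polynomial F := ∑ k ∈ Finset.range (n + 1), Polynomial.monomial k (d k)
  have hP : P = 0 := by
    refine Polynomial.eq_zero_of_natDegree_lt_card_of_eval_eq_zero' P
      ((Finset.range (orderOf ω)).image (ω ^ ·)) (fun x hx => ?_) ?_
    · obtain ⟨i, -, rfl⟩ := Finset.mem_image.1 hx
      rw [← h i, Polynomial.eval_finsetSum]
      exact Finset.sum_congr rfl fun k _ => by rw [Polynomial.eval_monomial, mul_comm]
    · rw [Finset.card_image_of_injOn, Finset.card_range]
      · refine (Polynomial.natDegree_sum_le_of_forall_le (n := n) _ _ fun k hk => ?_).trans_lt hω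
        exact (Polynomial.natDegree_monomial_le _).trans (by simpa [Nat.lt_succ_iff] using hk)
      · rw [Finset.coe_range]
        exact pow_injOn_Iio_orderOf
  have := congrArg (Polynomial.coeff · k) hP
  simpa [P, Polynomial.coeff_monomial, Polynomial.finsetSum_coeff, Nat.lt_succ_iff, hk] using this

theorem sum_range_natCast_pow {F : Type*} [Field F] {p : ℕ} [CharP F p] [Fact p.Prime] {n : ℕ}
    (hn : 0 < n) (hd : p - 1 ∣ n) : ∑ j ∈ Finset.range p, (j : F) ^ n = -1 := by
  have hp := (Fact.out : p.Prime)
  obtain ⟨k, hk⟩ : ∃ k, p = k + 1 := ⟨p - 1, by have := hp.pos; omega⟩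
  have h1 : ∀ j ∈ Finset.range k, (((j + 1 : ℕ) : F)) ^ n = 1 := by
    intro j hj
    have hj0 : ((j + 1 : ℕ) : ZMod p) ≠ 0 := by
      rw [Ne, ZMod.natCast_eq_zero_iff]
      exact Nat.not_dvd_of_pos_of_lt j.succ_pos (by have := Finset.mem_range.1 hj; omega)
    obtain ⟨l, rfl⟩ := hd
    have := ZMod.pow_card_sub_one_eq_one hj0
    have := congrArg (ZMod.castHom dvd_rfl F) this
    rw [map_pow, map_natCast, map_one] at this
    rw [pow_mul, this, one_pow]
  rw [hk, Finset.sum_range_succ', Finset.sum_congr rfl h1]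
  have := CharP.cast_eq_zero F p
  rw [hk] at this
  push_cast at this
  simp [hn.ne']
  linear_combination this

section

variable {F : Type*} [Field F] {p m q A B : ℕ} {σ : F →+* F} {f : unitaryJ σ → F}

namespace IsWeightFunction

theorem dvd_choose_mul_choose (h : IsUnitaryField F p m q σ) (hp : 5 ≤ p)
    (hf : IsWeightFunction σ p A B f) (hA : A < q ^ 2 - 1) (hB : B < q - 1) {k l : ℕ}
    (hkl : 0 < k + l) (hd : p - 1 ∣ k + l) : p ∣ A.choose k * B.choose l := by
  have := h.charP
  have := Fact.mk h.prime
  obtain ⟨ω, hω⟩ := h.exists_orderOf dvd_rfl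
  obtain ⟨η, hη, hση⟩ := h.exists_orderOf_fixed
  rcases Nat.lt_or_ge A k with hk | hk
  · simp [Nat.choose_eq_zero_of_lt hk]
  rcases Nat.lt_or_ge B l with hl | hl
  · simp [Nat.choose_eq_zero_of_lt hl]
  have h1 : ∀ i, ∑ j ∈ Finset.range p,
      (j : F) ^ k * (1 + (j : F) * η ^ i) ^ B * (A.choose k : F) = 0 := by
    intro i
    refine eq_zero_of_sum_pow_eq_zero (hω ▸ hA) (fun k => ∑ j ∈ Finset.range p,
      (j : F) ^ k * (1 + (j : F) * η ^ i) ^ B * (A.choose k : F)) (fun i' => ?_) hk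
    rw [← hf.sum_one_add_mul_pow h hp hA hB (ω ^ i') (η ^ i) (by rw [map_pow, hση])]
    simp_rw [Finset.mul_sum]
    rw [Finset.sum_comm]
    refine Finset.sum_congr rfl fun j _ => ?_
    rw [add_comm (1 : F) (_ * ω ^ i'), add_pow (_ * ω ^ i') 1 A, Finset.sum_mul]
    refine Finset.sum_congr rfl fun k _ => ?_
    rw [one_pow, mul_pow]
    ring
  have h2 := eq_zero_of_sum_pow_eq_zero (hη ▸ hB) (fun l => ∑ j ∈ Finset.range p,
      (j : F) ^ (k + l) * (A.choose k : F) * (B.choose l : F)) (fun i => ?_) hl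
  · rw [← CharP.cast_eq_zero_iff F p]
    simp only [mul_assoc, ← Finset.sum_mul] at h2
    rw [sum_range_natCast_pow hkl hd] at h2
    push_cast
    linear_combination -h2
  · rw [← h1 i]
    simp_rw [Finset.mul_sum]
    rw [Finset.sum_comm]
    refine Finset.sum_congr rfl fun j _ => ?_
    rw [add_comm (1 : F) (_ * η ^ i), add_pow (_ * η ^ i) 1 B, Finset.mul_sum, Finset.sum_mul]
    refine Finset.sum_congr rfl fun l _ => ?_
    rw [one_pow, mul_pow]
    ring

theorem digit_add_lt (h : IsUnitaryField F p m q σ) (hp : 5 ≤ p)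
    (hf : IsWeightFunction σ p A B f) (hA : A < q ^ 2 - 1) (hB : B < q - 1) (i : ℕ) :
    A / p ^ i % p + B / p ^ i % p + A / p ^ (i + m) % p < p - 1 := by
  by_contra! hc
  obtain ⟨x, y, z, hx, hy, hz, hs⟩ : ∃ x y z, x ≤ A / p ^ i % p ∧ y ≤ B / p ^ i % p ∧
      z ≤ A / p ^ (i + m) % p ∧ x + y + z = p - 1 := by
    generalize A / p ^ i % p = a at *
    generalize B / p ^ i % p = b at *
    generalize A / p ^ (i + m) % p = c at *
    refine ⟨min a (p - 1), min b (p - 1 - min a (p - 1)),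
      p - 1 - min a (p - 1) - min b (p - 1 - min a (p - 1)), ?_, ?_, ?_, ?_⟩ <;> omega
  have hmod : ∀ n, p ^ n ≡ 1 [MOD (p - 1)] := fun n => by
    have : p ≡ 1 [MOD (p - 1)] := by
      conv_lhs => rw [show p = 1 + (p - 1) by omega]
      simp [Nat.ModEq]
    simpa using this.pow n
  have h1 : p ^ i * (x + p ^ m * z) + p ^ i * (y + p ^ m * 0) ≡ 0 [MOD (p - 1)] := by
    have h2 : p ^ i * (x + p ^ m * z) + p ^ i * (y + p ^ m * 0) ≡
        1 * (x + 1 * z) + 1 * (y + 1 * 0) [MOD (p - 1)] := by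
      gcongr <;> exact hmod _
    refine h2.trans ?_
    rw [show 1 * (x + 1 * z) + 1 * (y + 1 * 0) = p - 1 by omega]
    simp [Nat.ModEq]
  have h3 := hf.dvd_choose_mul_choose h hp hA hB (k := p ^ i * (x + p ^ m * z))
    (l := p ^ i * (y + p ^ m * 0)) ?_ (Nat.modEq_zero_iff_dvd.1 h1)
  · rcases (h.prime.dvd_mul).1 h3 with h3 | h3
    · exact not_dvd_choose_of_digit_le h.prime h.m_pos hx hz h3
    · exact not_dvd_choose_of_digit_le h.prime h.m_pos hy (Nat.zero_le _) h3
  · have hpi := pow_pos h.prime.pos i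
    have hpm := pow_pos h.prime.pos m
    rw [← mul_add]
    refine Nat.mul_pos hpi ?_
    have := Nat.mul_le_mul_right z (Nat.one_le_iff_ne_zero.2 hpm.ne')
    omega

end IsWeightFunction

end

theorem add_smul_mul_eq {K R : Type*} [Field K] [Ring R] [Algebra K R] {e f : R} (hee : e * e = 0)
    (hff : f * f = 0) (hefe : e * f * e = e) (hfef : f * e * f = f) {c : K} (hc : c ≠ 0) :
    (1 + c • e) * (1 + (-c⁻¹) • f) * (1 + c • e) * ((1 + (-1 : K) • e) * (1 + (1 : K) • f) *
      (1 + (-1 : K) • e)) = 1 + (c - 1) • (e * f) + (c⁻¹ - 1) • (f * e) := by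
  have h1 : (1 + c • e) * (1 + (-c⁻¹) • f) * (1 + c • e) =
      1 + c • e - c⁻¹ • f - e * f - f * e := by
    simp only [mul_add, add_mul, mul_one, one_mul, smul_mul_assoc, mul_smul_comm, smul_add, hee,
      hefe, smul_zero, smul_smul, mul_neg, mul_inv_cancel₀ hc, neg_mul, inv_mul_cancel₀ hc]
    module
  have h2 : (1 + (-1 : K) • e) * (1 + (1 : K) • f) * (1 + (-1 : K) • e) =
      1 - e + f - e * f - f * e := by
    simp only [mul_add, add_mul, mul_one, one_mul, smul_mul_assoc, mul_smul_comm, smul_add, hee,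
      hefe, smul_zero, smul_smul]
    module
  have h3 : e * (e * f) = 0 := by rw [← mul_assoc, hee, zero_mul]
  have h4 : f * (f * e) = 0 := by rw [← mul_assoc, hff, zero_mul]
  have h5 : e * (f * e) = e := by rw [← mul_assoc, hefe]
  have h6 : f * (e * f) = f := by rw [← mul_assoc, hfef]
  have h7 : f * (e * (f * e)) = f * e := by rw [h5]
  have h8 : e * (f * (e * f)) = e * f := by rw [h6]
  rw [h1, h2]
  simp only [mul_add, add_mul, mul_sub, sub_mul, mul_one, one_mul, smul_mul_assoc, hee, hff,
    mul_assoc, h3, h4, h5, h6, smul_zero, mul_zero]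
  module

namespace Matrix

theorem diag2n_eq_transvection_mul {ι F : Type*} [Fintype ι] [DecidableEq ι] [Field F] {i j : ι}
    (hij : i ≠ j) {c : F} (hc : c ≠ 0) :
    SpecialLinearGroup.diag2n hij c hc =
      SpecialLinearGroup.transvection hij c * SpecialLinearGroup.transvection hij.symm (-c⁻¹) *
        SpecialLinearGroup.transvection hij c * (SpecialLinearGroup.transvection hij (-1) *
        SpecialLinearGroup.transvection hij.symm 1 * SpecialLinearGroup.transvection hij (-1)) := by
  have key := add_smul_mul_eq (e := single i j (1 : F)) (f := single j i 1) (by simp [hij.symm])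
    (by simp [hij]) (by simp) (by simp) hc
  simp only [smul_single, smul_eq_mul, mul_one, single_mul_single_same] at key
  apply Subtype.ext
  simp only [SpecialLinearGroup.coe_mul, SpecialLinearGroup.transvection_coe]
  rw [key, SpecialLinearGroup.diag2n_coe]
  ext k l
  simp only [diagonal_apply, Matrix.add_apply, Matrix.one_apply, single_apply]
  grind

theorem SpecialLinearGroup.mem_of_forall_transvection {ι F : Type*} [Fintype ι] [DecidableEq ι]
    [Nontrivial ι] [Field F] (S : Submonoid (SpecialLinearGroup ι F))
    (h : ∀ (i j : ι) (hij : i ≠ j) (c : F), transvection hij c ∈ S) (M : SpecialLinearGroup ι F) :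
    M ∈ S := by
  refine diagonal_transvection_induction' (· ∈ S) M (fun i j hij c hc => ?_) h
    fun A B hA hB => mul_mem hA hB
  rw [diag2n_eq_transvection_mul hij hc]
  exact mul_mem (mul_mem (mul_mem (h ..) (h ..)) (h ..)) (mul_mem (mul_mem (h ..) (h ..)) (h ..))

end Matrix

section

variable {F : Type*} [Field F] {p m q A B : ℕ} {σ : F →+* F} {f : unitaryJ σ → F}

/-- The leading principal minor of order three. -/
def minorThree (M : Matrix (Fin 4) (Fin 4) F) : F :=
  M 0 0 * (M 1 1 * M 2 2 - M 1 2 * M 2 1) - M 0 1 * (M 1 0 * M 2 2 - M 1 2 * M 2 0) +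
    M 0 2 * (M 1 0 * M 2 1 - M 1 1 * M 2 0)

theorem minorThree_mat (g : unitaryJ σ) : minorThree (mat g) = σ (mat g 0 0) := by
  have h1 : ((mat g).map σ)ᵀ * antiDiag F = antiDiag F * (mat g).adjugate := by
    have h2 := congrArg (· * (mat g).adjugate) (mat_form g)
    simpa only [mul_assoc, mul_adjugate, det_mat, one_smul, mul_one] using h2
  have h3 := congrFun (congrFun h1 0) 3
  have h4 : (((mat g).map σ)ᵀ * antiDiag F) 0 3 = σ (mat g 0 0) := by
    simp [antiDiag, Matrix.mul_apply, Fin.sum_univ_four]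
  have h5 : ∀ M : Matrix (Fin 4) (Fin 4) F, (antiDiag F * M.adjugate) 0 3 = minorThree M := by
    intro M
    have h6 : (antiDiag F * M.adjugate) 0 3 = M.adjugate 3 3 := by
      simp [antiDiag, Matrix.mul_apply, Fin.sum_univ_four]
    rw [h6, adjugate_fin_succ_eq_det_submatrix, det_fin_three, minorThree]
    simp [Fin.succAbove]
    ring
  rw [← h5, ← h3, h4]

/-- A product of powers of leading principal minors. -/
def minorForm (a b c : ℕ) (M : Matrix (Fin 4) (Fin 4) F) : F :=
  M 0 0 ^ a * minorTwo M ^ b * minorThree M ^ c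

/-- A product of powers of leading principal minors of several matrices. -/
def twistedForm (a b c : Fin m → ℕ) (x : Fin m → Matrix (Fin 4) (Fin 4) F) : F :=
  ∏ i, minorForm (a i) (b i) (c i) (x i)

/-- The Frobenius twists of a matrix. -/
def twist (F : Type*) [Field F] (p m : ℕ) [ExpChar F p] :
    Matrix (Fin 4) (Fin 4) F →* (Fin m → Matrix (Fin 4) (Fin 4) F) :=
  MonoidHom.pi fun i => ((iterateFrobenius F p i).mapMatrix :
    Matrix (Fin 4) (Fin 4) F →+* Matrix (Fin 4) (Fin 4) F).toMonoidHom

theorem twist_apply [ExpChar F p] (M : Matrix (Fin 4) (Fin 4) F) (i : Fin m) :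
    twist F p m M i = M.map (iterateFrobenius F p i) := rfl

theorem minorTwo_map {K : Type*} [Field K] (φ : F →+* K) (M : Matrix (Fin 4) (Fin 4) F) :
    minorTwo (M.map φ) = φ (minorTwo M) := by
  simp [minorTwo]

theorem minorThree_map {K : Type*} [Field K] (φ : F →+* K) (M : Matrix (Fin 4) (Fin 4) F) :
    minorThree (M.map φ) = φ (minorThree M) := by
  simp [minorThree]

theorem sum_digit_mul_pow (p n k : ℕ) :
    ∑ i ∈ Finset.range k, n / p ^ i % p * p ^ i = n % p ^ k := by
  induction k with
  | zero => simp [Nat.mod_one]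
  | succ k ih => rw [Finset.sum_range_succ, ih, Nat.mod_pow_succ, mul_comm (p ^ k)]

theorem prod_pow_digit {p m n : ℕ} (hn : n < p ^ m) (x : F) :
    ∏ i : Fin m, (x ^ p ^ (i : ℕ)) ^ (n / p ^ (i : ℕ) % p) = x ^ n := by
  rw [Fin.prod_univ_eq_prod_range (fun i => (x ^ p ^ i) ^ (n / p ^ i % p))]
  simp only [← pow_mul]
  rw [Finset.prod_pow_eq_pow_sum]
  simp only [mul_comm (p ^ _)]
  rw [sum_digit_mul_pow, Nat.mod_eq_of_lt hn]

theorem IsUnitaryField.twistedForm_twist [ExpChar F p] (h : IsUnitaryField F p m q σ)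
    (hA : A < q ^ 2) (hB : B < q) (g : unitaryJ σ) :
    twistedForm (fun i => A / p ^ (i : ℕ) % p) (fun i => B / p ^ (i : ℕ) % p)
      (fun i => A / p ^ ((i : ℕ) + m) % p) (twist F p m (mat g)) =
    mat g 0 0 ^ A * minorTwo (mat g) ^ B := by
  have hA' : A / p ^ m < p ^ m := by
    rw [Nat.div_lt_iff_lt_mul (pow_pos h.prime.pos m), ← h.q_eq, ← sq]
    exact hA
  have h1 : ∀ x : F, x ^ A = (∏ i : Fin m, (x ^ p ^ (i : ℕ)) ^ (A / p ^ (i : ℕ) % p)) *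
      ∏ i : Fin m, ((σ x) ^ p ^ (i : ℕ)) ^ (A / p ^ ((i : ℕ) + m) % p) := by
    intro x
    have e1 : ∀ i : ℕ, A / p ^ (i + m) % p = A / p ^ m / p ^ i % p := fun i => by
      rw [Nat.div_div_eq_div_mul, ← pow_add, add_comm]
    have e2 : ∀ i : Fin m, A / p ^ (i : ℕ) % p = A % p ^ m / p ^ (i : ℕ) % p := fun i => by
      obtain ⟨k, hk⟩ : ∃ k, m = i + (k + 1) := ⟨m - i - 1, by omega⟩
      rw [congrArg (p ^ ·) hk, pow_add, Nat.mod_mul_right_div_self, pow_succ, Nat.mod_mul_left_mod]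
    simp only [e1, e2]
    rw [prod_pow_digit (Nat.mod_lt _ (pow_pos h.prime.pos m)), prod_pow_digit hA', h.conj, h.q_eq,
      ← pow_mul, ← pow_add, Nat.mod_add_div]
  simp only [twistedForm, minorForm, twist_apply, minorTwo_map, minorThree_map, minorThree_mat,
    Matrix.map_apply, Finset.prod_mul_distrib, iterateFrobenius_def]
  rw [h1, prod_pow_digit (n := B) (by rwa [← h.q_eq])]
  ring

theorem IsWeightFunction.apply_eq_twistedForm [ExpChar F p] (h : IsUnitaryField F p m q σ)
    (hp : 5 ≤ p) (hf : IsWeightFunction σ p A B f) (hA : A < q ^ 2 - 1) (hB : B < q - 1)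
    (g : unitaryJ σ) :
    f g = twistedForm (fun i => A / p ^ (i : ℕ) % p) (fun i => B / p ^ (i : ℕ) % p)
      (fun i => A / p ^ ((i : ℕ) + m) % p) (twist F p m (mat g)) * f 1 := by
  rw [hf.apply_eq h hp hA hB, h.twistedForm_twist (by omega) (by omega)]

end

section

variable {F : Type*} [Field F] {p m q : ℕ} {σ : F →+* F}

/-- Functions of several matrices that, along families of transvections, are given by a polynomial
of degree less than `p` in every parameter. -/
def IsRestricted (p : ℕ) (φ : (Fin m → Matrix (Fin 4) (Fin 4) F) → F) : Prop :=
  ∀ (x y : Fin m → Matrix (Fin 4) (Fin 4) F) (u v : Fin m → Fin 4 → F),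
    ∃ d : (Fin m → Fin p) → F, ∀ τ : Fin m → F,
      φ (x * (fun i => 1 + τ i • vecMulVec (u i) (v i)) * y) = ∑ k, d k * ∏ i, τ i ^ (k i : ℕ)

namespace IsRestricted

variable {φ : (Fin m → Matrix (Fin 4) (Fin 4) F) → F}

theorem mul_left (hφ : IsRestricted p φ) (s : Fin m → Matrix (Fin 4) (Fin 4) F) :
    IsRestricted p fun x => φ (s * x) := by
  intro x y u v
  simpa only [mul_assoc] using hφ (s * x) y u v

theorem mul_right (hφ : IsRestricted p φ) (s : Fin m → Matrix (Fin 4) (Fin 4) F) :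
    IsRestricted p fun x => φ (x * s) := by
  intro x y u v
  simpa only [mul_assoc] using hφ x (y * s) u v

theorem sum {ι : Type*} (S : Finset ι) {φ : ι → (Fin m → Matrix (Fin 4) (Fin 4) F) → F}
    (hφ : ∀ j, IsRestricted p (φ j)) : IsRestricted p fun x => ∑ j ∈ S, φ j x := by
  intro x y u v
  choose d hd using fun j => hφ j x y u v
  refine ⟨fun k => ∑ j ∈ S, d j k, fun τ => ?_⟩
  simp only [hd, Finset.sum_mul]
  exact Finset.sum_comm

end IsRestricted

theorem exists_minorForm_eq_sum {a b c : ℕ} (habc : a + b + c < p)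
    (x y : Matrix (Fin 4) (Fin 4) F) (u v : Fin 4 → F) :
    ∃ d : Fin p → F, ∀ τ : F,
      minorForm a b c (x * (1 + τ • vecMulVec u v) * y) = ∑ k, d k * τ ^ (k : ℕ) := by
  have h1 : ∀ τ : F, x * (1 + τ • vecMulVec u v) * y =
      x * y + τ • vecMulVec (x *ᵥ u) (v ᵥ* y) := fun τ => by
    rw [mul_add, mul_one, add_mul, mul_smul_comm, smul_mul_assoc, mul_vecMulVec, vecMulVec_mul]
  simp only [h1]
  generalize x * y = z
  generalize x *ᵥ u = u
  generalize v ᵥ* y = v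
  obtain ⟨α₁, β₁, e1⟩ : ∃ α β, ∀ τ : F, (z + τ • vecMulVec u v) 0 0 = α + β * τ :=
    ⟨z 0 0, u 0 * v 0, fun τ => by simp [vecMulVec_apply, mul_comm]⟩
  obtain ⟨α₂, β₂, e2⟩ : ∃ α β, ∀ τ : F, minorTwo (z + τ • vecMulVec u v) = α + β * τ :=
    ⟨minorTwo z, z 0 0 * (u 1 * v 1) + u 0 * v 0 * z 1 1 - z 0 1 * (u 1 * v 0) -
      u 0 * v 1 * z 1 0, fun τ => by simp [minorTwo, vecMulVec_apply]; ring⟩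
  obtain ⟨α₃, β₃, e3⟩ : ∃ α β, ∀ τ : F, minorThree (z + τ • vecMulVec u v) = α + β * τ :=
    ⟨minorThree z, minorThree (z + vecMulVec u v) - minorThree z, fun τ => by
      simp [minorThree, vecMulVec_apply]; ring⟩
  open Polynomial in
  let P : F[X] := (C β₁ * X + C α₁) ^ a * (C β₂ * X + C α₂) ^ b * (C β₃ * X + C α₃) ^ c
  have hP : P.natDegree < p := by
    refine (Polynomial.natDegree_mul_le_of_le (Polynomial.natDegree_mul_le_of_le
      (Polynomial.natDegree_pow_le_of_le a Polynomial.natDegree_linear_le)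
      (Polynomial.natDegree_pow_le_of_le b Polynomial.natDegree_linear_le))
      (Polynomial.natDegree_pow_le_of_le c Polynomial.natDegree_linear_le)).trans_lt ?_
    simpa using habc
  refine ⟨fun k => P.coeff k, fun τ => ?_⟩
  rw [Fin.sum_univ_eq_sum_range (fun k => P.coeff k * τ ^ k), ← Polynomial.eval_eq_sum_range' hP,
    minorForm, e1, e2, e3]
  simp [P, add_comm]

theorem isRestricted_twistedForm {a b c : Fin m → ℕ} (habc : ∀ i, a i + b i + c i < p) :
    IsRestricted p (twistedForm (F := F) a b c) := by
  intro x y u v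
  choose d hd using fun i => exists_minorForm_eq_sum (habc i) (x i) (y i) (u i) (v i)
  refine ⟨fun k => ∏ i, d i (k i), fun τ => ?_⟩
  simp only [twistedForm, Pi.mul_apply, hd, Finset.prod_univ_sum, Fintype.piFinset_univ,
    Finset.prod_mul_distrib]

/-- The tuples at which every restricted function vanishing on the twisted diagonal vanishes. -/
def densityMonoid (σ : F →+* F) (p m : ℕ) [ExpChar F p] :
    Submonoid (Fin m → Matrix (Fin 4) (Fin 4) F) where
  carrier := {s | ∀ φ, IsRestricted p φ → (∀ g : unitaryJ σ, φ (twist F p m (mat g)) = 0) → φ s = 0}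
  one_mem' φ _ h := by simpa only [map_one] using h 1
  mul_mem' {s t} hs ht φ hφ h :=
    ht _ (hφ.mul_left s) fun g => hs _ (hφ.mul_right _) fun g' => by
      rw [← map_mul, ← map_mul, h]

theorem mem_densityMonoid [ExpChar F p] {s : Fin m → Matrix (Fin 4) (Fin 4) F} :
    s ∈ densityMonoid σ p m ↔
      ∀ φ, IsRestricted p φ → (∀ g : unitaryJ σ, φ (twist F p m (mat g)) = 0) → φ s = 0 := Iff.rfl

namespace IsUnitaryField

theorem eq_zero_of_sum_prod_pow (h : IsUnitaryField F p m q σ) (d : (Fin m → Fin p) → F)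
    (hd : ∀ t, σ t = t → ∑ k, d k * ∏ i : Fin m, (t ^ p ^ (i : ℕ)) ^ (k i : ℕ) = 0) : d = 0 := by
  obtain ⟨η, hη, hση⟩ := h.exists_orderOf_fixed
  have hq := h.q_ge
  let D : ℕ → F := fun n => if hn : n < p ^ m then d (finFunctionFinEquiv.symm ⟨n, hn⟩) else 0
  have hD : ∀ k, d k = D (finFunctionFinEquiv k) := fun k => by
    simp only [D, Fin.is_lt, dif_pos, Fin.eta, Equiv.symm_apply_apply]
  have hs : ∀ t, σ t = t → ∑ n ∈ Finset.range q, t ^ n * D n = 0 := by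
    intro t ht
    rw [h.q_eq, ← Fin.sum_univ_eq_sum_range (fun n => t ^ n * D n), ← hd t ht]
    refine (Fintype.sum_equiv finFunctionFinEquiv _ _ fun k => ?_).symm
    rw [hD k, mul_comm]
    simp only [← pow_mul]
    rw [Finset.prod_pow_eq_pow_sum, finFunctionFinEquiv_apply]
    simp only [mul_comm (p ^ _)]
  obtain ⟨n, rfl⟩ : ∃ n, q = n + 2 := ⟨q - 2, by omega⟩
  have h0 : D 0 = 0 := by simpa [Finset.sum_range_succ'] using hs 0 (map_zero σ)
  have h1 : ∀ k ≤ n, D (k + 1) = 0 := by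
    intro k hk
    refine eq_zero_of_sum_pow_eq_zero (by omega : n < orderOf η) (fun k => D (k + 1))
      (fun i => ?_) hk
    have h2 := hs (η ^ i) (by rw [map_pow, hση])
    have hη0 : η ^ i ≠ 0 := pow_ne_zero _ (by rintro rfl; simp at hη)
    rw [Finset.sum_range_succ', h0, mul_zero, add_zero] at h2
    simp only [pow_succ, mul_right_comm _ (η ^ i), ← Finset.sum_mul] at h2
    exact (mul_eq_zero.1 h2).resolve_right hη0
  funext k
  rw [hD, Pi.zero_apply]
  have hk := (finFunctionFinEquiv k).isLt.trans_eq h.q_eq.symm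
  rcases hk' : (finFunctionFinEquiv k : ℕ) with _ | n
  · exact h0
  · exact h1 n (by omega)

theorem one_add_smul_mem_densityMonoid [ExpChar F p] (h : IsUnitaryField F p m q σ)
    {w : Fin 4 → F} (hw : IsIsotropic σ w) (τ : Fin m → F) :
    (fun i => 1 + τ i • isotropicMatrix σ fun k => w k ^ p ^ (i : ℕ)) ∈ densityMonoid σ p m := by
  intro φ hφ h0
  obtain ⟨ε, hε, hσε⟩ := h.exists_conj_eq_neg
  obtain ⟨d, hd⟩ := hφ 1 1 (fun i k => w k ^ p ^ (i : ℕ))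
    (fun i k => σ (w (Fin.rev k) ^ p ^ (i : ℕ)))
  simp only [one_mul, mul_one] at hd
  have key : (fun k => d k * ∏ i : Fin m, (ε ^ p ^ (i : ℕ)) ^ (k i : ℕ)) = 0 := by
    refine h.eq_zero_of_sum_prod_pow _ fun t ht => ?_
    obtain ⟨g, hg⟩ := hw.exists_transvection h.invol (τ := t * ε) (by rw [map_mul, ht, hσε, mul_neg])
    have h1 := hd fun i => (t * ε) ^ p ^ (i : ℕ)
    have h2 : (fun i : Fin m => 1 + (t * ε) ^ p ^ (i : ℕ) • vecMulVec (fun k => w k ^ p ^ (i : ℕ))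
        fun k => σ (w (Fin.rev k) ^ p ^ (i : ℕ))) = twist F p m (mat g) := by
      funext i
      rw [hg, twist_apply, Matrix.map_add _ (map_add _), Matrix.map_one _ (map_zero _) (map_one _),
        Matrix.map_smul' _ _ _ (map_mul _), iterateFrobenius_def]
      congr 2
      ext k l
      simp [vecMulVec_apply, isotropicMatrix_apply, iterateFrobenius_def, mul_pow]
    rw [h2, h0] at h1
    rw [h1]
    refine Finset.sum_congr rfl fun k _ => ?_
    simp only [mul_pow, Finset.prod_mul_distrib]
    ring
  have hd0 : d = 0 := funext fun k => (mul_eq_zero.1 (congrFun key k)).resolve_right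
    (Finset.prod_ne_zero_iff.2 fun i _ => pow_ne_zero _ (pow_ne_zero _ hε))
  refine (hd τ).trans ?_
  simp [hd0]

theorem mulSingle_mem_densityMonoid [ExpChar F p] (h : IsUnitaryField F p m q σ)
    {w : Fin 4 → F} (hw : IsIsotropic σ w) (i : Fin m) (τ : F) :
    Pi.mulSingle i (1 + τ • isotropicMatrix σ fun k => w k ^ p ^ (i : ℕ)) ∈
      densityMonoid σ p m := by
  convert h.one_add_smul_mem_densityMonoid hw (Pi.single i τ) using 1
  funext j
  rcases eq_or_ne j i with rfl | hj
  · simp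
  · simp [hj]

theorem isIsotropic_single_add_single {k r : Fin 4} (hkr : r ≠ k) (hrk : r ≠ Fin.rev k) (c : F) :
    IsIsotropic σ (Pi.single k 1 + Pi.single r c) := by
  fin_cases k <;> fin_cases r <;> simp_all [IsIsotropic, Fin.rev]

theorem isotropicMatrix_single_add_single {k r : Fin 4} (hkr : r ≠ k) (c : F) (j : ℕ) (hp : 0 < p) :
    (isotropicMatrix σ fun i => (Pi.single k 1 + Pi.single r c : Fin 4 → F) i ^ p ^ j) =
      single k (Fin.rev k) 1 + single r (Fin.rev k) (c ^ p ^ j) +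
        single k (Fin.rev r) (σ (c ^ p ^ j)) +
        single r (Fin.rev r) (c ^ p ^ j * σ (c ^ p ^ j)) := by
  have h1 : (fun i => (Pi.single k 1 + Pi.single r c : Fin 4 → F) i ^ p ^ j) =
      Pi.single k 1 + Pi.single r (c ^ p ^ j) := by
    have h0 : p ^ j ≠ 0 := (pow_pos hp j).ne'
    funext i
    simp only [Pi.add_apply, Pi.single_apply]
    split_ifs <;> simp_all
  rw [h1]
  ext i l
  simp only [isotropicMatrix_apply, Pi.add_apply, Pi.single_apply, Matrix.add_apply, single_apply]
  simp only [Fin.rev_eq_iff, eq_comm (a := i), map_add, eq_comm (b := l.rev)]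
  split_ifs <;> simp_all

theorem mulSingle_transvection_mem [ExpChar F p] (h : IsUnitaryField F p m q σ) (i : Fin m)
    {r l : Fin 4} (hrl : r ≠ l) (c : F) :
    Pi.mulSingle i (transvection r l c) ∈ densityMonoid σ p m := by
  have := h.two_ne_zero
  obtain ⟨ε, hε, hσε⟩ := h.exists_conj_eq_neg
  have hε' : ε ^ p ^ (i : ℕ) ≠ 0 := pow_ne_zero _ hε
  have hσε' : σ (ε ^ p ^ (i : ℕ)) = -ε ^ p ^ (i : ℕ) := by
    rw [map_pow, hσε, (h.odd.pow).neg_pow]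
  have h0 : (0 : F) ^ p ^ (i : ℕ) = 0 := zero_pow (pow_pos h.prime.pos i).ne'
  have hne : ∀ k : Fin 4, k ≠ Fin.rev k := by decide
  have hr : ∀ (r : Fin 4) (τ : F),
      Pi.mulSingle i (1 + single r (Fin.rev r) τ) ∈ densityMonoid σ p m := by
    intro r τ
    have hw : IsIsotropic σ (Pi.single r 1 : Fin 4 → F) := by
      fin_cases r <;> simp [IsIsotropic]
    have h1 := h.mulSingle_mem_densityMonoid hw i τ
    have h2 := isotropicMatrix_single_add_single (σ := σ) (hne r).symm (0 : F) i h.prime.pos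
    simp only [h0, Pi.single_zero, add_zero, map_zero, mul_zero, single_zero] at h2
    simpa [h2] using h1
  rcases eq_or_ne l (Fin.rev r) with rfl | hlr
  · exact hr r c
  · have hkr : r ≠ Fin.rev l := fun e => hlr (by rw [e, Fin.rev_rev])
    let E (t : F × F × F × F) : Matrix (Fin 4) (Fin 4) F :=
      single (Fin.rev l) l t.1 + single r l t.2.1 + single (Fin.rev l) (Fin.rev r) t.2.2.1 +
        single r (Fin.rev r) t.2.2.2
    have hE : ∀ s t, E s * E t = 0 := fun s t => by
      simp only [E, mul_add, add_mul, single_mul_single_of_ne _ _ _ _ (hne l),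
        single_mul_single_of_ne _ _ _ _ hrl.symm, single_mul_single_of_ne _ _ _ _ (hne r).symm,
        single_mul_single_of_ne _ _ _ _ (fun e => hrl (Fin.rev_injective e) : r.rev ≠ l.rev),
        add_zero]
    have hadd : ∀ s t, Pi.mulSingle i (1 + E s) ∈ densityMonoid σ p m →
        Pi.mulSingle i (1 + E t) ∈ densityMonoid σ p m →
        Pi.mulSingle i (1 + E (s + t)) ∈ densityMonoid σ p m := by
      intro s t hs ht
      have h1 := mul_mem hs ht
      rw [← Pi.mulSingle_mul, add_mul, one_mul, mul_add, hE, mul_one, add_zero] at h1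
      have h2 : E (s + t) = E t + E s := by
        simp only [E, Prod.fst_add, Prod.snd_add, single_add]
        abel
      rwa [h2, ← add_assoc]
    have hmem : ∀ c τ : F, Pi.mulSingle i (1 + E (τ, τ * c ^ p ^ (i : ℕ),
        τ * σ (c ^ p ^ (i : ℕ)), τ * (c ^ p ^ (i : ℕ) * σ (c ^ p ^ (i : ℕ))))) ∈
        densityMonoid σ p m := by
      intro c τ
      have h1 := h.mulSingle_mem_densityMonoid
        (isIsotropic_single_add_single (σ := σ) hkr (by rwa [Fin.rev_rev]) c) i τ
      rw [isotropicMatrix_single_add_single hkr _ _ h.prime.pos, Fin.rev_rev] at h1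
      simpa only [E, smul_add, smul_single, smul_eq_mul, mul_one] using h1
    have hd : ∀ τ : F, Pi.mulSingle i (1 + E (0, 0, 0, τ)) ∈ densityMonoid σ p m :=
      fun τ => by simpa [E] using hr r τ
    have h1 := hadd _ _ (hadd _ _ (hmem 1 (c / 2)) (hmem ε (c / (2 * ε ^ p ^ (i : ℕ)))))
      (hadd _ _ (hmem 0 (-(c / 2) - c / (2 * ε ^ p ^ (i : ℕ))))
        (hd (-(c / 2) + c / 2 * ε ^ p ^ (i : ℕ))))
    convert h1 using 3
    simp only [E, Prod.mk_add_mk, h0, one_pow, map_one, map_zero, hσε', mul_zero, mul_one, add_zero]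
    have e1 : c / 2 + c / (2 * ε ^ p ^ (i : ℕ)) +
        (-(c / 2) - c / (2 * ε ^ p ^ (i : ℕ))) = 0 := by ring
    have e2 : c / 2 + c / (2 * ε ^ p ^ (i : ℕ)) * ε ^ p ^ (i : ℕ) = c := by field_simp; norm_num
    have e3 : c / 2 + c / (2 * ε ^ p ^ (i : ℕ)) * -ε ^ p ^ (i : ℕ) = 0 := by field_simp; norm_num
    have e4 : c / 2 + c / (2 * ε ^ p ^ (i : ℕ)) * (ε ^ p ^ (i : ℕ) * -ε ^ p ^ (i : ℕ)) +
        (0 + (-(c / 2) + c / 2 * ε ^ p ^ (i : ℕ))) = 0 := by field_simp; ring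
    rw [e1, e2, e3, e4]
    simp [transvection]

theorem mem_densityMonoid_of_det_eq_one [ExpChar F p] (h : IsUnitaryField F p m q σ)
    (s : Fin m → Matrix (Fin 4) (Fin 4) F) (hs : ∀ i, (s i).det = 1) :
    s ∈ densityMonoid σ p m := by
  refine Submonoid.pi_mem_of_mulSingle_mem s fun i => ?_
  exact SpecialLinearGroup.mem_of_forall_transvection
    (((densityMonoid σ p m).comap (MonoidHom.mulSingle _ i)).comap slMat)
    (fun r l hrl c => h.mulSingle_transvection_mem i hrl c) ⟨s i, hs i⟩

end IsUnitaryField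

end

section

theorem Submodule.mem_of_sum_pow_smul_mem {F V : Type*} [Field F] [AddCommGroup V] [Module F V]
    (W : Submodule F V) {n : ℕ} {ω : F} (hω : n < orderOf ω) (x : ℕ → V)
    (hx : ∀ v : F, v ≠ 0 → ∑ k ∈ Finset.range (n + 1), v ^ k • x k ∈ W) {k : ℕ} (hk : k ≤ n) :
    x k ∈ W := by
  by_contra hxk
  obtain ⟨l, hl, hlW⟩ := Submodule.exists_le_ker_of_notMem hxk
  have hω0 : ω ≠ 0 := by
    rintro rfl
    simp at hω
  refine hl (eq_zero_of_sum_pow_eq_zero hω (fun k => l (x k)) (fun i => ?_) hk)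
  simpa using hlW (hx (ω ^ i) (pow_ne_zero _ hω0))

theorem Submodule.pow_mul_pow_mem {F R : Type*} [Field F] [CommRing R] [Algebra F R] {p n : ℕ}
    [CharP F p] (hp : p.Prime) (hn : n < p) (W : Submodule F R) {ω : F} (hω : n < orderOf ω)
    {α β γ : R} (h : ∀ v : F, v ≠ 0 → (v • α + β) ^ n * γ ∈ W) {k : ℕ} (hk : k ≤ n) :
    α ^ k * β ^ (n - k) * γ ∈ W := by
  have h1 := W.mem_of_sum_pow_smul_mem hω (fun k => (n.choose k : F) • (α ^ k * β ^ (n - k) * γ))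
    (fun v hv => ?_) hk
  · refine (W.smul_mem_iff fun h0 => ?_).1 h1
    rw [CharP.cast_eq_zero_iff F p] at h0
    exact not_dvd_choose_of_lt_prime hp hn hk h0
  · convert h v hv using 1
    rw [add_pow, Finset.sum_mul]
    refine Finset.sum_congr rfl fun k _ => ?_
    rw [smul_pow, Nat.cast_smul_eq_nsmul, nsmul_eq_mul, smul_mul_assoc, smul_mul_assoc,
      smul_mul_assoc]
    congr 1
    ring

variable {F : Type*} [Field F] {p a b c : ℕ}

/-- The span of the functions obtained by evaluating a product of minors along the powers of a
diagonal matrix. -/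
def minorSpan (a b c : ℕ) (d : Fin 4 → F) : Submodule F (ℕ → F) :=
  Submodule.span F {w | ∃ X Y : Matrix (Fin 4) (Fin 4) F, X.det = 1 ∧ Y.det = 1 ∧
    w = fun j => minorForm a b c (X * diagonal d ^ j * Y)}

theorem mul_diagonal_pow_mul_apply (X Y : Matrix (Fin 4) (Fin 4) F) (d : Fin 4 → F) (j : ℕ)
    (k l : Fin 4) : (X * diagonal d ^ j * Y) k l = ∑ i, X k i * d i ^ j * Y i l := by
  rw [diagonal_pow, Matrix.mul_apply]
  simp only [mul_diagonal, Pi.pow_apply]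

theorem mem_minorSpan (d : Fin 4 → F) {r s v : F} (hr : r ≠ 0) (hs : s ≠ 0) (hv : v ≠ 0)
    (D : Fin 4 → ℕ → F) (hD : ∀ k j, D k j = d k ^ j) :
    (s • D 2 + D 1) ^ (a + c) * ((v • D 0 + D 2) ^ b * ((r • D 3 + D 1) ^ b * (D 0 * D 3) ^ c)) ∈
      minorSpan a b c d := by
  have h1 : (-s) ^ b * (-(s * r * v)) ^ c ≠ 0 := by simp [hr, hs, hv]
  rw [← Submodule.smul_mem_iff _ h1]
  refine Submodule.subset_span ⟨!![s * v, 1, s, 0; 0, 1, 0, r; s * v, 0, 0, 0;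
    0, 0, -(s * v * r)⁻¹, 0], !![0, 1, 0, 0; 1, 0, 0, 0; 1, 1, 0, 1; 1, 0, 1, 0], ?_, ?_, ?_⟩
  · simp [det_succ_row_zero, Fin.sum_univ_succ, Fin.succAbove]
    field_simp
  · simp [det_succ_row_zero, Fin.sum_univ_succ, Fin.succAbove]
  · funext j
    have hM := mul_diagonal_pow_mul_apply
      !![s * v, 1, s, 0; 0, 1, 0, r; s * v, 0, 0, 0; 0, 0, -(s * v * r)⁻¹, 0]
      !![0, 1, 0, 0; 1, 0, 0, 0; 1, 1, 0, 1; 1, 0, 1, 0] d j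
    generalize !![s * v, 1, s, 0; 0, 1, 0, r; s * v, 0, 0, 0; 0, 0, -(s * v * r)⁻¹, 0] *
      diagonal d ^ j * !![0, 1, 0, 0; 1, 0, 0, 0; 1, 1, 0, 1; 1, 0, 1, 0] = M at hM ⊢
    have e1 : M 0 0 = s * D 2 j + D 1 j := by
      simp [hM, Fin.sum_univ_four, hD]
      ring
    have e2 : minorTwo M = -s * (v * D 0 j + D 2 j) * (r * D 3 j + D 1 j) := by
      simp [minorTwo, hM, Fin.sum_univ_four, hD]
      ring
    have e3 : minorThree M = -(s * r * v) * (D 0 j * D 3 j) * (s * D 2 j + D 1 j) := by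
      simp [minorThree, hM, Fin.sum_univ_four, hD]
      ring
    simp only [minorForm, e1, e2, e3, Pi.smul_apply, Pi.mul_apply, Pi.pow_apply, Pi.add_apply,
      smul_eq_mul, mul_pow, pow_add]
    ring

theorem pow_mem_minorSpan [CharP F p] (hp : p.Prime) (habc : a + b + c < p) {ω : F}
    (hω : a + b + c < orderOf ω) (d : Fin 4 → F) {x z : ℕ} (hx : x ≤ b) (hz : z ≤ a + c) :
    (fun j => (d 2 ^ (z + (b - x)) * d 1 ^ (a + c - z + (b - x)) * (d 0 * d 3) ^ (x + c)) ^ j) ∈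
      minorSpan a b c d := by
  let D : Fin 4 → ℕ → F := fun k j => d k ^ j
  have h1 : ∀ s v r : F, s ≠ 0 → v ≠ 0 → r ≠ 0 → (s • D 2 + D 1) ^ (a + c) * ((v • D 0 + D 2) ^ b *
      ((r • D 3 + D 1) ^ b * (D 0 * D 3) ^ c)) ∈ minorSpan a b c d :=
    fun s v r hs hv hr => mem_minorSpan d hr hs hv D fun _ _ => rfl
  have h2 : ∀ v r : F, v ≠ 0 → r ≠ 0 → (v • D 0 + D 2) ^ b * (D 2 ^ z * D 1 ^ (a + c - z) *
      ((r • D 3 + D 1) ^ b * (D 0 * D 3) ^ c)) ∈ minorSpan a b c d := by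
    intro v r hv hr
    rw [mul_left_comm]
    exact Submodule.pow_mul_pow_mem hp (by omega) _ (ω := ω) (by omega) (fun s hs => h1 s v r hs hv hr) hz
  have h3 : ∀ r : F, r ≠ 0 → (r • D 3 + D 1) ^ b * (D 0 ^ x * D 2 ^ (b - x) *
      (D 2 ^ z * D 1 ^ (a + c - z) * (D 0 * D 3) ^ c)) ∈ minorSpan a b c d := by
    intro r hr
    have := Submodule.pow_mul_pow_mem hp (by omega) _ (ω := ω) (by omega) (fun v hv => h2 v r hv hr) hx
    convert this using 1
    ring
  have h4 := Submodule.pow_mul_pow_mem hp (by omega) _ (ω := ω) (by omega) h3 hx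
  convert h4 using 1
  funext j
  simp only [D, Pi.mul_apply, Pi.pow_apply]
  simp only [mul_pow, ← pow_mul, pow_add]
  ring

end

section

variable {F : Type*} [Field F] {p m q A B : ℕ} {σ : F →+* F} {f : unitaryJ σ → F}

theorem Submodule.prod_mem_prod {ι R A : Type*} [CommSemiring R] [CommSemiring A] [Algebra R A]
    (s : Finset ι) {M : ι → Submodule R A} {x : ι → A} (h : ∀ i ∈ s, x i ∈ M i) :
    ∏ i ∈ s, x i ∈ ∏ i ∈ s, M i := by
  classical
  induction s using Finset.induction_on with
  | empty => exact Submodule.one_le.1 le_rfl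
  | insert i s hi ih =>
    rw [Finset.prod_insert hi, Finset.prod_insert hi]
    exact Submodule.mul_mem_mul (h i (Finset.mem_insert_self ..))
      (ih fun j hj => h j (Finset.mem_insert_of_mem hj))

namespace IsWeightFunction

theorem sum_twistedForm_eq_zero [ExpChar F p] (h : IsUnitaryField F p m q σ)
    (hp : 5 ≤ p) (hf : IsWeightFunction σ p A B f) (hA : A < q ^ 2 - 1) (hB : B < q - 1)
    {x : unitaryJ σ}
    (hx : p * orderOf (x : projUnitary σ) ∉ elementOrders (projUnitary σ))
    {s t : Fin m → Matrix (Fin 4) (Fin 4) F} (hs : ∀ i, (s i).det = 1) (ht : ∀ i, (t i).det = 1) :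
    ∑ j ∈ Finset.range (orderOf (x : projUnitary σ)),
      twistedForm (fun i => A / p ^ (i : ℕ) % p) (fun i => B / p ^ (i : ℕ) % p)
      (fun i => A / p ^ ((i : ℕ) + m) % p) (s * twist F p m (mat x) ^ j * t) = 0 := by
  have hφ : IsRestricted p (twistedForm (F := F) (fun i : Fin m => A / p ^ (i : ℕ) % p)
      (fun i => B / p ^ (i : ℕ) % p) (fun i => A / p ^ ((i : ℕ) + m) % p)) :=
    isRestricted_twistedForm fun i => (hf.digit_add_lt h hp hA hB i).trans_le (Nat.sub_le _ _)
  have h1 := hf.apply_one_ne_zero h hp hA hB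
  have h2 : ∀ a b : unitaryJ σ, ∑ j ∈ Finset.range (orderOf (x : projUnitary σ)),
      twistedForm (fun i => A / p ^ (i : ℕ) % p) (fun i => B / p ^ (i : ℕ) % p)
      (fun i => A / p ^ ((i : ℕ) + m) % p)
      (twist F p m (mat a) * twist F p m (mat x) ^ j * twist F p m (mat b)) = 0 := by
    intro a b
    refine (mul_eq_zero.1 ?_).resolve_right h1
    rw [Finset.sum_mul, ← hf.mem x hx a b]
    refine Finset.sum_congr rfl fun j _ => ?_
    rw [hf.apply_eq_twistedForm h hp hA hB (a * x ^ j * b)]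
    simp only [map_mul, map_pow]
  refine mem_densityMonoid.1 (h.mem_densityMonoid_of_det_eq_one t ht) _
    (IsRestricted.sum _ fun j => hφ.mul_left (s * twist F p m (mat x) ^ j)) fun b => ?_
  refine mem_densityMonoid.1 (h.mem_densityMonoid_of_det_eq_one s hs)
    (fun s => ∑ j ∈ Finset.range (orderOf (x : projUnitary σ)), twistedForm _ _ _
      (s * twist F p m (mat x) ^ j * twist F p m (mat b))) ?_ fun a => h2 a b
  simp only [mul_assoc]
  exact IsRestricted.sum _ fun j => hφ.mul_right (twist F p m (mat x) ^ j * twist F p m (mat b))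

theorem sum_prod_eq_zero [ExpChar F p] (h : IsUnitaryField F p m q σ)
    (hp : 5 ≤ p) (hf : IsWeightFunction σ p A B f) (hA : A < q ^ 2 - 1) (hB : B < q - 1)
    {x : unitaryJ σ}
    (hx : p * orderOf (x : projUnitary σ) ∉ elementOrders (projUnitary σ))
    {P Q : Matrix (Fin 4) (Fin 4) F} (hP : P.det = 1) (hPQ : P * Q = 1) {d : Fin 4 → F}
    (hxd : mat x = P * diagonal d * Q) {w : Fin m → ℕ → F}
    (hw : ∀ i : Fin m, w i ∈ minorSpan (A / p ^ (i : ℕ) % p) (B / p ^ (i : ℕ) % p)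
      (A / p ^ ((i : ℕ) + m) % p) fun k => d k ^ p ^ (i : ℕ)) :
    ∑ j ∈ Finset.range (orderOf (x : projUnitary σ)), ∏ i, w i j = 0 := by
  let l : (ℕ → F) →ₗ[F] F :=
    ∑ j ∈ Finset.range (orderOf (x : projUnitary σ)), LinearMap.proj j
  have hl : ∀ v, l v = ∑ j ∈ Finset.range (orderOf (x : projUnitary σ)), v j := fun v => by
    simp [l]
  have hQ : Q.det = 1 := by
    have := congrArg det hPQ
    rwa [det_mul, hP, one_mul, det_one] at this
  have hx' : ∀ j : ℕ, twist F p m (mat x) ^ j =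
      twist F p m P * twist F p m (diagonal d) ^ j * twist F p m Q := by
    intro j
    have hQP : Q * P = 1 := mul_eq_one_comm.1 hPQ
    rw [hxd, ← map_pow, ← map_pow, ← map_mul, ← map_mul]
    congr 1
    induction j with
    | zero => simp [hPQ]
    | succ j ih =>
      rw [pow_succ, ih, pow_succ]
      simp only [mul_assoc]
      rw [← mul_assoc Q P, hQP, one_mul]
  have hdet : ∀ M : Matrix (Fin 4) (Fin 4) F, M.det = 1 → ∀ i, (twist F p m M i).det = 1 := by
    intro M hM i
    rw [twist_apply, ← RingHom.mapMatrix_apply, ← RingHom.map_det, hM, map_one]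
  have key : ∏ i, w i ∈ LinearMap.ker l := by
    have h1 := Submodule.prod_span Finset.univ (R := F) (A := ℕ → F) fun i : Fin m =>
      {w | ∃ X Y : Matrix (Fin 4) (Fin 4) F, X.det = 1 ∧ Y.det = 1 ∧
        w = fun j => minorForm (A / p ^ (i : ℕ) % p) (B / p ^ (i : ℕ) % p)
          (A / p ^ ((i : ℕ) + m) % p) (X * diagonal (fun k => d k ^ p ^ (i : ℕ)) ^ j * Y)}
    have h2 : ∏ i, w i ∈ ∏ i : Fin m, minorSpan (A / p ^ (i : ℕ) % p) (B / p ^ (i : ℕ) % p)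
        (A / p ^ ((i : ℕ) + m) % p) fun k => d k ^ p ^ (i : ℕ) :=
      Submodule.prod_mem_prod _ fun i _ => hw i
    simp only [minorSpan] at h2
    rw [h1] at h2
    refine Submodule.span_le.2 ?_ h2
    intro v hv
    obtain ⟨g, hg, rfl⟩ := (Set.mem_finsetProd _ _ _).1 hv
    choose X Y hX hY hXY using fun i => hg (Finset.mem_univ i)
    rw [SetLike.mem_coe, LinearMap.mem_ker, hl]
    have h3 := hf.sum_twistedForm_eq_zero h hp hA hB hx
      (s := X * twist F p m Q) (t := twist F p m P * Y)
      (fun i => by rw [Pi.mul_apply, det_mul, hX, hdet Q hQ, mul_one])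
      (fun i => by rw [Pi.mul_apply, det_mul, hY, hdet P hP, mul_one])
    rw [← h3]
    refine Finset.sum_congr rfl fun j _ => ?_
    have h4 : X * twist F p m Q * twist F p m (mat x) ^ j * (twist F p m P * Y) =
        fun i => X i * diagonal (fun k => d k ^ p ^ (i : ℕ)) ^ j * Y i := by
      have h5 : twist F p m Q * twist F p m P = 1 := by
        rw [← map_mul, mul_eq_one_comm.1 hPQ, map_one]
      have h6 : X * twist F p m Q * twist F p m (mat x) ^ j * (twist F p m P * Y) =
          X * (twist F p m Q * twist F p m P) * twist F p m (diagonal d) ^ j *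
            (twist F p m Q * twist F p m P) * Y := by
        rw [hx']
        simp only [mul_assoc]
      rw [h6, h5, mul_one, mul_one]
      funext i
      rw [Pi.mul_apply, Pi.mul_apply, Pi.pow_apply, twist_apply, diagonal_map (map_zero _)]
      simp only [iterateFrobenius_def]
    rw [h4, Finset.prod_apply]
    exact Finset.prod_congr rfl fun i _ => congrFun (hXY i) j
  rw [LinearMap.mem_ker, hl] at key
  simpa only [Finset.prod_apply] using key

end IsWeightFunction

end

section

theorem exists_odd_pow_succ_dvd {p : ℕ} (hp : Odd p) (m : ℕ) :
    ∃ k, Odd k ∧ p ^ m + 1 ∣ (p + 1) * k := by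
  rcases m.even_or_odd with ⟨j, rfl⟩ | ⟨j, rfl⟩
  · obtain ⟨t, ht⟩ := hp.pow (n := j)
    obtain ⟨u, hu⟩ := hp
    refine ⟨2 * (t ^ 2 + t) + 1, odd_two_mul_add_one _, u + 1, ?_⟩
    rw [pow_add, ht, hu]
    ring
  · suffices ∃ k, Odd k ∧ p ^ (2 * j + 1) + 1 = (p + 1) * k from
      this.imp fun k hk => ⟨hk.1, hk.2.dvd⟩
    induction j with
    | zero => exact ⟨1, odd_one, by ring⟩
    | succ j ih =>
      obtain ⟨k, ⟨s, rfl⟩, hk⟩ := ih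
      obtain ⟨t, rfl⟩ := hp
      refine ⟨(2 * t + 1) * (2 * ((2 * t + 1) * s + t)) + 1, ?_, ?_⟩
      · exact ⟨(2 * t + 1) * ((2 * t + 1) * s + t), by ring⟩
      · have : (2 * t + 1) ^ (2 * (j + 1) + 1) = (2 * t + 1) ^ 2 * (2 * t + 1) ^ (2 * j + 1) := by
          ring
        rw [this]
        nlinarith

variable {F : Type*} [Field F] {p m q : ℕ} {σ : F →+* F}

namespace IsUnitaryField

theorem exists_two_element (h : IsUnitaryField F p m q σ) :
    ∃ (x : unitaryJ σ) (P Q : Matrix (Fin 4) (Fin 4) F) (d : Fin 4 → F) (e : ℕ),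
      P.det = 1 ∧ P * Q = 1 ∧ mat x = P * diagonal d * Q ∧ d 1 = 1 ∧ d 0 * d 3 * d 2 = 1 ∧
      d 2 ^ (p + 1) = 1 ∧ orderOf (x : projUnitary σ) = 2 ^ e ∧
      p * orderOf (x : projUnitary σ) ∉ elementOrders (projUnitary σ) := by
  have h2 := h.two_ne_zero
  have hq3 := h.q_ge
  obtain ⟨e, c, hc, hec⟩ : ∃ e c, Odd c ∧ q ^ 2 - 1 = 2 ^ (e + 1) * c := by
    have h1 : q ^ 2 - 1 ≠ 0 := by
      have : 3 ^ 2 ≤ q ^ 2 := Nat.pow_le_pow_left hq3 2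
      omega
    obtain ⟨e, c, hc, hec⟩ := Nat.exists_eq_two_pow_mul_odd h1
    rcases e with _ | e
    · exfalso
      obtain ⟨k, hk⟩ := h.q_odd.pow (n := 2)
      obtain ⟨l, hl⟩ := hc
      omega
    · exact ⟨e, c, hc, hec⟩
  obtain ⟨θ, hθ⟩ := h.exists_orderOf ⟨c, hec⟩
  have hq2 : (q - 1) * (q + 1) = q ^ 2 - 1 := by
    have := Nat.sq_sub_sq q 1
    rw [one_pow] at this
    rw [this, mul_comm]
  have hθ0 : θ ≠ 0 := by
    rintro rfl
    rw [orderOf_zero] at hθ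
    exact absurd hθ.symm (by positivity)
  have hσ0 : σ θ ≠ 0 := (map_ne_zero σ).2 hθ0
  obtain ⟨ρ, hρ⟩ : ∃ ρ, ρ = σ θ / θ := ⟨_, rfl⟩
  have hρθ : ρ * θ = σ θ := by rw [hρ]; field_simp
  have hρσ : σ ρ * ρ = 1 := by
    rw [hρ, map_div₀, h.invol]; field_simp
  have hρp : ρ ^ (p + 1) = 1 := by
    have h1 : ρ = θ ^ (q - 1) := by
      rw [hρ, h.conj, div_eq_iff hθ0, ← pow_succ]; congr 1; omega
    rw [h1, ← pow_mul, ← orderOf_dvd_iff_pow_eq_one, hθ]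
    obtain ⟨k, hk, hd⟩ := exists_odd_pow_succ_dvd h.odd m
    rw [← h.q_eq] at hd
    have hcop : Nat.Coprime (2 ^ (e + 1)) k := (Nat.coprime_two_left.2 hk).pow_left _
    refine hcop.dvd_of_dvd_mul_right ?_
    rw [mul_assoc]
    exact (Dvd.intro _ hec.symm).trans (hq2 ▸ mul_dvd_mul_left _ hd)
  have hP : (!![1, 0, 0, 0; 0, 1, 1, 0; 0, -1 / 2, 1 / 2, 0; 0, 0, 0, 1] :
      Matrix (Fin 4) (Fin 4) F) * !![1, 0, 0, 0; 0, 1 / 2, -1, 0; 0, 1 / 2, 1, 0; 0, 0, 0, 1] =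
      1 := by
    rw [← Matrix.ext_iff]
    simp [Fin.forall_fin_succ, Matrix.mul_apply, Fin.sum_univ_succ, Matrix.one_apply]
    split_ands <;> field_simp <;> ring1
  have hPd : (!![1, 0, 0, 0; 0, 1, 1, 0; 0, -1 / 2, 1 / 2, 0; 0, 0, 0, 1] :
      Matrix (Fin 4) (Fin 4) F).det = 1 := by
    simp [det_succ_row_zero, Fin.sum_univ_succ, Fin.succAbove]
    field_simp
    ring1
  obtain ⟨P, hP'⟩ : ∃ P : Matrix (Fin 4) (Fin 4) F,
    P = !![1, 0, 0, 0; 0, 1, 1, 0; 0, -1 / 2, 1 / 2, 0; 0, 0, 0, 1] := ⟨_, rfl⟩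
  obtain ⟨Q, hQ'⟩ : ∃ Q : Matrix (Fin 4) (Fin 4) F,
    Q = !![1, 0, 0, 0; 0, 1 / 2, -1, 0; 0, 1 / 2, 1, 0; 0, 0, 0, 1] := ⟨_, rfl⟩
  obtain ⟨d, hd⟩ : ∃ d : Fin 4 → F, d = ![θ, 1, ρ, (σ θ)⁻¹] := ⟨_, rfl⟩
  rw [← hP', ← hQ'] at hP
  rw [← hP'] at hPd
  have hQP : Q * P = 1 := mul_eq_one_comm.1 hP
  obtain ⟨M, hM⟩ : ∃ M, M = P * diagonal d * Q := ⟨_, rfl⟩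
  have hMe : M = !![θ, 0, 0, 0; 0, (1 + ρ) / 2, ρ - 1, 0; 0, (ρ - 1) / 4, (1 + ρ) / 2, 0;
      0, 0, 0, (σ θ)⁻¹] := by
    rw [hM, hP', hQ', hd, ← Matrix.ext_iff]
    have h4 : (4 : F) ≠ 0 := by
      have : (4 : F) = 2 * 2 := by norm_num
      rw [this]; exact mul_ne_zero h2 h2
    simp [Fin.forall_fin_succ, Matrix.mul_apply, Fin.sum_univ_succ, vecMul_diagonal]
    split_ands <;> field_simp <;> ring1
  have hMd : M.det = 1 := by
    rw [hM, mul_assoc, det_mul_comm, mul_assoc, hQP, mul_one, det_diagonal, hd]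
    simp [Fin.prod_univ_succ]
    field_simp
    rw [← hρθ]; ring1
  have hMf : (M.map σ)ᵀ * antiDiag F * M = antiDiag F := by
    rw [hMe, ← Matrix.ext_iff]
    have h4 : (4 : F) ≠ 0 := by
      have : (4 : F) = 2 * 2 := by norm_num
      rw [this]; exact mul_ne_zero h2 h2
    simp [Fin.forall_fin_succ, antiDiag, Matrix.mul_apply, Fin.sum_univ_succ, h.invol, map_ofNat]
    split_ands <;> field_simp <;>
      first | ring1 | linear_combination (8 : F) * hρσ | linear_combination (2 : F) * hρσ
  have hMpow : ∀ k, M ^ k = P * diagonal d ^ k * Q := by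
    intro k
    induction k with
    | zero => simp [hP]
    | succ k ih =>
      rw [pow_succ, ih, hM, pow_succ]
      simp only [mul_assoc]
      rw [← mul_assoc Q P, hQP, one_mul]
  have hord : orderOf ((mkForm M hMd hMf : unitaryJ σ) : projUnitary σ) = 2 ^ (e + 1) := by
    refine Nat.dvd_antisymm ((h.orderOf_dvd_iff _ _).2 ⟨1, ?_⟩) ?_
    · have h1 : θ ^ 2 ^ (e + 1) = 1 := by rw [← hθ, pow_orderOf_eq_one]
      have h3 : d ^ 2 ^ (e + 1) = 1 := by
        rw [hd]
        funext i
        fin_cases i <;> simp [h1, hρ, div_pow, ← map_pow]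
      rw [mat_mkForm, hMpow, diagonal_pow, h3, Pi.one_def, diagonal_one, mul_one, hP, one_smul]
    · obtain ⟨ζ, hζ⟩ := (h.orderOf_dvd_iff (mkForm M hMd hMf : unitaryJ σ) _).1 dvd_rfl
      rw [mat_mkForm, hMpow] at hζ
      generalize orderOf ((mkForm M hMd hMf : unitaryJ σ) : projUnitary σ) = k at hζ ⊢
      have h1 : diagonal d ^ k = ζ • (1 : Matrix (Fin 4) (Fin 4) F) := by
        calc diagonal d ^ k = Q * (P * diagonal d ^ k * Q) * P := by
              simp only [mul_assoc]
              rw [hQP, mul_one, ← mul_assoc, hQP, one_mul]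
          _ = _ := by rw [hζ, mul_smul_comm, smul_mul_assoc, mul_one, hQP]
      rw [diagonal_pow, ← Matrix.ext_iff] at h1
      have h3 := h1 0 0
      have h4 := h1 1 1
      simp [hd] at h3 h4
      rw [← hθ]
      exact orderOf_dvd_of_pow_eq_one (h3.trans h4.symm)
  refine ⟨mkForm M hMd hMf, P, Q, d, e + 1, hPd, hP, hM, by simp [hd], ?_, by simpa [hd], hord, ?_⟩
  · simp [hd]
    rw [← hρθ] at hσ0 ⊢
    have := left_ne_zero_of_mul hσ0
    field_simp
  · rw [hord]
    exact h.mul_two_pow_notMem_elementOrders hec hc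

end IsUnitaryField

end

section

variable {F : Type*} [Field F] {p m q A B : ℕ} {σ : F →+* F} {f : unitaryJ σ → F}

theorem minorTwo_levi_pow (hσ : ∀ x, σ (σ x) = x) (b : F) (j : ℕ) :
    minorTwo (mat (levi hσ 0 (-1) 1 b 1 (by ring) one_ne_zero (map_one σ) : unitaryJ σ) ^ j) = 1 := by
  suffices H : ∀ M : Matrix (Fin 4) (Fin 4) F,
      M = mat (levi hσ 0 (-1) 1 b 1 (by ring) one_ne_zero (map_one σ) : unitaryJ σ) ^ j →
      M 0 2 = 0 ∧ M 0 3 = 0 ∧ M 1 2 = 0 ∧ M 1 3 = 0 ∧ minorTwo M = 1 from (H _ rfl).2.2.2.2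
  induction j with
  | zero => rintro _ rfl; simp [minorTwo]
  | succ j ih =>
    obtain ⟨h1, h2, h3, h4, h5⟩ := ih _ rfl
    rintro _ rfl
    rw [pow_succ, mat_levi]
    rw [mat_levi] at h1 h2 h3 h4 h5
    simp only [minorTwo] at h5
    simp [minorTwo, Matrix.mul_apply, Fin.sum_univ_succ] at h1 h2 h3 h4 h5 ⊢
    simp [h1, h2, h3, h4]
    linear_combination h5

theorem IsWeightFunction.weight_ne_zero (h : IsUnitaryField F p m q σ) (hp : 5 ≤ p)
    (hf : IsWeightFunction σ p A B f) (hA : A < q ^ 2 - 1) (hB : B < q - 1) : A ≠ 0 := by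
  rintro rfl
  have := h.charP
  obtain ⟨N, hN⟩ := h.gcd_dvd
  have hN' : N * Nat.gcd 4 (q + 1) = (q ^ 2 + 1) * (q - 1) := by rw [hN, mul_comm]
  obtain ⟨s, hs, hs2, hsq⟩ := exists_odd_prime_dvd_sq_add_one h.q_odd h.q_ge
  obtain ⟨b, hb⟩ := h.exists_mem_of_dvd_sq_add_one hs hs2 hsq
  have hdq := Nat.gcd_dvd_right 4 (q + 1)
  have hpN : ¬ p ∣ N := by
    intro hd
    have h1 : p ∣ (q ^ 2 + 1) * (q - 1) := hN' ▸ hd.mul_right _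
    have h2 : 1 ≤ q := h.q_ge.trans' (by norm_num)
    have h3 : p ∣ 1 := by
      rcases h.prime.dvd_mul.1 h1 with h1 | h1
      · exact (Nat.dvd_add_right (h.p_dvd_q.trans (dvd_pow_self q _root_.two_ne_zero))).1 h1
      · have := Nat.dvd_sub h.p_dvd_q h1
        rwa [Nat.sub_sub_self h2] at this
    exact h.prime.one_lt.not_ge (Nat.le_of_dvd one_pos h3)
  have h1 := h.orderOf_dvd_of_prime_dvd_sq_add_one hs hs2 hsq hb hN' hdq
  have h2 := hf.mem (levi h.invol 0 (-1) 1 b 1 (by ring) one_ne_zero (map_one σ) : unitaryJ σ) (by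
    rintro ⟨y, hy⟩
    obtain ⟨y, rfl⟩ := QuotientGroup.mk_surjective y
    have h2 := h.orderOf_dvd_of_prime_dvd_sq_add_one hs hs2 hsq (y := y)
      (by rw [hy]; exact hb.mul_left p) hN' hdq
    rw [hy] at h2
    exact hpN ((dvd_mul_right p _).trans h2)) 1 1
  have h3 := hf.apply_one_ne_zero h hp hA hB
  simp only [one_mul, mul_one] at h2
  rw [Finset.sum_congr rfl (g := fun _ => f 1) fun j _ => by
    rw [hf.apply_eq h hp hA hB (_ ^ j), map_pow, minorTwo_levi_pow, pow_zero, one_pow, one_mul,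
      one_mul]] at h2
  rw [Finset.sum_const, Finset.card_range, nsmul_eq_mul, mul_eq_zero, or_iff_left h3,
    CharP.cast_eq_zero_iff F p] at h2
  exact hpN (h2.trans h1)

end

section

open Pointwise in
theorem one_mem_prod_of_inv_mem {K ι : Type*} [Field K] [Fintype ι] {S : ι → Set K} {ρ : K}
    (hρ : ρ ≠ 0) (hS : ∀ i, 1 ∈ S i ∨ ρ ∈ S i ∧ ρ⁻¹ ∈ S i) {i₀ : ι} (h1 : 1 ∈ S i₀)
    (h2 : ρ ∈ S i₀ ∨ ρ⁻¹ ∈ S i₀) : 1 ∈ ∏ i, S i := by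
  classical
  wlog h3 : ρ ∈ S i₀ generalizing ρ
  · refine this (inv_ne_zero hρ) (fun i => ?_) ?_ (h2.resolve_left h3) <;> rw [inv_inv]
    · exact (hS i).imp_right And.symm
    · exact h2.symm
  have key : ∀ s : Finset ι, 1 ∈ ∏ i ∈ s, S i ∨ ρ⁻¹ ∈ ∏ i ∈ s, S i := by
    intro s
    induction s using Finset.induction_on with
    | empty => exact Or.inl (by simp)
    | insert i s hi ih =>
      rw [Finset.prod_insert hi]
      rcases hS i with h4 | ⟨h4, h5⟩ <;> rcases ih with ih | ih
      · exact Or.inl (by simpa using Set.mul_mem_mul h4 ih)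
      · exact Or.inr (by simpa using Set.mul_mem_mul h4 ih)
      · exact Or.inr (by simpa using Set.mul_mem_mul h5 ih)
      · exact Or.inl (by simpa [hρ] using Set.mul_mem_mul h4 ih)
  rw [← Finset.mul_prod_erase _ _ (Finset.mem_univ i₀)]
  rcases key (Finset.univ.erase i₀) with h4 | h4
  · simpa using Set.mul_mem_mul h1 h4
  · simpa [hρ] using Set.mul_mem_mul h3 h4

variable {F : Type*} [Field F] {p m q A B : ℕ} {σ : F →+* F} {f : unitaryJ σ → F}

theorem pow_mem_minorSpan_of_mul_eq_one [CharP F p] {a b c : ℕ} (hp : p.Prime)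
    (habc : a + b + c < p) {ω : F} (hω : a + b + c < orderOf ω) {d : Fin 4 → F} (h1 : d 1 = 1)
    (h2 : d 0 * d 3 * d 2 = 1) {x z : ℕ} (hx : x ≤ b) (hz : z ≤ a + c) {ζ : F}
    (hζ : ζ * d 2 ^ (x + c) = d 2 ^ (z + (b - x))) :
    (fun j => ζ ^ j) ∈ minorSpan a b c d := by
  convert pow_mem_minorSpan hp habc hω d hx hz using 3
  rw [h1, one_pow, mul_one, ← hζ, mul_assoc, ← mul_pow, mul_comm (d 2), h2, one_pow, mul_one]

theorem mem_minorSpan_cases [CharP F p] {a b c : ℕ} (hp : p.Prime)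
    (habc : a + b + c < p) {ω : F} (hω : a + b + c < orderOf ω) {d : Fin 4 → F} (h1 : d 1 = 1)
    (h2 : d 0 * d 3 * d 2 = 1) :
    ((fun j => (1 : F) ^ j) ∈ minorSpan a b c d ∨
      (fun j => d 2 ^ j) ∈ minorSpan a b c d ∧ (fun j => (d 2)⁻¹ ^ j) ∈ minorSpan a b c d) ∧
    (0 < a + c → (fun j => (1 : F) ^ j) ∈ minorSpan a b c d ∧
      ((fun j => d 2 ^ j) ∈ minorSpan a b c d ∨ (fun j => (d 2)⁻¹ ^ j) ∈ minorSpan a b c d)) := by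
  have h0 : d 2 ≠ 0 := right_ne_zero_of_mul_eq_one h2
  have key : ∀ x ≤ b, ∀ z ≤ a + c, ∀ ζ : F, ζ * d 2 ^ (x + c) = d 2 ^ (z + (b - x)) →
      (fun j => ζ ^ j) ∈ minorSpan a b c d :=
    fun x hx z hz ζ hζ => pow_mem_minorSpan_of_mul_eq_one hp habc hω h1 h2 hx hz hζ
  have k1 : ∀ x ≤ b, ∀ z ≤ a + c, x + c = z + (b - x) →
      (fun j => (1 : F) ^ j) ∈ minorSpan a b c d := fun x hx z hz e =>
    key x hx z hz _ (by rw [one_mul, e])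
  have k2 : ∀ x ≤ b, ∀ z ≤ a + c, x + c + 1 = z + (b - x) →
      (fun j => d 2 ^ j) ∈ minorSpan a b c d := fun x hx z hz e =>
    key x hx z hz _ (by rw [← e, pow_succ'])
  have k3 : ∀ x ≤ b, ∀ z ≤ a + c, x + c = z + (b - x) + 1 →
      (fun j => (d 2)⁻¹ ^ j) ∈ minorSpan a b c d := fun x hx z hz e =>
    key x hx z hz _ (by rw [e, pow_succ', inv_mul_cancel_left₀ h0])
  rcases b.even_or_odd' with ⟨t, rfl | rfl⟩
  · have h3 := k1 t (by omega) c (by omega) (by omega)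
    refine ⟨Or.inl h3, fun hac => ⟨h3, ?_⟩⟩
    rcases Nat.eq_zero_or_pos a with ha | ha
    · exact Or.inr (k3 t (by omega) (c - 1) (by omega) (by omega))
    · exact Or.inl (k2 t (by omega) (c + 1) (by omega) (by omega))
  · have h3 := k2 t (by omega) c (by omega) (by omega)
    refine ⟨Or.inr ⟨h3, k3 (t + 1) (by omega) c (by omega) (by omega)⟩, fun hac => ⟨?_, Or.inl h3⟩⟩
    rcases Nat.eq_zero_or_pos a with ha | ha
    · exact k1 t (by omega) (c - 1) (by omega) (by omega)
    · exact k1 (t + 1) (by omega) (c + 1) (by omega) (by omega)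

theorem pow_pow_eq_or_eq_inv {x : F} (hx : x ^ (p + 1) = 1) (i : ℕ) :
    x ^ p ^ i = x ∨ x ^ p ^ i = x⁻¹ := by
  have h1 : x ^ p = x⁻¹ := eq_inv_of_mul_eq_one_left (by rw [← pow_succ, hx])
  induction i with
  | zero => simp
  | succ i ih =>
    rw [pow_succ, pow_mul]
    rcases ih with ih | ih <;> simp [ih, h1]

theorem exists_digit_add_pos (hA : A < p ^ (m + m)) (h0 : A ≠ 0) :
    ∃ i : Fin m, 0 < A / p ^ (i : ℕ) % p + A / p ^ ((i : ℕ) + m) % p := by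
  by_contra! H
  refine h0 ?_
  rw [← Nat.mod_eq_of_lt hA, ← sum_digit_mul_pow]
  refine Finset.sum_eq_zero fun i hi => ?_
  rw [Finset.mem_range] at hi
  rcases lt_or_ge i m with h1 | h1
  · have := H ⟨i, h1⟩
    dsimp only at this
    rw [show A / p ^ i % p = 0 by omega, zero_mul]
  · have := H ⟨i - m, by omega⟩
    dsimp only at this
    rw [Nat.sub_add_cancel h1] at this
    rw [show A / p ^ i % p = 0 by omega, zero_mul]

theorem IsUnitaryField.subsingleton_of_eq {V : Type*} [AddCommGroup V]
    [DistribMulAction (unitaryJ σ) V] (h : IsUnitaryField F p m q σ) (hp : 5 ≤ p)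
    (hV : IsUnitaryModule σ p V) : Subsingleton V := by
  by_contra hn
  rw [not_subsingleton_iff_nontrivial] at hn
  obtain ⟨A, B, f, hA, hB, hf⟩ := hV.exists_weightFunction h hp
  have := h.charP
  have := Fact.mk h.prime
  obtain ⟨x, P, Q, d, e, hP, hPQ, hx, hd1, hd2, hdp, he, hxp⟩ := h.exists_two_element
  obtain ⟨ω, hω⟩ := h.exists_orderOf dvd_rfl
  have hd0 : d 2 ≠ 0 := right_ne_zero_of_mul_eq_one hd2
  have hq : p - 1 ≤ q ^ 2 - 1 := Nat.sub_le_sub_right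
    (h.p_le_q.trans (Nat.le_self_pow _root_.two_ne_zero q)) 1
  have hdig := hf.digit_add_lt h hp hA hB
  have hcases := fun i : Fin m => mem_minorSpan_cases h.prime (ω := ω)
    (d := fun k => d k ^ p ^ (i : ℕ)) ((hdig i).trans_le (Nat.sub_le p 1))
    (by rw [hω]; exact (hdig i).trans_le hq) (by rw [hd1, one_pow])
    (by rw [← mul_pow, ← mul_pow, hd2, one_pow])
  obtain ⟨i₀, hi₀⟩ := exists_digit_add_pos (A := A) (by
    rw [← two_mul, mul_comm, pow_mul, ← h.q_eq]; omega) (hf.weight_ne_zero h hp hA hB)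
  have hρ := pow_pow_eq_or_eq_inv hdp
  obtain ⟨ζ, hζ, hζ1⟩ := (Set.mem_finsetProd _ _ _).1 <| one_mem_prod_of_inv_mem
    (S := fun i : Fin m => {ζ : F | (fun j => ζ ^ j) ∈ minorSpan (A / p ^ (i : ℕ) % p)
      (B / p ^ (i : ℕ) % p) (A / p ^ ((i : ℕ) + m) % p) fun k => d k ^ p ^ (i : ℕ)}) hd0 (i₀ := i₀)
    (fun i => by
      have := (hcases i).1
      rcases hρ i with h1 | h1 <;> simp only [h1, inv_inv] at this
      · exact this
      · exact this.imp_right And.symm) ((hcases i₀).2 hi₀).1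
    (by
      have := ((hcases i₀).2 hi₀).2
      rcases hρ i₀ with h1 | h1 <;> simp only [h1, inv_inv] at this
      · exact this
      · exact this.symm)
  have hsum := hf.sum_prod_eq_zero h hp hA hB hxp hP hPQ hx (w := fun i j => ζ i ^ j)
    fun i => hζ (Finset.mem_univ i)
  simp only [Finset.prod_pow, hζ1, one_pow, Finset.sum_const, Finset.card_range, nsmul_eq_mul,
    mul_one, he, Nat.cast_pow, Nat.cast_ofNat] at hsum
  exact pow_ne_zero e h.two_ne_zero hsum

end

theorem IsUnitaryField.subsingleton_of_isUnitaryModule {F : Type*} [Field F] {p m q r : ℕ}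
    {σ : F →+* F} {V : Type*} [AddCommGroup V] [DistribMulAction (unitaryJ σ) V]
    (h : IsUnitaryField F p m q σ) (hr : r.Prime) (hV : IsUnitaryModule σ r V) :
    Subsingleton V := by
  by_cases hrp : r = p
  · subst hrp
    rcases h.p_ge.eq_or_lt with rfl | h1
    · exact h.subsingleton_of_three hV
    · obtain ⟨k, hk⟩ := h.odd
      exact h.subsingleton_of_eq (by omega) hV
  · exact h.subsingleton_of_ne hV hr hrp

theorem isUnitaryField_iterateFrobenius {p m : ℕ} [Fact p.Prime] (hp : Odd p) {F : Type*} [Field F]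
    [Fintype F] [CharP F p] (hF : Fintype.card F = (p ^ m) ^ 2) :
    IsUnitaryField F p m (p ^ m) (iterateFrobenius F p m) where
  prime := Fact.out
  odd := hp
  charP := inferInstance
  m_pos := by
    rw [Nat.pos_iff_ne_zero]
    rintro rfl
    exact Fintype.one_lt_card.ne' (by simpa using hF)
  q_eq := rfl
  finite := inferInstance
  card := by rw [Nat.card_eq_fintype_card, hF]
  conj := iterateFrobenius_def p m

theorem nonempty_projUnitary_mulEquiv {p m : ℕ} [Fact p.Prime] (hp : Odd p) {F : Type*} [Field F]
    [Fintype F] [CharP F p] (hF : Fintype.card F = (p ^ m) ^ 2) :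
    Nonempty (SU4 p m F hF ⧸ Subgroup.center (SU4 p m F hF) ≃*
      projUnitary (iterateFrobenius F p m)) := by
  obtain ⟨C, hC⟩ := exists_antiDiag_congruence hp.pow hF
    (isUnitaryField_iterateFrobenius hp hF).two_ne_zero _ (iterateFrobenius_def p m)
  have e : SU4 p m F hF ≃* unitaryJ (iterateFrobenius F p m) :=
    (MulEquiv.subgroupCongr (SU4_eq_formGroup p m hF)).trans (formGroupEquiv _ _ _ C hC).symm
  exact ⟨QuotientGroup.congr _ _ e <| le_antisymm
    (Subgroup.map_le_iff_le_comap.2 fun x hx => (Subgroup.centerCongr e ⟨x, hx⟩).2)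
    fun x hx => ⟨e.symm x, (Subgroup.centerCongr e.symm ⟨x, hx⟩).2, e.apply_symm_apply x⟩⟩

/-- `PSU₄(q)` for `q = p^m` odd is recognizable by spectrum among covers: if a finite
group `H` has a normal subgroup `K` with `H ⧸ K ≅ PSU₄(q)` and `ω(H) = ω(PSU₄(q))`,
then `H ≅ PSU₄(q)`. -/
theorem psu4_recognizable_among_covers
    (p m : ℕ) [Fact p.Prime] (hp : Odd p)
    (F : Type) [Field F] [Fintype F] [CharP F p] (hF : Fintype.card F = (p ^ m) ^ 2)
    (H : Type) [Group H] [Finite H] (K : Subgroup H) [K.Normal]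
    (e : (H ⧸ K) ≃* ((SU4 p m F hF : Subgroup (SpecialLinearGroup (Fin 4) F)) ⧸
        Subgroup.center (SU4 p m F hF)))
    (hω : elementOrders H = elementOrders
        ((SU4 p m F hF : Subgroup (SpecialLinearGroup (Fin 4) F)) ⧸
          Subgroup.center (SU4 p m F hF))) :
    Nonempty (H ≃* ((SU4 p m F hF : Subgroup (SpecialLinearGroup (Fin 4) F)) ⧸
        Subgroup.center (SU4 p m F hF))) := by
  obtain ⟨i⟩ := nonempty_projUnitary_mulEquiv hp hF
  have h := isUnitaryField_iterateFrobenius hp hF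
  have := h.finite_projUnitary
  let φ : H →* projUnitary (iterateFrobenius F p m) :=
    (e.trans i).toMonoidHom.comp (QuotientGroup.mk' K)
  have hφ : Function.Surjective φ := (e.trans i).surjective.comp (QuotientGroup.mk'_surjective K)
  have hker : φ.ker = ⊥ := by
    by_contra hne
    have hω' : elementOrders H ⊆ elementOrders (projUnitary (iterateFrobenius F p m)) := by
      rw [hω]
      rintro _ ⟨g, rfl⟩
      exact ⟨i g, MulEquiv.orderOf_eq i g⟩
    obtain ⟨r, hr, V, _, _, _, _, hV⟩ := exists_spectralModule _ H φ rfl hφ hω' hne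
    obtain ⟨_, hV⟩ := hV.exists_unitaryModule
    exact not_subsingleton V (h.subsingleton_of_isUnitaryModule hr hV)
  exact ⟨(MulEquiv.ofBijective φ ⟨(MonoidHom.ker_eq_bot_iff φ).1 hker, hφ⟩).trans i.symm⟩
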